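/- arXiv:1601.06588 — 2 statements merged into one kernel-verified Lean document; each statement's English description precedes it below -/
import Mathlib

section
/- For the W(2,2) Lie conformal algebra 𝒲 with trivial coefficients ℂ, the basic cohomology satisfies: dim H̃⁰ = 1, dim H̃¹ = dim H̃² = 0, dim H̃³ = 2, dim H̃⁴ = dim H̃⁵ = dim H̃⁶ = 1, and H̃^q = 0 for q ≥ 7. -/
open MvPolynomial

/-! ### The basic complex of the W(2,2) Lie conformal algebra `𝒲` with
trivial coefficients `ℂ`.

`𝒲` is the free `ℂ[∂]`-module on `{L, M}` with `[L_λ L] = (∂+2λ)L`,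
`[L_λ M] = (∂+2λ)M`, `[M_λ M] = 0`.  Since `𝒲` is free over `ℂ[∂]` on the
basis `{L, M}` (encoded as `Fin 2`, `0 = L`, `1 = M`), a `q`-cochain is
determined, via conformal antilinearity, by its values on basis tuples; we
encode it as a function of a basis tuple `X : Fin q → Fin 2` and values of the
variables `λ : Fin q → ℂ`, polynomial in `λ` and skew-symmetric under
simultaneous permutations. -/

abbrev WCochain (q : ℕ) : Type := (Fin q → Fin 2) → (Fin q → ℂ) → ℂ

/-- the value is polynomial in the `λ`'s. -/
def IsPolyCochain {q : ℕ} (γ : WCochain q) : Prop :=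
  ∀ X, ∃ P : MvPolynomial (Fin q) ℂ, ∀ l, γ X l = eval l P

/-- skew-symmetry with respect to simultaneous permutations of the arguments
and the variables. -/
def IsSkewCochain {q : ℕ} (γ : WCochain q) : Prop :=
  ∀ σ : Equiv.Perm (Fin q), ∀ X l,
    γ (X ∘ σ) (l ∘ σ) = (Equiv.Perm.sign σ : ℤ) * γ X l

def IsCochain {q : ℕ} (γ : WCochain q) : Prop := IsPolyCochain γ ∧ IsSkewCochain γ

/-- scalar coefficient of `[x_λ y]` for basis elements: `0` iff `x = y = M`. -/
def bcoef (x y : Fin 2) : ℂ := if x = 1 ∧ y = 1 then 0 else 1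

/-- the basis element appearing in `[x_λ y]`: `[L L] ∝ L`, `[L M] ∝ M`,
`[M L] ∝ M`. -/
def bres (x y : Fin 2) : Fin 2 := max x y

/-- the tuple `X` with entries `i` and `j` removed (`i < j`); entry `k` of the
result is given, with junk value `d` out of range. -/
def removeTwo {α : Type*} {n : ℕ} (i j : Fin n) (X : Fin n → α) (d : α) : ℕ → α :=
  fun k => (((List.ofFn X).eraseIdx j.val).eraseIdx i.val).getD k d

/-- the differential of the basic complex with trivial coefficients:
`(dγ)_{λ₁,…,λ_{q+1}}(a₁,…,a_{q+1}) = ∑_{i<j} (−1)^{i+j}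
γ_{λᵢ+λⱼ,λ₁,…,λ̂ᵢ,…,λ̂ⱼ,…}([a_{i λᵢ} a_j],a₁,…,âᵢ,…,âⱼ,…)`; for basis
arguments, `[a_{i λᵢ} a_j]` contributes the factor `(λᵢ−λⱼ)·bcoef` on the
basis element `bres` placed in the first slot (by conformal antilinearity,
since the coefficients are trivial). -/
noncomputable def dW {q : ℕ} (γ : WCochain q) : WCochain (q + 1) :=
  fun X l =>
    ∑ p ∈ Finset.univ.filter (fun p : Fin (q+1) × Fin (q+1) => p.1 < p.2),
      (-1 : ℂ) ^ (p.1.val + p.2.val) * bcoef (X p.1) (X p.2) * (l p.1 - l p.2) *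
        γ (fun k => if k.val = 0 then bres (X p.1) (X p.2)
              else removeTwo p.1 p.2 X 0 (k.val - 1))
          (fun k => if k.val = 0 then l p.1 + l p.2
              else removeTwo p.1 p.2 l 0 (k.val - 1))

/-- `dW` as a linear map. -/
noncomputable def dWLin (q : ℕ) : WCochain q →ₗ[ℂ] WCochain (q + 1) where
  toFun := dW
  map_add' γ₁ γ₂ := by
    funext X l
    simp only [dW, Pi.add_apply, mul_add, Finset.sum_add_distrib]
  map_smul' c γ := by
    funext X l
    simp only [dW, Pi.smul_apply, smul_eq_mul, RingHom.id_apply, Finset.mul_sum]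
    exact Finset.sum_congr rfl fun p _ => by ring

/-- the `ℂ`-subspace of genuine cochains. -/
noncomputable def cochainSub (q : ℕ) : Submodule ℂ (WCochain q) where
  carrier := {γ | IsCochain γ}
  add_mem' := by
    rintro a b ⟨hap, has⟩ ⟨hbp, hbs⟩
    refine ⟨fun X => ?_, fun σ X l => ?_⟩
    · obtain ⟨P, hP⟩ := hap X; obtain ⟨Q, hQ⟩ := hbp X
      exact ⟨P + Q, fun l => by simp [hP, hQ]⟩
    · have := has σ X l; have := hbs σ X l
      simp only [Pi.add_apply, *]; ring
  zero_mem' := ⟨fun X => ⟨0, by simp⟩, fun σ X l => by simp⟩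
  smul_mem' := by
    rintro c γ ⟨hp, hs⟩
    refine ⟨fun X => ?_, fun σ X l => ?_⟩
    · obtain ⟨P, hP⟩ := hp X
      exact ⟨c • P, fun l => by simp [hP]⟩
    · have := hs σ X l
      simp only [Pi.smul_apply, smul_eq_mul, *]; ring

/-- basic `q`-cocycles. -/
noncomputable def cocycleSub (q : ℕ) : Submodule ℂ (WCochain q) :=
  cochainSub q ⊓ LinearMap.ker (dWLin q)

/-- basic `q`-coboundaries. -/
noncomputable def coboundSub : (q : ℕ) → Submodule ℂ (WCochain q)
  | 0 => ⊥
  | (q + 1) => Submodule.map (dWLin q) (cochainSub q)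

/-- the `q`-th basic cohomology `H̃^q(𝒲,ℂ)`. -/
noncomputable abbrev basicH (q : ℕ) :=
  cocycleSub q ⧸ Submodule.comap (cocycleSub q).subtype (coboundSub q)

/-- the action of `∂` on the basic complex with trivial coefficients:
`(∂γ)_{λ₁,…,λ_q} = (∑ᵢ λᵢ)·γ_{λ₁,…,λ_q}`. -/
noncomputable def paW (q : ℕ) : WCochain q →ₗ[ℂ] WCochain q where
  toFun γ := fun X l => (∑ i, l i) * γ X l
  map_add' γ₁ γ₂ := by funext X l; simp [mul_add]
  map_smul' c γ := by funext X l; simp; ring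

/-- reduced `q`-cocycles: cochains `γ` with `dγ ∈ ∂C̃^{q+1}`. -/
noncomputable def redZ (q : ℕ) : Submodule ℂ (WCochain q) :=
  cochainSub q ⊓
    Submodule.comap (dWLin q) (Submodule.map (paW (q+1)) (cochainSub (q+1)))

/-- reduced `q`-coboundaries: `dC̃^{q−1} + ∂C̃^q`. -/
noncomputable def redB : (q : ℕ) → Submodule ℂ (WCochain q)
  | 0 => Submodule.map (paW 0) (cochainSub 0)
  | (q + 1) => Submodule.map (dWLin q) (cochainSub q)
      ⊔ Submodule.map (paW (q+1)) (cochainSub (q+1))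

/-- the `q`-th reduced cohomology `H^q(𝒲,ℂ)`. -/
noncomputable abbrev reducedH (q : ℕ) :=
  redZ q ⧸ Submodule.comap (redZ q).subtype (redB q)

/-! ### Skew functions on words of generators -/

namespace W22

/-- `(0, a)` and `(1, a)` stand for the divided powers `λ^a / a!` placed on `L` and on `M`. -/
abbrev Gen : Type := Fin 2 × ℕ

/-- The structure constant of the bracket of two generators. -/
def scoef (x y : Gen) : ℤ := if x.1 = 1 ∧ y.1 = 1 then 0 else (x.2 : ℤ) - y.2

/-- The generator in the bracket of two generators. -/
def sres (x y : Gen) : Gen := (max x.1 y.1, x.2 + y.2 - 1)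

/-- The order on generators used to sort words. -/
def glt (x y : Gen) : Prop := x.1 < y.1 ∨ x.1 = y.1 ∧ x.2 < y.2

instance (x y : Gen) : Decidable (glt x y) := by unfold glt; infer_instance

lemma scoef_antisymm (x y : Gen) : scoef x y = -scoef y x := by
  by_cases h : x.1 = 1 <;> by_cases h' : y.1 = 1 <;> simp [scoef, h, h']

lemma sres_comm (x y : Gen) : sres x y = sres y x := by
  simp [sres, max_comm, add_comm]

lemma glt_irrefl (x : Gen) : ¬ glt x x := by simp [glt]

lemma glt_trichotomy (x y : Gen) : glt x y ∨ x = y ∨ glt y x := by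
  rcases lt_trichotomy x.1 y.1 with h | h | h
  · exact Or.inl (Or.inl h)
  · rcases lt_trichotomy x.2 y.2 with h' | h' | h'
    · exact Or.inl (Or.inr ⟨h, h'⟩)
    · exact Or.inr (Or.inl (Prod.ext h h'))
    · exact Or.inr (Or.inr (Or.inr ⟨h.symm, h'⟩))
  · exact Or.inr (Or.inr (Or.inl h))

lemma glt_asymm {x y : Gen} (h : glt x y) : ¬ glt y x := by
  unfold glt at *; omega

lemma glt_trans {x y z : Gen} (h : glt x y) (h' : glt y z) : glt x z := by
  unfold glt at *; omega

/-- Functions on words that change sign when two neighbouring letters are exchanged. -/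
def Skew (f : List Gen → ℂ) : Prop :=
  ∀ p x y l, f (p ++ x :: y :: l) = -f (p ++ y :: x :: l)

lemma Skew.cons {f : List Gen → ℂ} (hf : Skew f) (x : Gen) : Skew fun l => f (x :: l) :=
  fun p y z l => hf (x :: p) y z l

lemma Skew.swap {f : List Gen → ℂ} (hf : Skew f) (x y : Gen) (l : List Gen) :
    f (x :: y :: l) = -f (y :: x :: l) := hf [] x y l

lemma Skew.neg {f : List Gen → ℂ} (hf : Skew f) : Skew fun l => -f l :=
  fun p x y l => congrArg Neg.neg (hf p x y l)

lemma Skew.perm {f : List Gen → ℂ} (hf : Skew f) {l l' : List Gen} (h : l.Perm l') :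
    f l = f l' ∨ f l = -f l' := by
  induction h generalizing f with
  | nil => exact Or.inl rfl
  | cons x _ ih => exact ih (hf.cons x)
  | swap x y l => exact Or.inr (hf.swap y x l)
  | trans _ _ ih₁ ih₂ =>
    rcases ih₁ hf with h₁ | h₁ <;> rcases ih₂ hf with h₂ | h₂ <;> simp [h₁, h₂]

lemma Skew.eq_zero_of_self {f : List Gen → ℂ} (hf : Skew f) (x : Gen) (l : List Gen) :
    f (x :: x :: l) = 0 := self_eq_neg.mp (hf.swap x x l)

lemma Skew.eq_zero_of_mem {f : List Gen → ℂ} (hf : Skew f) {x : Gen} {l : List Gen}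
    (h : x ∈ l) : f (x :: l) = 0 := by
  have hp := (List.perm_cons_erase h).cons x
  rcases hf.perm hp with h' | h' <;> simp [h', hf.eq_zero_of_self]

lemma Skew.nodup {f : List Gen → ℂ} (hf : Skew f) {l : List Gen} (h : f l ≠ 0) : l.Nodup := by
  induction l generalizing f with
  | nil => exact List.nodup_nil
  | cons x l ih =>
    exact List.nodup_cons.mpr ⟨fun hx => h (hf.eq_zero_of_mem hx), ih (hf.cons x) h⟩

/-! ### The differential on words -/

/-- The sum over all letters `y` of `l`, replaced by the bracket of `x` and `y`. -/
def act (x : Gen) : List Gen → (List Gen → ℂ) → ℂ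
  | [], _ => 0
  | y :: l, f => scoef x y * f (sres x y :: l) + act x l fun h => f (y :: h)

/-- The Chevalley–Eilenberg differential, by recursion through Cartan's formula. -/
def diff : (List Gen → ℂ) → List Gen → ℂ
  | _, [] => 0
  | f, x :: l => -act x l f - diff (fun h => f (x :: h)) l

lemma act_neg (x : Gen) (l : List Gen) (f : List Gen → ℂ) :
    act x l (fun h => -f h) = -act x l f := by
  induction l generalizing f with
  | nil => simp [act]
  | cons y l ih => simp only [act, ih]; ring

lemma diff_neg (f : List Gen → ℂ) (l : List Gen) : diff (fun h => -f h) l = -diff f l := by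
  induction l generalizing f with
  | nil => simp [diff]
  | cons y l ih => simp only [diff, ih, act_neg]; ring

lemma act_add (x : Gen) (l : List Gen) (f g : List Gen → ℂ) :
    act x l (fun h => f h + g h) = act x l f + act x l g := by
  induction l generalizing f g with
  | nil => simp [act]
  | cons y l ih => simp only [act, ih]; ring

lemma diff_add (f g : List Gen → ℂ) (l : List Gen) :
    diff (fun h => f h + g h) l = diff f l + diff g l := by
  induction l generalizing f g with
  | nil => simp [diff]
  | cons y l ih => simp only [diff, ih, act_add]; ring

lemma Skew.act {f : List Gen → ℂ} (hf : Skew f) (x : Gen) : Skew fun l => act x l f := by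
  intro p y z l
  induction p generalizing f with
  | nil =>
    have h : (fun h => f (y :: z :: h)) = fun h => -f (z :: y :: h) :=
      funext fun h => hf.swap y z h
    simp only [List.nil_append, W22.act, h, act_neg, hf.swap (sres x y), hf.swap (sres x z)]
    ring
  | cons w p ih =>
    have h := hf (sres x w :: p) y z l
    simp only [List.cons_append] at h
    simp only [List.cons_append, W22.act, h, ih (hf.cons w)]
    ring

lemma Skew.diff {f : List Gen → ℂ} (hf : Skew f) : Skew (diff f) := by
  intro p y z l
  induction p generalizing f with
  | nil =>
    have h : (fun h => f (y :: z :: h)) = fun h => -f (z :: y :: h) :=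
      funext fun h => hf.swap y z h
    simp only [List.nil_append, W22.diff, W22.act, h, diff_neg, scoef_antisymm y z, sres_comm y z]
    push_cast
    ring
  | cons w p ih =>
    have h := hf.act w p y z l
    simp only at h
    simp only [List.cons_append, W22.diff, h, ih (hf.cons w)]
    ring

/-- The excess of the `λ`-degree over the arity. -/
def excess : List Gen → ℤ
  | [] => 0
  | x :: l => ((x.2 : ℤ) - 1) + excess l

lemma scoef_mul_excess (x y : Gen) (u : ℤ → ℂ) :
    (scoef x y : ℂ) * u (((sres x y).2 : ℤ) - 1) =
      scoef x y * u (((x.2 : ℤ) - 1) + ((y.2 : ℤ) - 1)) := by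
  by_cases h : x.2 + y.2 = 0
  · have hx : x.2 = 0 := by omega
    have hy : y.2 = 0 := by omega
    simp [scoef, hx, hy]
  · congr 2
    simp only [sres]
    omega

lemma act_excess_mul (u : ℤ → ℂ) (x : Gen) (l : List Gen) (f : List Gen → ℂ) :
    act x l (fun h => u (excess h) * f h) = u (excess (x :: l)) * act x l f := by
  induction l generalizing f u with
  | nil => simp [act]
  | cons y l ih =>
    have h := ih (fun t => u (((y.2 : ℤ) - 1) + t)) fun h => f (y :: h)
    have h' := scoef_mul_excess x y fun t => u (t + excess l)
    simp only [excess, act] at *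
    rw [h, ← mul_assoc, h', add_left_comm, ← add_assoc ((x.2 : ℤ) - 1)]
    ring

lemma diff_excess_mul (u : ℤ → ℂ) (f : List Gen → ℂ) (l : List Gen) :
    diff (fun h => u (excess h) * f h) l = u (excess l) * diff f l := by
  induction l generalizing f u with
  | nil => simp [diff]
  | cons y l ih =>
    have h := ih (fun t => u (((y.2 : ℤ) - 1) + t)) fun h => f (y :: h)
    simp only [diff, act_excess_mul, excess] at *
    rw [h]
    ring

lemma act_euler (f : List Gen → ℂ) (l : List Gen) :
    act (0, 1) l f = -excess l * f l := by
  induction l generalizing f with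
  | nil => simp [act, excess]
  | cons y l ih =>
    have h : sres (0, 1) y = y := Prod.ext (by simp [sres]) (by simp [sres])
    simp only [act, ih, h, excess, scoef]
    push_cast
    simp
    ring

/-- Contraction with `L` at `λ`-degree one inverts the differential off excess zero. -/
lemma diff_contract {f : List Gen → ℂ} {l : List Gen} (h : diff f ((0, 1) :: l) = 0) :
    diff (fun h => ((excess h : ℂ))⁻¹ * f ((0, 1) :: h)) l =
      if excess l = 0 then 0 else f l := by
  have h₁ := diff_excess_mul (fun t => (t : ℂ)⁻¹) (fun h => f ((0, 1) :: h)) l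
  rw [h₁]
  simp only [diff, act_euler] at h
  have h₂ : diff (fun h => f ((0, 1) :: h)) l = excess l * f l := by linear_combination -h
  rw [h₂]
  split_ifs with h₀
  · simp [h₀]
  · have : (excess l : ℂ) ≠ 0 := by exact_mod_cast h₀
    field_simp

/-! ### Normal forms -/

/-- Insertion of a letter into a sorted word, with sign. -/
def ins (x : Gen) : List Gen → ℤ × List Gen
  | [] => (1, [x])
  | y :: l =>
    if glt x y then (1, x :: y :: l)
    else if x = y then (0, [])
    else (-(ins x l).1, y :: (ins x l).2)

/-- The sorted form of a word, with sign. -/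
def norm : List Gen → ℤ × List Gen
  | [] => (1, [])
  | x :: l => ((norm l).1 * (ins x (norm l).2).1, (ins x (norm l).2).2)

lemma Skew.ins {f : List Gen → ℂ} (hf : Skew f) (x : Gen) (l : List Gen) :
    f (x :: l) = (ins x l).1 * f (ins x l).2 := by
  induction l generalizing f with
  | nil => simp [W22.ins]
  | cons y l ih =>
    unfold W22.ins
    split_ifs with h₁ h₂
    · simp
    · simp [h₂, hf.eq_zero_of_self]
    · rw [hf.swap, ih (hf.cons y)]
      push_cast
      ring

lemma Skew.norm {f : List Gen → ℂ} (hf : Skew f) (l : List Gen) :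
    f l = (norm l).1 * f (norm l).2 := by
  induction l generalizing f with
  | nil => simp [W22.norm]
  | cons x l ih =>
    rw [ih (hf.cons x), hf.ins x]
    simp only [W22.norm]
    push_cast
    ring

/-- The terms of `act`. -/
def actTerms (x : Gen) : List Gen → List (ℤ × List Gen)
  | [] => []
  | y :: l => (scoef x y, sres x y :: l) :: (actTerms x l).map fun p => (p.1, y :: p.2)

/-- The terms of `diff`. -/
def diffTerms : List Gen → List (ℤ × List Gen)
  | [] => []
  | x :: l => (actTerms x l).map (fun p => (-p.1, p.2)) ++
      (diffTerms l).map fun p => (-p.1, x :: p.2)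

/-- The terms of `diff`, in sorted form and without the vanishing ones. -/
def diffNorm (l : List Gen) : List (ℤ × List Gen) :=
  ((diffTerms l).map fun p => (p.1 * (norm p.2).1, (norm p.2).2)).filter fun p => p.1 ≠ 0

/-- Evaluation of a linear combination of words. -/
def evalTerms (t : List (ℤ × List Gen)) (f : List Gen → ℂ) : ℂ :=
  (t.map fun p => (p.1 : ℂ) * f p.2).sum

lemma act_eq_evalTerms (x : Gen) (l : List Gen) (f : List Gen → ℂ) :
    act x l f = evalTerms (actTerms x l) f := by
  induction l generalizing f with
  | nil => simp [act, actTerms, evalTerms]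
  | cons y l ih =>
    simp [act, ih, actTerms, evalTerms, Function.comp_def]

lemma sum_map_neg (t : List (ℤ × List Gen)) (f : ℤ × List Gen → ℂ) :
    (t.map fun p => -f p).sum = -(t.map f).sum := by
  induction t with
  | nil => simp
  | cons p t ih => simp only [List.map_cons, List.sum_cons, ih]; ring

lemma diff_eq_evalTerms (f : List Gen → ℂ) (l : List Gen) :
    diff f l = evalTerms (diffTerms l) f := by
  induction l generalizing f with
  | nil => simp [diff, diffTerms, evalTerms]
  | cons y l ih =>
    simp [diff, ih, act_eq_evalTerms, diffTerms, evalTerms, Function.comp_def,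
      sum_map_neg, sub_eq_add_neg]

lemma Skew.diff_eq {f : List Gen → ℂ} (hf : Skew f) (l : List Gen) :
    W22.diff f l = evalTerms (diffNorm l) f := by
  rw [diff_eq_evalTerms, diffNorm]
  induction diffTerms l with
  | nil => rfl
  | cons p t ih =>
    simp only [evalTerms, List.map_cons, List.sum_cons, List.filter_cons] at ih ⊢
    rw [ih, hf.norm p.2]
    split_ifs with h
    · simp; ring
    · have h' : p.1 * (W22.norm p.2).1 = 0 := by
        by_contra h'
        exact h (decide_eq_true h')
      rw [← mul_assoc, ← Int.cast_mul, h']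
      simp

/-! ### Skew functions with prescribed values on sorted words -/

/-- The composite of `v` with insertion of `x`. -/
def insFun (x : Gen) : (List Gen → ℂ) → List Gen → ℂ
  | v, [] => v [x]
  | v, y :: l =>
    if glt x y then v (x :: y :: l)
    else if x = y then 0
    else -insFun x (fun h => v (y :: h)) l

/-- The skew function that agrees with `v` on sorted words. -/
def skewExt : (List Gen → ℂ) → List Gen → ℂ
  | v, [] => v []
  | v, x :: l => skewExt (insFun x v) l

lemma insFun_neg (x : Gen) (v : List Gen → ℂ) (l : List Gen) :
    insFun x (fun h => -v h) l = -insFun x v l := by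
  induction l generalizing v with
  | nil => simp [insFun]
  | cons y l ih => simp only [insFun, ih]; split_ifs <;> simp

lemma insFun_zero (x : Gen) (l : List Gen) : insFun x (fun _ => 0) l = 0 := by
  induction l with
  | nil => simp [insFun]
  | cons y l ih => simp [insFun, ih]

lemma skewExt_neg (v : List Gen → ℂ) (l : List Gen) :
    skewExt (fun h => -v h) l = -skewExt v l := by
  induction l generalizing v with
  | nil => simp [skewExt]
  | cons y l ih =>
    have h : insFun y (fun h => -v h) = fun h => -insFun y v h := funext (insFun_neg y v)
    simp only [skewExt, h, ih]

lemma insFun_comm (x y : Gen) (v : List Gen → ℂ) (l : List Gen) :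
    insFun y (insFun x v) l = -insFun x (insFun y v) l := by
  induction l generalizing v with
  | nil =>
    rcases glt_trichotomy x y with h | rfl | h
    · have : x ≠ y := fun e => glt_irrefl x (e ▸ h)
      simp [insFun, h, glt_asymm h, this.symm]
    · simp [insFun, glt_irrefl]
    · have : x ≠ y := fun e => glt_irrefl y (e ▸ h)
      simp [insFun, h, glt_asymm h, this]
  | cons z l ih =>
    have ne {a b : Gen} (h : glt a b) : a ≠ b := fun e => glt_irrefl b (e ▸ h)
    rcases glt_trichotomy x z with hx | hx | hx <;> rcases glt_trichotomy y z with hy | hy | hy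
    · rcases glt_trichotomy x y with h | h | h
      · simp [insFun, hx, hy, h, glt_asymm h, (ne h).symm]
      · simp [insFun, hy, h, glt_irrefl]
      · simp [insFun, hx, hy, h, glt_asymm h, (ne h).symm]
    · subst hy
      simp [insFun, hx, glt_irrefl, glt_asymm hx, (ne hx).symm]
    · have h := glt_trans hx hy
      simp [insFun, hx, glt_asymm hy, (ne hy).symm, glt_asymm h, (ne h).symm]
    · subst hx
      simp [insFun, hy, glt_irrefl, glt_asymm hy, (ne hy).symm]
    · simp [insFun, hx, hy, glt_irrefl]
    · subst hx
      simp [insFun, glt_irrefl, glt_asymm hy, (ne hy).symm, insFun_zero]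
    · have h := glt_trans hy hx
      simp [insFun, hy, glt_asymm hx, (ne hx).symm, glt_asymm h, (ne h).symm]
    · subst hy
      simp [insFun, glt_irrefl, glt_asymm hx, (ne hx).symm, insFun_zero]
    · simp [insFun, glt_asymm hx, (ne hx).symm, glt_asymm hy, (ne hy).symm, insFun_neg, ih]

lemma skew_skewExt (v : List Gen → ℂ) : Skew (skewExt v) := by
  intro p x y l
  induction p generalizing v with
  | nil =>
    have h : insFun y (insFun x v) = fun h => -insFun x (insFun y v) h :=
      funext (insFun_comm x y v)
    simp only [List.nil_append, skewExt, h, skewExt_neg]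
  | cons z p ih => exact ih (insFun z v)

lemma skewExt_eq (v : List Gen → ℂ) {l : List Gen} (h : l.Pairwise glt) : skewExt v l = v l := by
  induction l generalizing v with
  | nil => rfl
  | cons x l ih =>
    rw [List.pairwise_cons] at h
    rw [skewExt, ih _ h.2]
    cases l with
    | nil => rfl
    | cons y l => simp [insFun, h.1 y]

lemma exists_perm_of_insFun {x : Gen} {v : List Gen → ℂ} {l : List Gen} (h : insFun x v l ≠ 0) :
    ∃ b, b.Perm (x :: l) ∧ v b ≠ 0 := by
  induction l generalizing v with
  | nil => exact ⟨[x], .refl _, h⟩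
  | cons y l ih =>
    unfold insFun at h
    split_ifs at h with h₁ h₂
    · exact ⟨_, .refl _, h⟩
    · exact absurd rfl h
    · obtain ⟨b, hb, hv⟩ := ih (neg_ne_zero.mp h)
      exact ⟨y :: b, (hb.cons y).trans (.swap x y l), hv⟩

lemma exists_perm_of_skewExt {v : List Gen → ℂ} {l : List Gen} (h : skewExt v l ≠ 0) :
    ∃ b, b.Perm l ∧ v b ≠ 0 := by
  induction l generalizing v with
  | nil => exact ⟨[], .refl _, h⟩
  | cons x l ih =>
    obtain ⟨b, hb, hv⟩ := ih h
    obtain ⟨b', hb', hv'⟩ := exists_perm_of_insFun hv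
    exact ⟨b', hb'.trans (hb.cons x), hv'⟩

/-! ### The words of excess zero -/

/-- The letters that occur in repetition-free words of excess zero. -/
def letters : List Gen := [(0, 0), (0, 1), (0, 2), (0, 3), (1, 0), (1, 1), (1, 2), (1, 3)]

/-- The sorted words of length `q` and excess zero. -/
def basis (q : ℕ) : List (List Gen) :=
  letters.sublists.filter fun l => l.length = q ∧ excess l = 0

lemma excess_eq_sum (l : List Gen) : excess l = (l.map fun x => (x.2 : ℤ) - 1).sum := by
  induction l with
  | nil => rfl
  | cons x l ih => simp [excess, ih]

lemma excess_perm {l l' : List Gen} (h : l.Perm l') : excess l = excess l' := by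
  rw [excess_eq_sum, excess_eq_sum]
  exact (h.map _).sum_eq

lemma neg_two_le_excess {l : List Gen} (h : l.Nodup) : -2 ≤ excess l := by
  have h₁ : excess l = ∑ x ∈ l.toFinset, ((x.2 : ℤ) - 1) := by
    rw [excess_eq_sum, List.sum_toFinset _ h]
  have h₂ : ∑ x ∈ l.toFinset, -(if x ∈ ({(0, 0), (1, 0)} : Finset Gen) then (1 : ℤ) else 0) ≤
      ∑ x ∈ l.toFinset, ((x.2 : ℤ) - 1) := by
    refine Finset.sum_le_sum fun x _ => ?_
    split_ifs with h
    · omega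
    · have : x.2 ≠ 0 := by
        intro h0
        apply h
        obtain ⟨a, b⟩ := x
        fin_cases a <;> simp_all
      omega
  rw [Finset.sum_neg_distrib, Finset.sum_ite_mem, Finset.sum_const, nsmul_one] at h₂
  have h₃ := Finset.card_le_card (Finset.inter_subset_right (s₁ := l.toFinset)
    (s₂ := ({(0, 0), (1, 0)} : Finset Gen)))
  have h₄ : ({(0, 0), (1, 0)} : Finset Gen).card = 2 := rfl
  omega

lemma mem_letters {x : Gen} {l : List Gen} (h : l.Nodup) (he : excess l = 0) (hx : x ∈ l) :
    x ∈ letters := by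
  have hp := List.perm_cons_erase hx
  have h₁ := excess_perm hp
  have h₂ := neg_two_le_excess (h.erase x)
  simp only [excess] at h₁
  have h₃ : x.2 < 4 := by omega
  obtain ⟨a, b⟩ := x
  simp only at h₃
  interval_cases b <;> fin_cases a <;> simp [letters]

/-- A skew function that vanishes on sorted words vanishes. -/
lemma Skew.eq_zero {f : List Gen → ℂ} (hf : Skew f) {q : ℕ} (h : ∀ b ∈ basis q, f b = 0)
    {l : List Gen} (hl : l.length = q) (he : excess l = 0) : f l = 0 := by
  by_contra h0
  have hn := hf.nodup h0
  obtain ⟨b, hb, hs⟩ := hn.subperm fun x hx => mem_letters hn he hx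
  have hm : b ∈ basis q := by
    simp [basis, hs, excess_perm hb, he, hb.length_eq, hl]
  rcases hf.perm hb with h' | h' <;> simp_all

lemma basis_pairwise {q : ℕ} {b : List Gen} (h : b ∈ basis q) : b.Pairwise glt := by
  have hs : b.Sublist letters := List.mem_sublists.mp (List.mem_of_mem_filter h)
  exact List.Pairwise.sublist hs (by decide)

lemma basis_length {q : ℕ} {b : List Gen} (h : b ∈ basis q) : b.length = q := by
  have := (List.mem_filter.mp h).2
  simp at this
  exact this.1

lemma basis_excess {q : ℕ} {b : List Gen} (h : b ∈ basis q) : excess b = 0 := by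
  have := (List.mem_filter.mp h).2
  simp at this
  exact this.2

lemma diffNorm_mem_basis {q : ℕ} {b : List Gen} (h : b ∈ basis (q + 1))
    {p : ℤ × List Gen} (hp : p ∈ diffNorm b) : p.2 ∈ basis q := by
  have key : ∀ b ∈ letters.sublists, excess b = 0 → ∀ p ∈ diffNorm b,
      p.2 ∈ basis (b.length - 1) := by decide +kernel
  have := key b (List.mem_of_mem_filter h) (basis_excess h) p hp
  rwa [basis_length h] at this

lemma basis_eq_nil {q : ℕ} (hq : 7 ≤ q) : basis q = [] := by
  have key : ∀ b ∈ letters.sublists, excess b = 0 → b.length < 7 := by decide +kernel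
  rw [List.eq_nil_iff_forall_not_mem]
  intro b h
  have := key b (List.mem_of_mem_filter h) (basis_excess h)
  rw [basis_length h] at this
  omega


/-! ### Taylor coefficients of polynomials -/

section Taylor

variable {ι κ : Type*}

/-- The partial derivative of order `a` of `P` at the origin. -/
noncomputable def taylor [Fintype ι] (a : ι → ℕ) : MvPolynomial ι ℂ →ₗ[ℂ] ℂ :=
  ((∏ i, (a i).factorial : ℕ) : ℂ) • lcoeff ℂ (Finsupp.equivFunOnFinite.symm a)

lemma taylor_apply [Fintype ι] (a : ι → ℕ) (P : MvPolynomial ι ℂ) :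
    taylor a P = ((∏ i, (a i).factorial : ℕ) : ℂ) * coeff (Finsupp.equivFunOnFinite.symm a) P := by
  simp [taylor]

lemma factorial_prod_ne_zero [Fintype ι] (a : ι → ℕ) : ((∏ i, (a i).factorial : ℕ) : ℂ) ≠ 0 :=
  Nat.cast_ne_zero.mpr (Finset.prod_ne_zero_iff.mpr fun i _ => (a i).factorial_ne_zero)

lemma eq_of_taylor [Fintype ι] {P Q : MvPolynomial ι ℂ} (h : ∀ a, taylor a P = taylor a Q) :
    P = Q := by
  ext m
  have := h (Finsupp.equivFunOnFinite m)
  simp only [taylor_apply, Equiv.symm_apply_apply] at this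
  exact mul_left_cancel₀ (factorial_prod_ne_zero _) this

lemma taylor_zero [Fintype ι] (P : MvPolynomial ι ℂ) : taylor 0 P = constantCoeff P := by
  have : Finsupp.equivFunOnFinite.symm (0 : ι → ℕ) = 0 := by ext; simp
  simp [taylor_apply, this, constantCoeff_eq]

lemma exists_eq_add_single [DecidableEq ι] {a : ι → ℕ} {k : ι} (h : a k ≠ 0) :
    ∃ b : ι → ℕ, a = b + Pi.single k 1 := by
  refine ⟨a - (Pi.single k 1 : ι → ℕ), ?_⟩
  ext i
  by_cases hi : i = k
  · subst hi; simp; omega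
  · simp [hi]

lemma factorial_prod_add_single [Fintype ι] [DecidableEq ι] (a : ι → ℕ) (k : ι) :
    ∏ i, ((a + Pi.single k 1 : ι → ℕ) i).factorial = (∏ i, (a i).factorial) * (a k + 1) := by
  rw [← Finset.mul_prod_erase _ _ (Finset.mem_univ k),
    ← Finset.mul_prod_erase _ (fun i => (a i).factorial) (Finset.mem_univ k)]
  have : ∏ x ∈ Finset.univ.erase k, ((a + Pi.single k 1 : ι → ℕ) x).factorial =
      ∏ x ∈ Finset.univ.erase k, (a x).factorial :=
    Finset.prod_congr rfl fun x hx => by simp [Finset.ne_of_mem_erase hx]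
  rw [this]
  simp [Nat.factorial_succ]
  ring

lemma symm_add_single [Fintype ι] [DecidableEq ι] (a : ι → ℕ) (k : ι) :
    Finsupp.equivFunOnFinite.symm (a + Pi.single k 1) =
      Finsupp.equivFunOnFinite.symm a + Finsupp.single k 1 := by
  ext i
  simp [Finsupp.single_apply, Pi.single_apply, eq_comm]

lemma taylor_pderiv [Fintype ι] [DecidableEq ι] (a : ι → ℕ) (k : ι) (P : MvPolynomial ι ℂ) :
    taylor a (pderiv k P) = taylor (a + Pi.single k 1) P := by
  rw [taylor_apply, taylor_apply, coeff_pderiv, factorial_prod_add_single, symm_add_single]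
  simp
  ring

lemma taylor_X_mul [Fintype ι] [DecidableEq ι] (a : ι → ℕ) (k : ι) (P : MvPolynomial ι ℂ) :
    taylor a (X k * P) = a k * taylor (a - (Pi.single k 1 : ι → ℕ)) P := by
  rw [taylor_apply, coeff_X_mul']
  by_cases h : a k = 0
  · simp [h]
  · obtain ⟨b, rfl⟩ := exists_eq_add_single h
    rw [if_pos (by simp), symm_add_single, factorial_prod_add_single, taylor_apply]
    simp
    ring

lemma pderiv_aeval_fusion [DecidableEq κ] {σ : κ → MvPolynomial ι ℂ} {p : ι → κ}
    (h : ∀ i k, pderiv i (σ k) = if p i = k then 1 else 0) (i : ι) (P : MvPolynomial κ ℂ) :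
    pderiv i (aeval σ P) = aeval σ (pderiv (p i) P) := by
  induction P using MvPolynomial.induction_on with
  | C c => simp
  | add P Q hP hQ => simp only [map_add, hP, hQ]
  | mul_X P k hP =>
    simp only [map_mul, pderiv_mul, hP, aeval_X, h, map_add, pderiv_X, Pi.single_apply]
    by_cases e : p i = k
    · simp [e]
    · simp [e, Ne.symm e]

lemma constantCoeff_aeval {σ : κ → MvPolynomial ι ℂ} (h0 : ∀ k, constantCoeff (σ k) = 0)
    (P : MvPolynomial κ ℂ) : constantCoeff (aeval σ P) = constantCoeff P := by
  induction P using MvPolynomial.induction_on with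
  | C c => simp
  | add P Q hP hQ => simp only [map_add, hP, hQ]
  | mul_X P k hP => simp [h0]

/-- Taylor coefficients after a substitution which identifies variables. -/
lemma taylor_aeval [Fintype ι] [DecidableEq ι] [Fintype κ] [DecidableEq κ]
    {σ : κ → MvPolynomial ι ℂ} {p : ι → κ}
    (h : ∀ i k, pderiv i (σ k) = if p i = k then 1 else 0)
    (h0 : ∀ k, constantCoeff (σ k) = 0) (a : ι → ℕ) (P : MvPolynomial κ ℂ) :
    taylor a (aeval σ P) = taylor (fun k => ∑ i, if p i = k then a i else 0) P := by
  induction hN : ∑ i, a i generalizing a P with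
  | zero =>
    obtain rfl : a = 0 := funext fun i => by simpa using Finset.sum_eq_zero_iff.mp hN i
    have : (fun k => ∑ i, if p i = k then (0 : ι → ℕ) i else 0) = 0 := by ext; simp
    rw [this, taylor_zero, taylor_zero, constantCoeff_aeval h0]
  | succ N ih =>
    obtain ⟨j, hj⟩ : ∃ j, a j ≠ 0 := by
      by_contra! hc
      simp [hc] at hN
    obtain ⟨b, rfl⟩ := exists_eq_add_single hj
    rw [← taylor_pderiv, pderiv_aeval_fusion h, ih, taylor_pderiv]
    · refine congrArg (fun c => taylor c P) (funext fun k => ?_)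
      have : ∀ i, (if p i = k then (b + Pi.single j 1 : ι → ℕ) i else 0) =
          (if p i = k then b i else 0) + if j = i then (if p j = k then 1 else 0) else 0 := by
        intro i
        by_cases e : j = i
        · subst e; simp; split_ifs <;> rfl
        · simp [e, Ne.symm e]
      rw [Finset.sum_congr rfl fun i _ => this i, Finset.sum_add_distrib, Finset.sum_ite_eq]
      simp [Pi.single_apply, eq_comm]
    · simpa [Finset.sum_add_distrib] using hN

end Taylor


/-! ### Cochains as functions on words -/

lemma taylor_rename {q : ℕ} (σ : Equiv.Perm (Fin q)) (a : Fin q → ℕ) (P : MvPolynomial (Fin q) ℂ) :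
    taylor a (rename σ P) = taylor (a ∘ σ) P := by
  have h : rename σ P = aeval (fun k => (X (σ k) : MvPolynomial (Fin q) ℂ)) P := by
    rw [show (fun k => X (σ k)) = (X ∘ σ : Fin q → MvPolynomial (Fin q) ℂ) from rfl,
      ← aeval_rename, aeval_X_left_apply]
  rw [h, taylor_aeval (p := σ.symm)]
  · refine congrArg (fun c => taylor c P) (funext fun k => ?_)
    simp [Equiv.symm_apply_eq]
  · intro i k
    simp only [pderiv_X, Pi.single_apply, Equiv.symm_apply_eq, eq_comm (a := i)]
  · simp

lemma exists_toPoly (q : ℕ) : ∃ T : ((Fin q → ℂ) → ℂ) →ₗ[ℂ] MvPolynomial (Fin q) ℂ,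
    ∀ P : MvPolynomial (Fin q) ℂ, T (fun l => eval l P) = P := by
  let E : MvPolynomial (Fin q) ℂ →ₗ[ℂ] ((Fin q → ℂ) → ℂ) :=
    { toFun := fun P l => eval l P
      map_add' := fun P Q => by ext; simp
      map_smul' := fun c P => by ext; simp }
  obtain ⟨T, hT⟩ := E.exists_leftInverse_of_injective
    (LinearMap.ker_eq_bot.mpr fun P Q h => MvPolynomial.funext fun l => congrFun h l)
  exact ⟨T, fun P => LinearMap.congr_fun hT P⟩

/-- A linear left inverse of the evaluation of polynomials. -/
noncomputable def toPoly (q : ℕ) : ((Fin q → ℂ) → ℂ) →ₗ[ℂ] MvPolynomial (Fin q) ℂ :=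
  (exists_toPoly q).choose

lemma toPoly_eq {q : ℕ} {u : (Fin q → ℂ) → ℂ} {P : MvPolynomial (Fin q) ℂ}
    (h : ∀ l, u l = eval l P) : toPoly q u = P := by
  rw [funext h]
  exact (exists_toPoly q).choose_spec P

lemma eval_toPoly {q : ℕ} {γ : WCochain q} (h : IsPolyCochain γ) (Y : Fin q → Fin 2)
    (l : Fin q → ℂ) : eval l (toPoly q (γ Y)) = γ Y l := by
  obtain ⟨P, hP⟩ := h Y
  rw [toPoly_eq hP, hP]

/-- The Taylor coefficient of a cochain at a tuple of generators. -/
noncomputable def coeffAt {q : ℕ} (γ : WCochain q) (g : Fin q → Gen) : ℂ :=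
  taylor (fun i => (g i).2) (toPoly q (γ fun i => (g i).1))

/-- The Taylor coefficients of a cochain, as a function on words. -/
noncomputable def co (q : ℕ) : WCochain q →ₗ[ℂ] (List Gen → ℂ) where
  toFun γ l := if l.length = q then coeffAt γ fun i => l.getD i (0, 0) else 0
  map_add' γ₁ γ₂ := by ext l; by_cases h : l.length = q <;> simp [h, coeffAt]
  map_smul' c γ := by ext l; by_cases h : l.length = q <;> simp [h, coeffAt]

lemma co_apply {q : ℕ} (γ : WCochain q) (l : List Gen) :
    co q γ l = if l.length = q then coeffAt γ fun i => l.getD i (0, 0) else 0 := rfl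

lemma co_ofFn {q : ℕ} (γ : WCochain q) (g : Fin q → Gen) :
    co q γ (List.ofFn g) = coeffAt γ g := by
  simp [co_apply]

lemma eq_zero_of_co {q : ℕ} {γ : WCochain q} (h : IsPolyCochain γ)
    (h0 : ∀ l : List Gen, l.length = q → co q γ l = 0) : γ = 0 := by
  ext Y l
  rw [← eval_toPoly h, eq_of_taylor (Q := 0) (P := toPoly q (γ Y))]
  · simp
  · intro a
    have := h0 (List.ofFn fun i => (Y i, a i)) (by simp)
    rw [co_ofFn] at this
    simpa [coeffAt] using this

lemma coeffAt_perm {q : ℕ} {γ : WCochain q} (h : IsCochain γ) (σ : Equiv.Perm (Fin q))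
    (g : Fin q → Gen) : coeffAt γ (g ∘ σ) = (Equiv.Perm.sign σ : ℤ) * coeffAt γ g := by
  have key : rename σ (toPoly q (γ ((fun i => (g i).1) ∘ σ))) =
      ((Equiv.Perm.sign σ : ℤ) : ℂ) • toPoly q (γ fun i => (g i).1) := by
    refine MvPolynomial.funext fun l => ?_
    rw [eval_rename, eval_toPoly h.1, h.2, smul_eval, eval_toPoly h.1]
  have := congrArg (taylor fun i => (g i).2) key
  rw [taylor_rename, map_smul] at this
  exact this

lemma skew_co {q : ℕ} {γ : WCochain q} (h : IsCochain γ) : Skew (co q γ) := by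
  intro p x y l
  by_cases hl : (p ++ x :: y :: l).length = q
  · have hl' : (p ++ y :: x :: l).length = q := by simpa using hl
    simp only [co_apply, if_pos hl, if_pos hl']
    simp only [List.length_append, List.length_cons] at hl
    let i : Fin q := ⟨p.length, by omega⟩
    let j : Fin q := ⟨p.length + 1, by omega⟩
    have hij : i ≠ j := by simp [i, j]
    have e : (fun k : Fin q => (p ++ x :: y :: l).getD k (0, 0)) =
        (fun k : Fin q => (p ++ y :: x :: l).getD k (0, 0)) ∘ Equiv.swap i j := by
      ext1 k
      simp only [Function.comp_apply]
      by_cases hi : k = i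
      · subst hi
        simp [i, j, List.getD_eq_getElem?_getD]
      by_cases hj : k = j
      · subst hj
        simp [i, j, List.getD_eq_getElem?_getD]
      rw [Equiv.swap_apply_of_ne_of_ne hi hj]
      have hi' : (k : ℕ) ≠ p.length := fun h => hi (Fin.ext h)
      have hj' : (k : ℕ) ≠ p.length + 1 := fun h => hj (Fin.ext h)
      simp only [List.getD_eq_getElem?_getD, List.getElem?_append]
      split_ifs with hk
      · rfl
      · obtain ⟨m, hm⟩ : ∃ m, (k : ℕ) - p.length = m + 2 := ⟨k - p.length - 2, by omega⟩
        simp [hm]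
    rw [e, coeffAt_perm h, Equiv.Perm.sign_swap hij]
    simp
  · have hl' : (p ++ y :: x :: l).length ≠ q := by simpa using hl
    simp only [co_apply, if_neg hl, if_neg hl', neg_zero]

lemma finite_support_co {q : ℕ} (γ : WCochain q) : (Function.support (co q γ)).Finite := by
  have hf : (⋃ Y : Fin q → Fin 2, (fun m : Fin q →₀ ℕ => List.ofFn fun i => ((Y i, m i) : Gen)) ''
      ((toPoly q (γ Y)).support : Set (Fin q →₀ ℕ))).Finite :=
    Set.finite_iUnion fun Y => (Finset.finite_toSet _).image _
  refine hf.subset fun l hl => ?_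
  obtain ⟨rfl, h⟩ : l.length = q ∧ coeffAt γ (fun i => l.getD i (0, 0)) ≠ 0 := by
    rw [Function.mem_support, co_apply] at hl
    split_ifs at hl with h
    exacts [⟨h, hl⟩, absurd rfl hl]
  rw [coeffAt, taylor_apply] at h
  refine Set.mem_iUnion.mpr ⟨_, _, mem_support_iff.mpr (right_ne_zero_of_mul h), ?_⟩
  simp

/-! ### Cochains with prescribed coefficients -/

lemma Skew.swap_ofFn {f : List Gen → ℂ} (hf : Skew f) {n : ℕ} (i : Fin n) (g : Fin (n + 1) → Gen) :
    f (List.ofFn (g ∘ Equiv.swap i.castSucc i.succ)) = -f (List.ofFn g) := by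
  induction n generalizing f with
  | zero => exact i.elim0
  | succ n ih =>
    refine Fin.cases ?_ (fun i => ?_) i
    · have : ∀ k : Fin n, Equiv.swap (0 : Fin (n + 2)) 1 k.succ.succ = k.succ.succ := fun k =>
        Equiv.swap_apply_of_ne_of_ne (Fin.succ_ne_zero _)
          (fun h => Fin.succ_ne_zero k (Fin.succ_injective _ h))
      simp only [List.ofFn_succ, Function.comp_apply, Fin.castSucc_zero, Fin.succ_zero_eq_one,
        this, Equiv.swap_apply_left, Equiv.swap_apply_right]
      exact hf.swap _ _ _
    · have h0 : Equiv.swap i.succ.castSucc i.succ.succ 0 = 0 :=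
        Equiv.swap_apply_of_ne_of_ne (by simp [Fin.ext_iff]) (Fin.succ_ne_zero _).symm
      have h1 : ∀ k : Fin (n + 1), Equiv.swap i.succ.castSucc i.succ.succ k.succ =
          (Equiv.swap i.castSucc i.succ k).succ := fun k => by
        rw [← Fin.succ_castSucc, (Fin.succ_injective _).swap_apply]
      have := ih (hf.cons (g 0)) i (fun k => g k.succ)
      rw [List.ofFn_succ, List.ofFn_succ (f := g)]
      simpa only [Function.comp_apply, h0, h1, Function.comp_def] using this

lemma Skew.perm_ofFn {f : List Gen → ℂ} (hf : Skew f) {n : ℕ} (σ : Equiv.Perm (Fin n))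
    (g : Fin n → Gen) :
    f (List.ofFn (g ∘ σ)) = (Equiv.Perm.sign σ : ℤ) * f (List.ofFn g) := by
  cases n with
  | zero => simp [Subsingleton.elim σ 1]
  | succ n =>
    have hσ : σ ∈ Submonoid.closure
        (Set.range fun i : Fin n => Equiv.swap i.castSucc i.succ) := by
      rw [Equiv.Perm.mclosure_swap_castSucc_succ]; trivial
    induction hσ using Submonoid.closure_induction generalizing g with
    | mem τ hτ =>
      obtain ⟨i, rfl⟩ := hτ
      rw [hf.swap_ofFn, Equiv.Perm.sign_swap (Fin.castSucc_lt_succ).ne]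
      simp
    | one => simp
    | mul τ υ _ _ hτ hυ =>
      rw [Equiv.Perm.coe_mul, ← Function.comp_assoc, hυ, hτ, Equiv.Perm.sign_mul]
      push_cast
      ring

lemma exists_taylor_eq {q : ℕ} {f : List Gen → ℂ} (hs : (Function.support f).Finite)
    (Y : Fin q → Fin 2) : ∃ P : MvPolynomial (Fin q) ℂ,
      ∀ a, taylor a P = f (List.ofFn fun i => (Y i, a i)) := by
  have hfin : {m : Fin q →₀ ℕ | f (List.ofFn fun i => (Y i, m i)) ≠ 0}.Finite := by
    refine hs.preimage (f := fun m : Fin q →₀ ℕ => List.ofFn fun i => ((Y i, m i) : Gen)) ?_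
    intro m _ m' _ h
    ext i
    exact congrArg Prod.snd (congrFun (List.ofFn_injective h) i)
  refine ⟨∑ m ∈ hfin.toFinset, monomial m
    (((∏ i, (m i).factorial : ℕ) : ℂ)⁻¹ * f (List.ofFn fun i => (Y i, m i))), fun a => ?_⟩
  rw [taylor_apply, coeff_sum]
  simp only [coeff_monomial, Finset.sum_ite_eq']
  have := factorial_prod_ne_zero a
  split_ifs with h
  · simp only [Finsupp.equivFunOnFinite_symm_apply_apply]
    rw [mul_inv_cancel_left₀ this]
  · simp only [Set.Finite.mem_toFinset, Set.mem_ofPred_eq, not_not] at h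
    simpa using h.symm

lemma exists_cochain {q : ℕ} {f : List Gen → ℂ} (hf : Skew f) (hs : (Function.support f).Finite) :
    ∃ γ ∈ cochainSub q, ∀ l : List Gen, l.length = q → co q γ l = f l := by
  choose P hP using exists_taylor_eq (q := q) hs
  refine ⟨fun Y l => eval l (P Y), ⟨fun Y => ⟨P Y, fun _ => rfl⟩, fun σ Y l => ?_⟩, ?_⟩
  · have : rename σ (P (Y ∘ σ)) = ((Equiv.Perm.sign σ : ℤ) : ℂ) • P Y := by
      refine eq_of_taylor fun a => ?_
      rw [taylor_rename, map_smul, hP, hP]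
      exact hf.perm_ofFn σ fun i => (Y i, a i)
    simp only
    rw [← eval_rename, this, smul_eval]
  · rintro l rfl
    rw [co_apply, if_pos rfl, coeffAt, toPoly_eq fun _ => rfl, hP]
    simp


/-! ### The differential on Taylor coefficients -/

lemma sum_lt_succ {n : ℕ} (F : Fin (n + 1) → Fin (n + 1) → ℂ) :
    (∑ i, ∑ j, if i < j then F i j else 0) =
      (∑ j : Fin n, F 0 j.succ) + ∑ i : Fin n, ∑ j, if i < j then F i.succ j.succ else 0 := by
  rw [Fin.sum_univ_succ]
  congr 1
  · rw [Fin.sum_univ_succ]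
    simp [Fin.succ_pos]
  · refine Finset.sum_congr rfl fun i _ => ?_
    rw [Fin.sum_univ_succ]
    simp

lemma Skew.act_ofFn {f : List Gen → ℂ} (hf : Skew f) (x : Gen) {n : ℕ} (g : Fin n → Gen) :
    W22.act x (List.ofFn g) f = ∑ j : Fin n, (-1 : ℂ) ^ (j : ℕ) * scoef x (g j) *
      f (sres x (g j) :: (List.ofFn g).eraseIdx j) := by
  induction n generalizing f with
  | zero => simp [W22.act]
  | succ n ih =>
    rw [List.ofFn_succ, W22.act, ih (hf.cons (g 0)), Fin.sum_univ_succ]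
    simp only [Fin.val_zero, pow_zero, one_mul, Fin.val_succ, List.eraseIdx_cons_zero,
      List.eraseIdx_cons_succ]
    congr 1
    refine Finset.sum_congr rfl fun j _ => ?_
    rw [hf.swap (g 0)]
    ring

/-- The Chevalley–Eilenberg differential as a sum over pairs of letters. -/
lemma Skew.diff_ofFn {f : List Gen → ℂ} (hf : Skew f) {n : ℕ} (g : Fin n → Gen) :
    W22.diff f (List.ofFn g) = ∑ i : Fin n, ∑ j : Fin n, if i < j then
      (-1 : ℂ) ^ ((i : ℕ) + j) * scoef (g i) (g j) *
        f (sres (g i) (g j) :: ((List.ofFn g).eraseIdx j).eraseIdx i) else 0 := by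
  induction n generalizing f with
  | zero => simp [W22.diff]
  | succ n ih =>
    rw [sum_lt_succ, List.ofFn_succ, W22.diff, ih (hf.cons (g 0)), hf.act_ofFn, sub_eq_add_neg]
    simp only [Fin.val_zero, Fin.val_succ, List.eraseIdx_cons_zero, List.eraseIdx_cons_succ,
      ← Finset.sum_neg_distrib]
    congr 1
    · refine Finset.sum_congr rfl fun j _ => ?_
      ring
    · refine Finset.sum_congr rfl fun i _ => Finset.sum_congr rfl fun j _ => ?_
      split_ifs
      · rw [hf.swap (g 0)]
        ring
      · simp

/-- The position of entry `k` before the removal of the entries `i < j`. -/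
def skip (i j k : ℕ) : ℕ := if k < i then k else if k + 1 < j then k + 1 else k + 2

/-- The position of entry `m` after the entries `i < j` have been moved to the front and fused. -/
def fuse (i j m : ℕ) : ℕ :=
  if m = i ∨ m = j then 0 else if m < i then m + 1 else if m < j then m else m - 1

lemma fuse_eq_zero_iff {i j m : ℕ} (h : i < j) : fuse i j m = 0 ↔ m = i ∨ m = j := by
  grind [fuse]

lemma fuse_eq_succ_iff {i j m k : ℕ} (h : i < j) : fuse i j m = k + 1 ↔ m = skip i j k := by
  grind [fuse, skip]

lemma skip_lt {q i j k : ℕ} (hk : k + 1 < q) : skip i j k < q + 1 := by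
  unfold skip; split_ifs <;> omega

lemma fuse_lt {q i j m : ℕ} (h : i < j) (hj : j < q + 1) (hm : m < q + 1) : fuse i j m < q := by
  unfold fuse; split_ifs <;> omega

lemma length_eraseIdx_eraseIdx {α : Type*} {q : ℕ} {i j : Fin (q + 1)} (h : i < j)
    (Y : Fin (q + 1) → α) : (((List.ofFn Y).eraseIdx j).eraseIdx i).length = q - 1 := by
  have h' : (i : ℕ) < j := h
  have hj := j.isLt
  simp only [List.length_eraseIdx, List.length_ofFn]
  split_ifs <;> omega

lemma removeTwo_eq {α : Type*} {q : ℕ} {i j : Fin (q + 1)} (h : i < j) (Y : Fin (q + 1) → α) (d : α)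
    {k : ℕ} (hk : k + 1 < q) : removeTwo i j Y d k = Y ⟨skip i j k, skip_lt hk⟩ := by
  have h' : (i : ℕ) < j := h
  have hj := j.isLt
  unfold removeTwo
  rw [List.getD_eq_getElem _ _ (by rw [length_eraseIdx_eraseIdx h]; omega)]
  simp only [List.getElem_eraseIdx, List.getElem_ofFn, skip]
  split_ifs <;> first | rfl | omega

/-- The tuple with entries `i < j` removed and `x` added to the front. -/
def fused {α : Type*} {q : ℕ} (i j : Fin (q + 1)) (x : α) (Y : Fin (q + 1) → α) (d : α) :
    Fin q → α :=
  fun k => if k.val = 0 then x else removeTwo i j Y d (k.val - 1)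

lemma comp_fused {α β : Type*} {q : ℕ} {i j : Fin (q + 1)} (h : i < j) (x : α)
    (Y : Fin (q + 1) → α) (d : α) (d' : β) (u : α → β) :
    u ∘ fused i j x Y d = fused i j (u x) (u ∘ Y) d' := by
  ext1 k
  simp only [Function.comp_apply, fused]
  split_ifs with hk
  · rfl
  · have := k.isLt
    rw [removeTwo_eq h _ _ (by omega), removeTwo_eq h _ _ (by omega)]
    rfl

lemma ofFn_fused {α : Type*} {q : ℕ} {i j : Fin (q + 1)} (h : i < j) (x : α)
    (Y : Fin (q + 1) → α) (d : α) :
    List.ofFn (fused i j x Y d) = x :: ((List.ofFn Y).eraseIdx j).eraseIdx i := by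
  have h' : (i : ℕ) < j := h
  have hj := j.isLt
  have hl := length_eraseIdx_eraseIdx h Y
  refine List.ext_getElem (by simp only [List.length_ofFn, List.length_cons, hl]; omega) ?_
  intro k hk _
  rw [List.getElem_ofFn]
  cases k with
  | zero => simp [fused]
  | succ k =>
    simp only [fused, List.getElem_cons_succ, removeTwo]
    simp only [List.length_ofFn] at hk
    rw [if_neg (by simp), Nat.add_sub_cancel, List.getD_eq_getElem _ _ (by omega)]

/-- The substitution fusing the variables `i` and `j`. -/
noncomputable def fuseVar {q : ℕ} (i j : Fin (q + 1)) : Fin q → MvPolynomial (Fin (q + 1)) ℂ :=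
  fused i j (X i + X j) X 0

lemma pderiv_fuseVar {q : ℕ} {i j : Fin (q + 1)} (h : i < j) (m : Fin (q + 1)) (k : Fin q) :
    pderiv m (fuseVar i j k) =
      if (⟨fuse i j m, fuse_lt h j.isLt m.isLt⟩ : Fin q) = k then 1 else 0 := by
  obtain ⟨k, hk⟩ := k
  cases k with
  | zero =>
    have hij : i ≠ j := h.ne
    simp only [fuseVar, fused, if_true, map_add, pderiv_X, Fin.mk.injEq,
      fuse_eq_zero_iff (show (i : ℕ) < j from h), Pi.single_apply, ← Fin.ext_iff]
    by_cases h₁ : m = i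
    · subst h₁; simp [hij.symm]
    · by_cases h₂ : m = j
      · subst h₂; simp [hij]
      · simp [h₁, h₂, Ne.symm h₁, Ne.symm h₂]
  | succ k =>
    simp only [fuseVar, fused, Nat.add_sub_cancel, Nat.succ_ne_zero, if_false,
      fuse_eq_succ_iff (show (i : ℕ) < j from h), removeTwo_eq h _ _ hk, pderiv_X, Pi.single_apply,
      Fin.ext_iff]
    exact if_congr eq_comm rfl rfl

lemma constantCoeff_fuseVar {q : ℕ} {i j : Fin (q + 1)} (h : i < j) (k : Fin q) :
    constantCoeff (fuseVar i j k) = 0 := by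
  have hk := k.isLt
  simp only [fuseVar, fused]
  split_ifs
  · simp
  · rw [removeTwo_eq h _ _ (by omega)]
    simp

lemma eval_fuseVar {q : ℕ} {i j : Fin (q + 1)} (h : i < j) (l : Fin (q + 1) → ℂ) (k : Fin q) :
    eval l (fuseVar i j k) = fused i j (l i + l j) l 0 k := by
  have := congrFun (comp_fused h (X i + X j) X 0 (0 : ℂ) (eval l)) k
  simpa [fuseVar, Function.comp_def] using this

lemma sum_fuse {q : ℕ} {i j : Fin (q + 1)} (h : i < j) (a : Fin (q + 1) → ℕ) :
    (fun k => ∑ m : Fin (q + 1),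
      if (⟨fuse i j m, fuse_lt h j.isLt m.isLt⟩ : Fin q) = k then a m else 0) =
      fused i j (a i + a j) a 0 := by
  ext ⟨k, hk⟩
  cases k with
  | zero =>
    simp only [fused, if_true, Fin.mk.injEq, fuse_eq_zero_iff (show (i : ℕ) < j from h),
      ← Fin.ext_iff]
    rw [Finset.sum_eq_add i j h.ne (by intro m _ hm; simp [hm.1, hm.2]) (by simp) (by simp)]
    simp
  | succ k =>
    simp only [fused, Nat.add_sub_cancel, Nat.succ_ne_zero, if_false, Fin.mk.injEq,
      fuse_eq_succ_iff (show (i : ℕ) < j from h), removeTwo_eq h _ _ hk]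
    rw [Finset.sum_eq_single ⟨skip i j k, skip_lt hk⟩ (fun m _ hm => if_neg fun e => hm (Fin.ext e))
      (by simp)]
    simp

lemma fused_sub_single {q : ℕ} {i j : Fin (q + 1)} (h : i < j) (a : Fin (q + 1) → ℕ)
    {s : Fin (q + 1)} (hs : s = i ∨ s = j) (h0 : a s ≠ 0) :
    fused i j ((a - (Pi.single s 1 : Fin (q + 1) → ℕ)) i + (a - (Pi.single s 1 : Fin (q + 1) → ℕ)) j)
      (a - (Pi.single s 1 : Fin (q + 1) → ℕ)) 0 = fused i j (a i + a j - 1) a 0 := by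
  ext ⟨k, hk⟩
  cases k with
  | zero =>
    simp only [fused, if_true, Pi.sub_apply]
    rcases hs with rfl | rfl
    · simp [h.ne']; omega
    · simp [h.ne]; omega
  | succ k =>
    simp only [fused, Nat.add_sub_cancel, Nat.succ_ne_zero, if_false, removeTwo_eq h _ _ hk]
    have : skip i j k ≠ s := by
      intro e
      have e₁ := (fuse_eq_succ_iff (show (i : ℕ) < j from h)).mpr e.symm
      rw [(fuse_eq_zero_iff (show (i : ℕ) < j from h)).mpr (hs.imp (congrArg _) (congrArg _))] at e₁
      omega
    have hne : (⟨skip i j k, skip_lt hk⟩ : Fin (q + 1)) ≠ s := fun e => this (congrArg Fin.val e)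
    simp [hne]

lemma taylor_fuse {q : ℕ} {i j : Fin (q + 1)} (h : i < j) (a : Fin (q + 1) → ℕ)
    (P : MvPolynomial (Fin q) ℂ) :
    taylor a ((X i - X j) * aeval (fuseVar i j) P) =
      ((a i : ℂ) - a j) * taylor (fused i j (a i + a j - 1) a 0) P := by
  rw [sub_mul, map_sub, taylor_X_mul, taylor_X_mul,
    taylor_aeval (pderiv_fuseVar h) (constantCoeff_fuseVar h),
    taylor_aeval (pderiv_fuseVar h) (constantCoeff_fuseVar h), sum_fuse h, sum_fuse h, sub_mul]
  congr 1
  · by_cases h0 : a i = 0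
    · simp [h0]
    · rw [fused_sub_single h a (Or.inl rfl) h0]
  · by_cases h0 : a j = 0
    · simp [h0]
    · rw [fused_sub_single h a (Or.inr rfl) h0]

lemma eval_aeval {ι κ : Type*} (σ : κ → MvPolynomial ι ℂ) (l : ι → ℂ) (P : MvPolynomial κ ℂ) :
    eval l (aeval σ P) = eval (fun k => eval l (σ k)) P := by
  induction P using MvPolynomial.induction_on with
  | C c => simp
  | add P Q hP hQ => simp only [map_add, hP, hQ]
  | mul_X P k hP => simp only [map_mul, hP, aeval_X, eval_X]

/-- The polynomial of a summand of the differential. -/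
noncomputable def dTerm {q : ℕ} (γ : WCochain q) (Y : Fin (q + 1) → Fin 2) (i j : Fin (q + 1)) :
    MvPolynomial (Fin (q + 1)) ℂ :=
  ((-1 : ℂ) ^ (i.val + j.val) * bcoef (Y i) (Y j)) •
    ((X i - X j) * aeval (fuseVar i j) (toPoly q (γ (fused i j (bres (Y i) (Y j)) Y 0))))

lemma dW_eq_eval {q : ℕ} {γ : WCochain q} (hγ : IsPolyCochain γ) (Y : Fin (q + 1) → Fin 2)
    (l : Fin (q + 1) → ℂ) :
    dW γ Y l = eval l (∑ i, ∑ j, if i < j then dTerm γ Y i j else 0) := by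
  rw [dW, Finset.sum_filter, Fintype.sum_prod_type, map_sum]
  refine Finset.sum_congr rfl fun i _ => ?_
  rw [map_sum]
  refine Finset.sum_congr rfl fun j _ => ?_
  simp only
  split_ifs with h
  · have e : eval l (aeval (fuseVar i j) (toPoly q (γ (fused i j (bres (Y i) (Y j)) Y 0)))) =
        γ (fused i j (bres (Y i) (Y j)) Y 0) (fused i j (l i + l j) l 0) := by
      rw [← eval_toPoly hγ, ← funext (eval_fuseVar h l), eval_aeval]
    simp only [dTerm, smul_eval, map_mul, map_sub, eval_X, e]
    unfold fused
    ring
  · simp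

lemma isPolyCochain_dW {q : ℕ} {γ : WCochain q} (hγ : IsPolyCochain γ) : IsPolyCochain (dW γ) :=
  fun Y => ⟨_, dW_eq_eval hγ Y⟩

lemma taylor_dTerm {q : ℕ} (γ : WCochain q) (g : Fin (q + 1) → Gen) {i j : Fin (q + 1)}
    (h : i < j) : taylor (fun k => (g k).2) (dTerm γ (fun k => (g k).1) i j) =
      (-1 : ℂ) ^ (i.val + j.val) * scoef (g i) (g j) *
        co q γ (sres (g i) (g j) :: ((List.ofFn g).eraseIdx j).eraseIdx i) := by
  rw [dTerm, map_smul, taylor_fuse h, ← ofFn_fused h _ _ (0, 0), co_ofFn, coeffAt]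
  have h₁ := comp_fused h (sres (g i) (g j)) g (0, 0) 0 Prod.fst
  have h₂ := comp_fused h (sres (g i) (g j)) g (0, 0) 0 Prod.snd
  have hs : (scoef (g i) (g j) : ℂ) = bcoef (g i).1 (g j).1 * (((g i).2 : ℂ) - (g j).2) := by
    simp only [scoef, bcoef]
    split_ifs <;> simp
  simp only [Function.comp_def, sres] at h₁ h₂
  simp only [sres, h₁, h₂, hs, bres, smul_eq_mul]
  ring

lemma co_dW {q : ℕ} {γ : WCochain q} (hγ : IsCochain γ) {l : List Gen} (hl : l.length = q + 1) :
    co (q + 1) (dW γ) l = diff (co q γ) l := by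
  obtain ⟨g, rfl⟩ : ∃ g : Fin (q + 1) → Gen, l = List.ofFn g :=
    ⟨fun i => l.get (i.cast hl.symm),
      List.ext_getElem (by rw [List.length_ofFn]; exact hl) fun k _ _ => by
        rw [List.getElem_ofFn]; rfl⟩
  rw [co_ofFn, coeffAt, toPoly_eq (dW_eq_eval hγ.1 _), (skew_co hγ).diff_ofFn, map_sum]
  refine Finset.sum_congr rfl fun i _ => ?_
  rw [map_sum]
  refine Finset.sum_congr rfl fun j _ => ?_
  split_ifs with h
  · exact taylor_dTerm γ g h
  · simp


/-! ### Reduction to the complex spanned by the words of excess zero -/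

lemma act_congr {x : Gen} {l : List Gen} {f g : List Gen → ℂ}
    (h : ∀ w, w.length = l.length → f w = g w) : act x l f = act x l g := by
  induction l generalizing f g with
  | nil => rfl
  | cons y l ih =>
    simp only [act]
    rw [h _ (by simp), ih fun w hw => h (y :: w) (by simpa using hw)]

lemma diff_congr {l : List Gen} {f g : List Gen → ℂ}
    (h : ∀ w, w.length + 1 = l.length → f w = g w) : diff f l = diff g l := by
  induction l generalizing f g with
  | nil => rfl
  | cons y l ih =>
    simp only [diff]
    rw [act_congr fun w hw => h w (by simp [hw]), ih fun w hw => h (y :: w) (by simpa using hw)]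

lemma evalTerms_congr {t : List (ℤ × List Gen)} {f g : List Gen → ℂ}
    (h : ∀ p ∈ t, f p.2 = g p.2) : evalTerms t f = evalTerms t g := by
  unfold evalTerms
  exact congrArg List.sum (List.map_congr_left fun p hp => by rw [h p hp])

lemma diff_eq_zero_of_excess {f : List Gen → ℂ} (hf : ∀ l, excess l ≠ 0 → f l = 0)
    {l : List Gen} (hl : excess l ≠ 0) : diff f l = 0 := by
  have h := diff_excess_mul (fun t => if t = 0 then 1 else 0) f l
  have e : (fun w => (if excess w = 0 then 1 else 0) * f w) = f := by
    ext w
    by_cases hw : excess w = 0 <;> simp [hw, hf]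
  rw [e, if_neg hl, zero_mul] at h
  exact h

lemma diff_eq_of_basis {f g : List Gen → ℂ} (hf : Skew f) (hg : Skew g) {q : ℕ}
    (h : ∀ b ∈ basis (q + 1), evalTerms (diffNorm b) f = g b) {l : List Gen}
    (hl : l.length = q + 1) (he : excess l = 0) : diff f l = g l := by
  have hs : Skew fun w => diff f w - g w := fun p x y w => by
    simp only [hf.diff p x y w, hg p x y w]; ring
  exact sub_eq_zero.mp (hs.eq_zero (fun b hb => by rw [hf.diff_eq, h b hb, sub_self]) hl he)

lemma exists_skew (q : ℕ) (v : List Gen → ℂ) : ∃ f : List Gen → ℂ, Skew f ∧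
    (Function.support f).Finite ∧ (∀ l, excess l ≠ 0 → f l = 0) ∧ ∀ b ∈ basis q, f b = v b := by
  let v' : List Gen → ℂ := fun b => if b ∈ basis q then v b else 0
  have key : ∀ l, skewExt v' l ≠ 0 → ∃ b ∈ basis q, b.Perm l := by
    intro l hl
    obtain ⟨b, hb, hv⟩ := exists_perm_of_skewExt hl
    exact ⟨b, by_contra fun h => hv (if_neg h), hb⟩
  refine ⟨skewExt v', skew_skewExt v', ?_, fun l hl => ?_, fun b hb => ?_⟩
  · have hf : (⋃ b ∈ {b | b ∈ basis q}, {l : List Gen | b.Perm l}).Finite :=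
      (List.finite_toSet _).biUnion fun b _ =>
        b.permutations.finite_toSet.subset fun l (hl : b.Perm l) =>
          List.mem_permutations.mpr hl.symm
    refine hf.subset fun l hl => ?_
    obtain ⟨b, hb, hp⟩ := key l hl
    exact Set.mem_biUnion (show b ∈ {b | b ∈ basis q} from hb) hp
  · by_contra h
    obtain ⟨b, hb, hp⟩ := key l h
    exact hl ((excess_perm hp).symm.trans (basis_excess hb))
  · rw [skewExt_eq v' (basis_pairwise hb)]
    exact if_pos hb

lemma diff_co_eq_zero {q : ℕ} {γ : WCochain q} (hγ : γ ∈ cocycleSub q) {l : List Gen}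
    (hl : l.length = q + 1) : diff (co q γ) l = 0 := by
  have h : dW γ = 0 := hγ.2
  rw [← co_dW hγ.1 hl, h, map_zero, Pi.zero_apply]

lemma exists_cocycle {q : ℕ} {w : List Gen → ℂ}
    (hw : ∀ b ∈ basis (q + 1), evalTerms (diffNorm b) w = 0) :
    ∃ γ ∈ cocycleSub q, ∀ b ∈ basis q, co q γ b = w b := by
  obtain ⟨f, hf, hs, he, hb⟩ := exists_skew q w
  obtain ⟨γ, hγ, hc⟩ := exists_cochain (q := q) hf hs
  have hdf : ∀ l : List Gen, l.length = q + 1 → diff f l = 0 := by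
    intro l hl
    by_cases h : excess l = 0
    · refine diff_eq_of_basis (g := fun _ => 0) hf (fun _ _ _ _ => neg_zero.symm) (fun b h' => ?_)
        hl h
      rw [← hw b h']
      exact evalTerms_congr fun p hp => hb _ (diffNorm_mem_basis h' hp)
    · exact diff_eq_zero_of_excess he h
  refine ⟨γ, ⟨hγ, ?_⟩, fun b h => (hc b (basis_length h)).trans (hb b h)⟩
  refine eq_zero_of_co (isPolyCochain_dW hγ.1) fun l hl => ?_
  rw [← hdf l hl]
  refine (co_dW hγ hl).trans (diff_congr ?_)
  exact fun w hw => hc w (by omega)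

lemma mem_cobound_of_basis {q : ℕ} {γ : WCochain (q + 1)} (hγ : γ ∈ cocycleSub (q + 1))
    {v : List Gen → ℂ}
    (hv : ∀ b ∈ basis (q + 1), evalTerms (diffNorm b) v = co (q + 1) γ b) :
    γ ∈ coboundSub (q + 1) := by
  have hc := skew_co hγ.1
  obtain ⟨f, hf, hs, he, hb⟩ := exists_skew q v
  let β : List Gen → ℂ := fun w => (excess w : ℂ)⁻¹ * co (q + 1) γ ((0, 1) :: w)
  have hβ : Skew β := fun p x y l => by
    have h₁ : excess (p ++ x :: y :: l) = excess (p ++ y :: x :: l) :=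
      excess_perm ((List.Perm.swap y x l).append_left p)
    have h₂ := hc.cons (0, 1) p x y l
    simp only at h₂
    simp only [β, h₁, h₂]
    ring
  have hβs : (Function.support β).Finite :=
    ((finite_support_co γ).preimage (f := List.cons (0, 1)) List.cons_injective.injOn).subset
      fun w hw => right_ne_zero_of_mul hw
  obtain ⟨δ, hδ, hδc⟩ := exists_cochain (q := q) (f := fun w => β w + f w)
    (fun p x y l => by simp only [hβ p x y l, hf p x y l]; ring)
    ((hβs.union hs).subset (Function.support_add β f))
  refine ⟨δ, hδ, sub_eq_zero.mp ?_⟩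
  have hpoly : IsPolyCochain (dWLin q δ - γ) := fun Y => by
    obtain ⟨P, hP⟩ := isPolyCochain_dW hδ.1 Y
    obtain ⟨Q, hQ⟩ := hγ.1.1 Y
    exact ⟨P - Q, fun l => by simp [← hP, ← hQ, dWLin]⟩
  refine eq_zero_of_co hpoly fun l hl => ?_
  have h₁ : diff β l = if excess l = 0 then 0 else co (q + 1) γ l :=
    diff_contract (diff_co_eq_zero hγ (by simp [hl]))
  have h₂ : diff f l = if excess l = 0 then co (q + 1) γ l else 0 := by
    split_ifs with h
    · refine diff_eq_of_basis hf hc (fun b h' => ?_) hl h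
      rw [← hv b h']
      exact evalTerms_congr fun p hp => hb _ (diffNorm_mem_basis h' hp)
    · exact diff_eq_zero_of_excess he h
  have h₃ : co (q + 1) (dWLin q δ) l = diff β l + diff f l := by
    rw [← diff_add]
    refine (co_dW hδ hl).trans (diff_congr fun w hw => hδc w (by omega))
  rw [map_sub, Pi.sub_apply, h₃, h₁, h₂]
  split_ifs <;> simp

/-- `g` is the differential of `v` on the sorted words of length `q` and excess zero. -/
def BasisDiff (q : ℕ) (v g : List Gen → ℂ) : Prop :=
  ∀ b ∈ basis q, evalTerms (diffNorm b) v = g b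

/-- Cohomology in degree `q + 1` from a linear functional on the words of excess zero. -/
theorem nonempty_linearEquiv {q h : ℕ} (φ : (List Gen → ℂ) →ₗ[ℂ] (Fin h → ℂ))
    (hloc : ∀ f g : List Gen → ℂ, (∀ b ∈ basis (q + 1), f b = g b) → φ f = φ g)
    (hbd : ∀ v g, BasisDiff (q + 1) v g → φ g = 0)
    (hker : ∀ f, BasisDiff (q + 2) f 0 → φ f = 0 → ∃ v, BasisDiff (q + 1) v f)
    (hsurj : ∀ t, ∃ w, BasisDiff (q + 2) w 0 ∧ φ w = t) :
    Nonempty (basicH (q + 1) ≃ₗ[ℂ] (Fin h → ℂ)) := by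
  let ψ : cocycleSub (q + 1) →ₗ[ℂ] (Fin h → ℂ) :=
    φ ∘ₗ co (q + 1) ∘ₗ (cocycleSub (q + 1)).subtype
  have hψ : Function.Surjective ψ := fun t => by
    obtain ⟨w, hw, rfl⟩ := hsurj t
    obtain ⟨γ, hγ, hc⟩ := exists_cocycle hw
    exact ⟨⟨γ, hγ⟩, hloc _ _ hc⟩
  have hk : Submodule.comap (cocycleSub (q + 1)).subtype (coboundSub (q + 1)) =
      LinearMap.ker ψ := by
    ext ⟨γ, hγ⟩
    simp only [Submodule.mem_comap, Submodule.subtype_apply, LinearMap.mem_ker]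
    constructor
    · rintro ⟨δ, hδ, rfl⟩
      refine hbd (co q δ) _ fun b hb => ?_
      exact ((co_dW hδ (basis_length hb)).trans ((skew_co hδ).diff_eq b)).symm
    · intro h0
      obtain ⟨v, hv⟩ := hker (co (q + 1) γ) (fun b hb => by
        rw [← (skew_co hγ.1).diff_eq, diff_co_eq_zero hγ (basis_length hb), Pi.zero_apply]) h0
      exact mem_cobound_of_basis hγ hv
  exact ⟨(Submodule.quotEquivOfEq _ _ hk).trans (ψ.quotKerEquivOfSurjective hψ)⟩

lemma finrank_basicH_zero : Module.finrank ℂ (basicH 0) = 1 := by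
  let ψ : cocycleSub 0 →ₗ[ℂ] ℂ :=
    { toFun := fun γ => γ.1 0 0
      map_add' := fun _ _ => rfl
      map_smul' := fun _ _ => rfl }
  have hψ : Function.Surjective ψ := fun t => by
    refine ⟨⟨fun _ _ => t, ⟨fun Y => ⟨C t, by simp⟩, fun σ Y l => ?_⟩, ?_⟩, rfl⟩
    · simp [Subsingleton.elim σ 1]
    · refine LinearMap.mem_ker.mpr ?_
      ext Y l
      change dW (fun _ _ => t) Y l = 0
      rw [dW]
      refine Finset.sum_eq_zero fun p hp => ?_
      exact absurd (Fin.ext (by omega)) (Finset.mem_filter.mp hp).2.ne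
  have hk : Submodule.comap (cocycleSub 0).subtype (coboundSub 0) = LinearMap.ker ψ := by
    ext ⟨γ, hγ⟩
    simp only [Submodule.mem_comap, Submodule.subtype_apply, LinearMap.mem_ker, coboundSub,
      Submodule.mem_bot]
    refine ⟨fun h => congrFun (congrFun h 0) 0, fun h => ?_⟩
    ext Y l
    rw [Subsingleton.elim Y 0, Subsingleton.elim l 0]
    exact h
  have e : basicH 0 ≃ₗ[ℂ] ℂ :=
    (Submodule.quotEquivOfEq _ _ hk).trans (ψ.quotKerEquivOfSurjective hψ)
  rw [e.finrank_eq, Module.finrank_self]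

lemma subsingleton_basicH {q : ℕ} (hq : 7 ≤ q) : Subsingleton (basicH q) := by
  obtain ⟨q, rfl⟩ : ∃ r, q = r + 1 := ⟨q - 1, by omega⟩
  obtain ⟨e⟩ := nonempty_linearEquiv (q := q) (h := 0) 0 (fun _ _ _ => rfl) (fun _ _ _ => rfl)
    (fun f _ _ => ⟨0, by simp [BasisDiff, basis_eq_nil hq]⟩)
    (fun t => ⟨0, by simp [BasisDiff, basis_eq_nil (show 7 ≤ q + 2 by omega)],
      Subsingleton.elim _ _⟩)
  exact e.toEquiv.subsingleton


/-! ### The complex spanned by the words of excess zero -/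

/-- The generator `λ^a / a!` on `L`. -/
abbrev L (a : ℕ) : Gen := (0, a)

/-- The generator `λ^a / a!` on `M`. -/
abbrev M (a : ℕ) : Gen := (1, a)

lemma basisDiff_iff {q : ℕ} {v g : List Gen → ℂ} : BasisDiff q v g ↔
    ∀ p ∈ (basis q).map fun b => (b, diffNorm b), evalTerms p.2 v = g p.1 := by
  simp [BasisDiff]

lemma basisDiff_one {v g : List Gen → ℂ} : BasisDiff 1 v g ↔
    0 = g [L 1] ∧
    0 = g [M 1] := by
  have h : ((basis 1).map fun b => (b, diffNorm b)) =
      [([L 1], []),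
       ([M 1], [])] := by
    decide +kernel
  simp [basisDiff_iff, h, evalTerms]

lemma basisDiff_two {v g : List Gen → ℂ} : BasisDiff 2 v g ↔
    2 * v [L 1] = g [L 0, L 2] ∧
    -2 * v [M 1] = g [L 2, M 0] ∧
    0 = g [L 1, M 1] ∧
    2 * v [M 1] = g [L 0, M 2] ∧
    0 = g [M 0, M 2] := by
  have h : ((basis 2).map fun b => (b, diffNorm b)) =
      [([L 0, L 2], [(2, [L 1])]),
       ([L 2, M 0], [(-2, [M 1])]),
       ([L 1, M 1], []),
       ([L 0, M 2], [(2, [M 1])]),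
       ([M 0, M 2], [])] := by
    decide +kernel
  simp [basisDiff_iff, h, evalTerms]

lemma basisDiff_three {v g : List Gen → ℂ} : BasisDiff 3 v g ↔
    0 = g [L 0, L 1, L 2] ∧
    2 * v [L 1, M 1] = g [L 1, L 2, M 0] ∧
    3 * v [L 2, M 0] + 3 * v [L 0, M 2] = g [L 0, L 3, M 0] ∧
    2 * v [L 1, M 1] + v [L 2, M 0] + v [L 0, M 2] = g [L 0, L 2, M 1] ∧
    -v [M 0, M 2] = g [L 2, M 0, M 1] ∧
    2 * v [L 1, M 1] = g [L 0, L 1, M 2] ∧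
    0 = g [L 1, M 0, M 2] ∧
    v [M 0, M 2] = g [L 0, M 1, M 2] ∧
    0 = g [M 0, M 1, M 2] ∧
    3 * v [M 0, M 2] = g [L 0, M 0, M 3] := by
  have h : ((basis 3).map fun b => (b, diffNorm b)) =
      [([L 0, L 1, L 2], [(1, [L 0, L 2]), (-1, [L 0, L 2])]),
       ([L 1, L 2, M 0], [(1, [L 2, M 0]), (-1, [L 2, M 0]), (2, [L 1, M 1])]),
       ([L 0, L 3, M 0], [(3, [L 2, M 0]), (3, [L 0, M 2])]),
       ([L 0, L 2, M 1], [(2, [L 1, M 1]), (1, [L 2, M 0]), (1, [L 0, M 2])]),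
       ([L 2, M 0, M 1], [(-1, [M 0, M 2])]),
       ([L 0, L 1, M 2], [(1, [L 0, M 2]), (2, [L 1, M 1]), (-1, [L 0, M 2])]),
       ([L 1, M 0, M 2], [(-1, [M 0, M 2]), (1, [M 0, M 2])]),
       ([L 0, M 1, M 2], [(1, [M 0, M 2])]),
       ([M 0, M 1, M 2], []),
       ([L 0, M 0, M 3], [(3, [M 0, M 2])])] := by
    decide +kernel
  simp [basisDiff_iff, h, evalTerms, add_assoc, ← sub_eq_add_neg]

lemma basisDiff_four {v g : List Gen → ℂ} : BasisDiff 4 v g ↔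
    3 * v [L 1, L 2, M 0] - 3 * v [L 0, L 1, M 2] = g [L 0, L 1, L 3, M 0] ∧
    v [L 1, L 2, M 0] - v [L 0, L 1, M 2] = g [L 0, L 1, L 2, M 1] ∧
    v [L 1, M 0, M 2] = g [L 1, L 2, M 0, M 1] ∧
    3 * v [L 2, M 0, M 1] - 3 * v [L 0, M 1, M 2] + 2 * v [L 0, M 0, M 3] =
      g [L 0, L 3, M 0, M 1] ∧
    2 * v [L 1, M 0, M 2] + 2 * v [L 2, M 0, M 1] + 2 * v [L 0, M 1, M 2] =
      g [L 0, L 2, M 0, M 2] ∧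
    v [L 1, M 0, M 2] = g [L 0, L 1, M 1, M 2] ∧
    0 = g [L 1, M 0, M 1, M 2] ∧
    3 * v [L 1, M 0, M 2] = g [L 0, L 1, M 0, M 3] ∧
    3 * v [M 0, M 1, M 2] = g [L 0, M 0, M 1, M 3] := by
  have h : ((basis 4).map fun b => (b, diffNorm b)) =
      [([L 0, L 1, L 3, M 0],
      [(1, [L 0, L 3, M 0]), (3, [L 1, L 2, M 0]), (-2, [L 0, L 3, M 0]), (1, [L 0, L 3, M 0]),
       (-3, [L 0, L 1, M 2])]),
       ([L 0, L 1, L 2, M 1],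
      [(1, [L 0, L 2, M 1]), (1, [L 1, L 2, M 0]), (-1, [L 0, L 2, M 1]), (-1, [L 0, L 1, M 2])]),
       ([L 1, L 2, M 0, M 1], [(1, [L 2, M 0, M 1]), (-1, [L 2, M 0, M 1]), (1, [L 1, M 0, M 2])]),
       ([L 0, L 3, M 0, M 1], [(3, [L 2, M 0, M 1]), (-3, [L 0, M 1, M 2]), (2, [L 0, M 0, M 3])]),
       ([L 0, L 2, M 0, M 2], [(2, [L 1, M 0, M 2]), (2, [L 2, M 0, M 1]), (2, [L 0, M 1, M 2])]),
       ([L 0, L 1, M 1, M 2], [(1, [L 0, M 1, M 2]), (1, [L 1, M 0, M 2]), (-1, [L 0, M 1, M 2])]),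
       ([L 1, M 0, M 1, M 2], [(-1, [M 0, M 1, M 2]), (1, [M 0, M 1, M 2])]),
       ([L 0, L 1, M 0, M 3],
      [(1, [L 0, M 0, M 3]), (3, [L 1, M 0, M 2]), (1, [L 0, M 0, M 3]), (-2, [L 0, M 0, M 3])]),
       ([L 0, M 0, M 1, M 3], [(3, [M 0, M 1, M 2])])] := by
    decide +kernel
  simp [basisDiff_iff, h, evalTerms]
  grind

lemma basisDiff_five {v g : List Gen → ℂ} : BasisDiff 5 v g ↔
    3 * v [L 1, L 2, M 0, M 1] + 3 * v [L 0, L 1, M 1, M 2] - 2 * v [L 0, L 1, M 0, M 3] =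
      g [L 0, L 1, L 3, M 0, M 1] ∧
    2 * v [L 1, L 2, M 0, M 1] - 2 * v [L 0, L 1, M 1, M 2] = g [L 0, L 1, L 2, M 0, M 2] ∧
    2 * v [L 1, M 0, M 1, M 2] = g [L 0, L 2, M 0, M 1, M 2] ∧
    3 * v [L 1, M 0, M 1, M 2] = g [L 0, L 1, M 0, M 1, M 3] := by
  have h : ((basis 5).map fun b => (b, diffNorm b)) =
      [([L 0, L 1, L 3, M 0, M 1],
      [(1, [L 0, L 3, M 0, M 1]), (3, [L 1, L 2, M 0, M 1]), (-2, [L 0, L 3, M 0, M 1]),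
       (1, [L 0, L 3, M 0, M 1]), (3, [L 0, L 1, M 1, M 2]), (-2, [L 0, L 1, M 0, M 3])]),
       ([L 0, L 1, L 2, M 0, M 2],
      [(1, [L 0, L 2, M 0, M 2]), (2, [L 1, L 2, M 0, M 1]), (-1, [L 0, L 2, M 0, M 2]),
       (1, [L 0, L 2, M 0, M 2]), (-1, [L 0, L 2, M 0, M 2]), (-2, [L 0, L 1, M 1, M 2])]),
       ([L 0, L 2, M 0, M 1, M 2], [(2, [L 1, M 0, M 1, M 2])]),
       ([L 0, L 1, M 0, M 1, M 3],
      [(1, [L 0, M 0, M 1, M 3]), (3, [L 1, M 0, M 1, M 2]), (1, [L 0, M 0, M 1, M 3]),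
       (-2, [L 0, M 0, M 1, M 3])])] := by
    decide +kernel
  simp [basisDiff_iff, h, evalTerms]
  grind

lemma basisDiff_six {v g : List Gen → ℂ} : BasisDiff 6 v g ↔
    0 = g [L 0, L 1, L 2, M 0, M 1, M 2] := by
  have h : ((basis 6).map fun b => (b, diffNorm b)) =
      [([L 0, L 1, L 2, M 0, M 1, M 2],
      [(1, [L 0, L 2, M 0, M 1, M 2]), (-1, [L 0, L 2, M 0, M 1, M 2]),
       (1, [L 0, L 2, M 0, M 1, M 2]), (-1, [L 0, L 2, M 0, M 1, M 2])])] := by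
    decide +kernel
  simp [basisDiff_iff, h, evalTerms]

lemma subsingleton_of_equiv {q : ℕ} (h : Nonempty (basicH q ≃ₗ[ℂ] (Fin 0 → ℂ))) :
    Subsingleton (basicH q) :=
  h.elim fun e => e.toEquiv.subsingleton

lemma finrank_of_equiv {q h : ℕ} (e : Nonempty (basicH q ≃ₗ[ℂ] (Fin h → ℂ))) :
    Module.finrank ℂ (basicH q) = h :=
  e.elim fun e => by rw [e.finrank_eq, Module.finrank_fin_fun]

/-- The evaluation of a function of words at the word `l`. -/
abbrev ev (l : List Gen) : (List Gen → ℂ) →ₗ[ℂ] ℂ := LinearMap.proj l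

lemma subsingleton_basicH_one : Subsingleton (basicH 1) := by
  refine subsingleton_of_equiv (nonempty_linearEquiv (q := 0) 0 (fun _ _ _ => rfl)
    (fun _ _ _ => rfl) (fun f hf _ => ⟨0, ?_⟩) (fun t => ⟨0, ?_, Subsingleton.elim _ _⟩))
  · rw [basisDiff_two] at hf
    rw [basisDiff_one]
    simp only [Pi.zero_apply] at hf
    grind
  · simp [basisDiff_two]

lemma subsingleton_basicH_two : Subsingleton (basicH 2) := by
  refine subsingleton_of_equiv (nonempty_linearEquiv (q := 1) 0 (fun _ _ _ => rfl)
    (fun _ _ _ => rfl) (fun f hf _ => ⟨fun l => if l = [L 1] then f [L 0, L 2] / 2 else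
      if l = [M 1] then f [L 0, M 2] / 2 else 0, ?_⟩) (fun t => ⟨0, ?_, Subsingleton.elim _ _⟩))
  · rw [basisDiff_three] at hf
    simp only [Pi.zero_apply] at hf
    rw [basisDiff_two]
    simp
    grind
  · simp [basisDiff_three]

lemma finrank_basicH_three : Module.finrank ℂ (basicH 3) = 2 := by
  refine finrank_of_equiv (nonempty_linearEquiv (q := 2)
    (LinearMap.pi ![ev [L 0, L 1, L 2],
      ev [L 0, L 2, M 1] - ev [L 0, L 1, M 2] - (1 / 3 : ℂ) • ev [L 0, L 3, M 0]])
    (fun f g h => ?_) (fun v g h => ?_)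
    (fun f hf h => ⟨fun l => if l = [L 1, M 1] then f [L 0, L 1, M 2] / 2 else
      if l = [L 0, M 2] then f [L 0, L 3, M 0] / 3 else
      if l = [M 0, M 2] then f [L 0, M 1, M 2] else 0, ?_⟩)
    (fun t => ⟨fun l => if l = [L 0, L 1, L 2] then t 0 else
      if l = [L 0, L 2, M 1] then t 1 else 0, ?_, ?_⟩))
  · have h₁ := h [L 0, L 1, L 2] (by decide +kernel)
    have h₂ := h [L 0, L 2, M 1] (by decide +kernel)
    have h₃ := h [L 0, L 1, M 2] (by decide +kernel)
    have h₄ := h [L 0, L 3, M 0] (by decide +kernel)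
    ext i
    fin_cases i <;> simp [h₁, h₂, h₃, h₄]
  · rw [basisDiff_three] at h
    ext i
    fin_cases i <;> simp <;> grind
  · rw [basisDiff_four] at hf
    have h₀ := congrFun h 0
    have h₁ := congrFun h 1
    simp only [Pi.zero_apply] at hf
    simp at h₀ h₁
    simp [basisDiff_three]
    grind
  · simp [basisDiff_four]
  · ext i
    fin_cases i <;> simp

lemma finrank_basicH_four : Module.finrank ℂ (basicH 4) = 1 := by
  refine finrank_of_equiv (nonempty_linearEquiv (q := 3)
    (LinearMap.pi ![ev [L 0, L 1, L 2, M 1] - (1 / 3 : ℂ) • ev [L 0, L 1, L 3, M 0]])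
    (fun f g h => ?_) (fun v g h => ?_)
    (fun f hf h => ⟨fun l => if l = [L 1, L 2, M 0] then f [L 0, L 1, L 2, M 1] else
      if l = [L 1, M 0, M 2] then f [L 0, L 1, M 1, M 2] else
      if l = [L 2, M 0, M 1] then f [L 0, L 2, M 0, M 2] / 2 - f [L 0, L 1, M 1, M 2] else
      if l = [L 0, M 0, M 3] then (f [L 0, L 3, M 0, M 1] -
        3 * (f [L 0, L 2, M 0, M 2] / 2 - f [L 0, L 1, M 1, M 2])) / 2 else
      if l = [M 0, M 1, M 2] then f [L 0, M 0, M 1, M 3] / 3 else 0, ?_⟩)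
    (fun t => ⟨fun l => if l = [L 0, L 1, L 2, M 1] then t 0 else 0, ?_, ?_⟩))
  · have h₁ := h [L 0, L 1, L 2, M 1] (by decide +kernel)
    have h₂ := h [L 0, L 1, L 3, M 0] (by decide +kernel)
    ext i
    fin_cases i
    simp [h₁, h₂]
  · rw [basisDiff_four] at h
    ext i
    fin_cases i
    simp
    grind
  · rw [basisDiff_five] at hf
    have h₀ := congrFun h 0
    simp only [Pi.zero_apply] at hf
    simp at h₀
    simp [basisDiff_four]
    grind
  · simp [basisDiff_five]
  · ext i
    fin_cases i
    simp

lemma finrank_basicH_five : Module.finrank ℂ (basicH 5) = 1 := by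
  refine finrank_of_equiv (nonempty_linearEquiv (q := 4)
    (LinearMap.pi ![ev [L 0, L 2, M 0, M 1, M 2] - (2 / 3 : ℂ) • ev [L 0, L 1, M 0, M 1, M 3]])
    (fun f g h => ?_) (fun v g h => ?_)
    (fun f hf h => ⟨fun l => if l = [L 1, L 2, M 0, M 1] then f [L 0, L 1, L 2, M 0, M 2] / 2 else
      if l = [L 0, L 1, M 0, M 3] then
        (3 / 2 * f [L 0, L 1, L 2, M 0, M 2] - f [L 0, L 1, L 3, M 0, M 1]) / 2 else
      if l = [L 1, M 0, M 1, M 2] then f [L 0, L 1, M 0, M 1, M 3] / 3 else 0, ?_⟩)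
    (fun t => ⟨fun l => if l = [L 0, L 2, M 0, M 1, M 2] then t 0 else 0, ?_, ?_⟩))
  · have h₁ := h [L 0, L 2, M 0, M 1, M 2] (by decide +kernel)
    have h₂ := h [L 0, L 1, M 0, M 1, M 3] (by decide +kernel)
    ext i
    fin_cases i
    simp [h₁, h₂]
  · rw [basisDiff_five] at h
    ext i
    fin_cases i
    simp
    grind
  · have h₀ := congrFun h 0
    simp at h₀
    simp [basisDiff_five]
    grind
  · simp [basisDiff_six]
  · ext i
    fin_cases i
    simp

lemma finrank_basicH_six : Module.finrank ℂ (basicH 6) = 1 := by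
  refine finrank_of_equiv (nonempty_linearEquiv (q := 5)
    (LinearMap.pi ![ev [L 0, L 1, L 2, M 0, M 1, M 2]])
    (fun f g h => ?_) (fun v g h => ?_) (fun f hf h => ⟨0, ?_⟩)
    (fun t => ⟨fun l => if l = [L 0, L 1, L 2, M 0, M 1, M 2] then t 0 else 0, ?_, ?_⟩))
  · ext i
    fin_cases i
    exact h _ (by decide +kernel)
  · ext i
    fin_cases i
    exact (basisDiff_six.mp h).symm
  · exact basisDiff_six.mpr (congrFun h 0).symm
  · simp [BasisDiff, basis_eq_nil (le_refl 7)]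
  · ext i
    fin_cases i
    simp

end W22

/-- the basic cohomology of the W(2,2) Lie conformal algebra
`𝒲` with trivial coefficients `ℂ`: `dim H̃⁰ = 1`, `H̃¹ = H̃² = 0`,
`dim H̃³ = 2`, `dim H̃⁴ = dim H̃⁵ = dim H̃⁶ = 1`, and `H̃^q = 0` for `q ≥ 7`. -/
theorem stmt12 :
    Module.finrank ℂ (basicH 0) = 1 ∧
    Subsingleton (basicH 1) ∧
    Subsingleton (basicH 2) ∧
    Module.finrank ℂ (basicH 3) = 2 ∧
    Module.finrank ℂ (basicH 4) = 1 ∧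
    Module.finrank ℂ (basicH 5) = 1 ∧
    Module.finrank ℂ (basicH 6) = 1 ∧
    ∀ q : ℕ, 7 ≤ q → Subsingleton (basicH q) := by
  exact ⟨W22.finrank_basicH_zero, W22.subsingleton_basicH_one, W22.subsingleton_basicH_two,
    W22.finrank_basicH_three, W22.finrank_basicH_four, W22.finrank_basicH_five,
    W22.finrank_basicH_six, fun _ hq => W22.subsingleton_basicH hq⟩
end

section
/- For the W(2,2) Lie conformal algebra 𝒲 with trivial coefficients ℂ, the reduced cohomology satisfies: dim H⁰ = 1, dim H¹ = 0, dim H² = 2, dim H³ = 3, dim H⁴ = dim H⁵ = 2, dim H⁶ = 1, and H^q = 0 for q ≥ 7. -/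
open MvPolynomial

/-! ### Chevalley–Eilenberg cochains of a Lie algebra with a multiplicative basis -/

/-- The structure constants of a Lie algebra with a basis `G` in which the bracket of `g` and `h`
is the multiple `coef g h` of the basis element `mul g h`. -/
structure BasisBracket (G R : Type*) [CommRing R] where
  mul : G → G → G
  coef : G → G → R
  mul_comm : ∀ g h, mul g h = mul h g
  coef_antisymm : ∀ g h, coef h g = -coef g h
  jacobi : ∀ (a b c : G) (F : G → R),
    coef a b * coef (mul a b) c * F (mul (mul a b) c) +
    coef b c * coef (mul b c) a * F (mul (mul b c) a) +
    coef c a * coef (mul c a) b * F (mul (mul c a) b) = 0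

/-- Insertion of a basis element in the first slot. -/
def insertFirst {G R : Type*} {q : ℕ} (g : G) (f : (Fin (q + 1) → G) → R) : (Fin q → G) → R :=
  fun Y => f (Fin.cons g Y)

/-- Alternating functions of `q` basis elements. -/
def IsAlt {G R : Type*} [CommRing R] {q : ℕ} (f : (Fin q → G) → R) : Prop :=
  ∀ (σ : Equiv.Perm (Fin q)) (Y : Fin q → G), f (Y ∘ σ) = (Equiv.Perm.sign σ : ℤ) * f Y

section insertFirst

variable {G R : Type*} [CommRing R] {q : ℕ}

theorem insertFirst_ext {G R : Type*} {q : ℕ} {f f' : (Fin (q + 1) → G) → R}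
    (h : ∀ g, insertFirst g f = insertFirst g f') : f = f' := by
  funext Y
  rw [← Fin.cons_self_tail Y]
  exact congrFun (h (Y 0)) (Fin.tail Y)

theorem insertFirst_add (g : G) (f f' : (Fin (q + 1) → G) → R) :
    insertFirst g (f + f') = insertFirst g f + insertFirst g f' := rfl

theorem insertFirst_sub (g : G) (f f' : (Fin (q + 1) → G) → R) :
    insertFirst g (f - f') = insertFirst g f - insertFirst g f' := rfl

theorem insertFirst_smul (a : R) (g : G) (f : (Fin (q + 1) → G) → R) :
    insertFirst g (a • f) = a • insertFirst g f := rfl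

theorem cons_comp_decomposeFin {α : Type*} (g : α) (Y : Fin q → α) (σ : Equiv.Perm (Fin q)) :
    (Fin.cons g Y : Fin (q + 1) → α) ∘ (Equiv.Perm.decomposeFin.symm (0, σ)) =
      Fin.cons g (Y ∘ σ) := by
  funext i
  refine Fin.cases ?_ (fun j => ?_) i <;> simp

theorem IsAlt.insertFirst {f : (Fin (q + 1) → G) → R} (hf : IsAlt f) (g : G) :
    IsAlt (insertFirst g f) := by
  intro σ Y
  have := hf (Equiv.Perm.decomposeFin.symm (0, σ)) (Fin.cons g Y)
  rw [cons_comp_decomposeFin] at this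
  simpa [_root_.insertFirst] using this

theorem IsAlt.cons_cons {f : (Fin (q + 2) → G) → R} (hf : IsAlt f) (g h : G) (Y : Fin q → G) :
    f (Fin.cons g (Fin.cons h Y)) = -f (Fin.cons h (Fin.cons g Y)) := by
  have := hf (Equiv.swap 0 1) (Fin.cons h (Fin.cons g Y))
  rw [Equiv.Perm.sign_swap (by simp)] at this
  have e : (Fin.cons h (Fin.cons g Y) : Fin (q + 2) → G) ∘ (Equiv.swap 0 1) =
      Fin.cons g (Fin.cons h Y) := by
    funext i
    refine Fin.cases ?_ (fun j => Fin.cases ?_ (fun l => ?_) j) i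
    · simp
    · simp
    · simp only [Function.comp]
      rw [Equiv.swap_apply_of_ne_of_ne (by simp) (by simp [Fin.ext_iff])]
      simp
  rw [e] at this
  simpa using this

theorem isAlt_of_subsingleton [Subsingleton (Fin q)] (f : (Fin q → G) → R) : IsAlt f := by
  intro σ Y
  have : σ = 1 := Subsingleton.elim _ _
  simp [this]

theorem isAlt_of_insertFirst {f : (Fin (q + 2) → G) → R}
    (hf : ∀ g, IsAlt (insertFirst g f))
    (hs : ∀ g h Y, f (Fin.cons g (Fin.cons h Y)) = -f (Fin.cons h (Fin.cons g Y))) :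
    IsAlt f := by
  intro σ
  have hσ : σ ∈ Submonoid.closure
      (Set.range fun i : Fin (q + 1) => Equiv.swap i.castSucc i.succ) := by
    rw [Equiv.Perm.mclosure_swap_castSucc_succ]; trivial
  induction hσ using Submonoid.closure_induction with
  | one => intro Y; simp
  | mul σ τ _ _ h1 h2 =>
    intro Y
    have : Y ∘ (σ * τ : Equiv.Perm _) = (Y ∘ σ) ∘ τ := rfl
    rw [this, h2, h1, map_mul]; push_cast; ring
  | mem σ h =>
    obtain ⟨i, rfl⟩ := h
    intro Y
    refine Fin.cases ?_ (fun j => ?_) i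
    · obtain ⟨g, Z, rfl⟩ : ∃ g Z, Y = Fin.cons g Z := ⟨_, _, (Fin.cons_self_tail Y).symm⟩
      obtain ⟨h, Z, rfl⟩ : ∃ g Z', Z = Fin.cons g Z' := ⟨_, _, (Fin.cons_self_tail Z).symm⟩
      have e : (Fin.cons g (Fin.cons h Z) : Fin (q + 2) → G) ∘
          (Equiv.swap (Fin.castSucc 0) (Fin.succ 0)) = Fin.cons h (Fin.cons g Z) := by
        funext i
        refine Fin.cases ?_ (fun j => Fin.cases ?_ (fun l => ?_) j) i
        · simp
        · simp
        · simp only [Function.comp]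
          rw [Equiv.swap_apply_of_ne_of_ne (by simp) (by simp [Fin.ext_iff])]
          simp
      dsimp only
      rw [e, hs, Equiv.Perm.sign_swap (by simp)]
      simp
    · obtain ⟨g, Z, rfl⟩ : ∃ g Z, Y = Fin.cons g Z := ⟨_, _, (Fin.cons_self_tail Y).symm⟩
      have e : Equiv.swap j.succ.castSucc j.succ.succ =
          Equiv.Perm.decomposeFin.symm (0, Equiv.swap j.castSucc j.succ) := by
        ext i
        refine Fin.cases ?_ (fun l => ?_) i
        · rw [Equiv.swap_apply_of_ne_of_ne] <;> simp [Fin.ext_iff]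
        · rw [← Fin.succ_castSucc, (Fin.succ_injective _).swap_apply]
          simp
      dsimp only
      rw [e, cons_comp_decomposeFin]
      have := hf g (Equiv.swap j.castSucc j.succ) Z
      simpa [insertFirst] using this

end insertFirst

namespace BasisBracket

variable {G R : Type*} [CommRing R] (B : BasisBracket G R)

/-- The coadjoint action of a basis element on cochains. -/
def lie {q : ℕ} (g : G) (f : (Fin q → G) → R) : (Fin q → G) → R :=
  fun Y => -∑ j, B.coef g (Y j) * f (Function.update Y j (B.mul g (Y j)))

/-- The Chevalley–Eilenberg differential with trivial coefficients, defined through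
Cartan's formula. -/
def diff : ∀ {q : ℕ}, ((Fin q → G) → R) → ((Fin (q + 1) → G) → R)
  | 0, _ => 0
  | _ + 1, f => fun Y => B.lie (Y 0) f (Fin.tail Y) - diff (insertFirst (Y 0) f) (Fin.tail Y)

theorem diff_of_zero (f : (Fin 0 → G) → R) : B.diff f = 0 := rfl

theorem insertFirst_diff {q : ℕ} (g : G) (f : (Fin (q + 1) → G) → R) :
    insertFirst g (B.diff f) = B.lie g f - B.diff (insertFirst g f) := by
  funext Y
  simp [insertFirst, diff]

theorem lie_add {q : ℕ} (g : G) (f f' : (Fin q → G) → R) :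
    B.lie g (f + f') = B.lie g f + B.lie g f' := by
  funext Y
  simp only [lie, Pi.add_apply, mul_add, Finset.sum_add_distrib]; ring

theorem lie_smul {q : ℕ} (a : R) (g : G) (f : (Fin q → G) → R) :
    B.lie g (a • f) = a • B.lie g f := by
  funext Y
  simp only [lie, Pi.smul_apply, smul_eq_mul, mul_neg, Finset.mul_sum]
  congr 1
  exact Finset.sum_congr rfl fun i _ => by ring

theorem lie_sub {q : ℕ} (g : G) (f f' : (Fin q → G) → R) :
    B.lie g (f - f') = B.lie g f - B.lie g f' := by
  funext Y
  simp only [lie, Pi.sub_apply, mul_sub, Finset.sum_sub_distrib]; ring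

theorem diff_add {q : ℕ} (f f' : (Fin q → G) → R) : B.diff (f + f') = B.diff f + B.diff f' := by
  induction q with
  | zero => simp [diff_of_zero]
  | succ q ih =>
    refine insertFirst_ext fun g => ?_
    simp only [insertFirst_add, insertFirst_diff, lie_add, ih]; abel

theorem diff_smul {q : ℕ} (a : R) (f : (Fin q → G) → R) : B.diff (a • f) = a • B.diff f := by
  induction q with
  | zero => simp [diff_of_zero]
  | succ q ih =>
    refine insertFirst_ext fun g => ?_
    simp only [insertFirst_smul, insertFirst_diff, lie_smul, ih, smul_sub]

theorem diff_sub {q : ℕ} (f f' : (Fin q → G) → R) : B.diff (f - f') = B.diff f - B.diff f' := by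
  have := B.diff_add (f - f') f'
  rw [sub_add_cancel] at this
  rw [this, add_sub_cancel_right]

theorem insertFirst_lie {q : ℕ} (g h : G) (f : (Fin (q + 1) → G) → R) :
    insertFirst h (B.lie g f) =
      B.lie g (insertFirst h f) - B.coef g h • insertFirst (B.mul g h) f := by
  funext Y
  simp only [insertFirst, lie, Fin.sum_univ_succ, Fin.cons_zero, Fin.cons_succ,
    Fin.update_cons_zero, ← Fin.cons_update, Pi.sub_apply, Pi.smul_apply, smul_eq_mul]
  ring

theorem lie_lie {q : ℕ} (g h : G) (f : (Fin q → G) → R) :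
    B.lie g (B.lie h f) = B.lie h (B.lie g f) + B.coef g h • B.lie (B.mul g h) f := by
  induction q with
  | zero => funext Y; simp [lie]
  | succ q ih =>
    refine insertFirst_ext fun x => ?_
    funext Y
    have jac := B.jacobi g h x fun y => f (Fin.cons y Y)
    have e := congrFun (ih (insertFirst x f)) Y
    have c1 := B.mul_comm x g
    have c2 := B.coef_antisymm x g
    have c3 := B.mul_comm h (B.mul g x)
    have c4 := B.mul_comm g (B.mul h x)
    have c5 := B.coef_antisymm g (B.mul h x)
    have c6 := B.coef_antisymm h (B.mul g x)
    simp only [insertFirst_lie, insertFirst_add, insertFirst_smul, lie_sub, lie_smul,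
      Pi.add_apply, Pi.sub_apply, Pi.smul_apply, smul_eq_mul] at e ⊢
    simp only [insertFirst] at e ⊢
    rw [c3, c4]
    rw [c1, c6, c5] at jac
    rw [e]
    linear_combination jac + B.coef h (B.mul g x) *
      f (Fin.cons (B.mul (B.mul g x) h) Y) * c2

theorem lie_diff {q : ℕ} (g : G) (f : (Fin q → G) → R) :
    B.lie g (B.diff f) = B.diff (B.lie g f) := by
  induction q with
  | zero => funext Y; simp [lie, diff_of_zero]
  | succ q ih =>
    refine insertFirst_ext fun h => ?_
    simp only [insertFirst_lie, insertFirst_diff, lie_sub, diff_sub, diff_smul, ih,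
      B.lie_lie g h f, smul_sub]
    abel

theorem diff_diff {q : ℕ} (f : (Fin q → G) → R) : B.diff (B.diff f) = 0 := by
  induction q with
  | zero =>
    have := B.diff_smul (0 : R) (B.diff f)
    rw [diff_of_zero] at this ⊢
    simpa using this
  | succ q ih =>
    refine insertFirst_ext fun h => ?_
    rw [insertFirst_diff, insertFirst_diff, diff_sub, ih, lie_diff]
    simp; rfl

theorem isAlt_lie {q : ℕ} (g : G) {f : (Fin q → G) → R} (hf : IsAlt f) : IsAlt (B.lie g f) := by
  intro σ Y
  simp only [lie, mul_neg, Finset.mul_sum]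
  congr 1
  rw [← Equiv.sum_comp σ fun j => _ * (B.coef g (Y j) * _)]
  refine Finset.sum_congr rfl fun j _ => ?_
  have := hf σ (Function.update Y (σ j) (B.mul g (Y (σ j))))
  rw [Function.update_comp_equiv, Equiv.symm_apply_apply] at this
  simp only [Function.comp_apply]
  rw [this]; ring

theorem isAlt_diff {q : ℕ} {f : (Fin q → G) → R} (hf : IsAlt f) : IsAlt (B.diff f) := by
  induction q with
  | zero => exact @isAlt_of_subsingleton _ _ _ _ (inferInstanceAs (Subsingleton (Fin 1))) _
  | succ q ih =>
    refine isAlt_of_insertFirst (fun g => ?_) fun g h Y => ?_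
    · rw [insertFirst_diff]
      intro σ Y
      rw [Pi.sub_apply, Pi.sub_apply, B.isAlt_lie g hf, ih (hf.insertFirst g)]; ring
    · have key : ∀ g h, B.diff f (Fin.cons g (Fin.cons h Y)) =
          insertFirst h (insertFirst g (B.diff f)) Y := fun _ _ => rfl
      rw [key, key, insertFirst_diff, insertFirst_diff, insertFirst_sub, insertFirst_sub,
        insertFirst_lie, insertFirst_lie]
      cases q with
      | zero =>
        simp only [diff_of_zero, Pi.sub_apply, Pi.smul_apply, smul_eq_mul]
        rw [B.coef_antisymm g h, B.mul_comm g h]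
        simp [lie, insertFirst]
      | succ q =>
        have e : insertFirst h (insertFirst g f) = (-1 : R) • insertFirst g (insertFirst h f) := by
          funext Z
          simp only [insertFirst, Pi.smul_apply, smul_eq_mul]
          rw [hf.cons_cons]; ring
        rw [insertFirst_diff, insertFirst_diff, e, diff_smul, B.coef_antisymm g h, B.mul_comm h g]
        simp only [Pi.sub_apply, Pi.smul_apply, smul_eq_mul]
        ring

end BasisBracket

/-! ### The differential `dW` is the Chevalley–Eilenberg differential -/

section removeTwo

variable {α : Type*} {n : ℕ}

theorem removeTwo_cons_zero_succ (j : Fin n) (a : α) (Z : Fin n → α) (d : α) (k : ℕ) :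
    removeTwo (0 : Fin (n + 1)) j.succ (Fin.cons a Z : Fin (n + 1) → α) d k =
      ((List.ofFn Z).eraseIdx j).getD k d := by
  simp [removeTwo, List.ofFn_succ]

theorem removeTwo_cons_succ_succ_zero (i j : Fin n) (a : α) (Z : Fin n → α) (d : α) :
    removeTwo i.succ j.succ (Fin.cons a Z : Fin (n + 1) → α) d 0 = a := by
  simp [removeTwo, List.ofFn_succ]

theorem removeTwo_cons_succ_succ_succ (i j : Fin n) (a : α) (Z : Fin n → α) (d : α) (k : ℕ) :
    removeTwo i.succ j.succ (Fin.cons a Z : Fin (n + 1) → α) d (k + 1) =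
      removeTwo i j Z d k := by
  simp [removeTwo, List.ofFn_succ]

theorem removeTwo_comp {β : Type*} (f : α → β) (i j : Fin n) (Z : Fin n → α) (d : α) (k : ℕ) :
    removeTwo i j (f ∘ Z) (f d) k = f (removeTwo i j Z d k) := by
  simp only [removeTwo, ← List.map_ofFn, List.eraseIdx_map, List.getD_map]

theorem getD_eraseIdx_ofFn (Z : Fin (n + 1) → α) (j : Fin (n + 1)) (d : α) (k : Fin n) :
    ((List.ofFn Z).eraseIdx j).getD k d = j.removeNth Z k := by
  have hl : (k : ℕ) < ((List.ofFn Z).eraseIdx j).length := by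
    have := j.is_le
    have := k.isLt
    simp only [List.length_eraseIdx, List.length_ofFn]
    split_ifs <;> omega
  rw [List.getD_eq_getElem _ _ hl, List.getElem_eraseIdx]
  simp only [List.getElem_ofFn, Fin.removeNth, Fin.succAbove, Fin.lt_def, Fin.val_castSucc]
  split_ifs <;> rfl

end removeTwo

theorem IsAlt.cons_removeNth {G R : Type*} [CommRing R] {q : ℕ} {f : (Fin (q + 1) → G) → R}
    (hf : IsAlt f) (j : Fin (q + 1)) (v : G) (Z : Fin (q + 1) → G) :
    f (Fin.cons v (j.removeNth Z)) = (-1) ^ (j : ℕ) * f (Function.update Z j v) := by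
  have h := hf j.cycleRange.symm (Function.update Z j v)
  rw [← Fin.cons_removeNth_eq_comp_cycleRange_symm] at h
  simpa [Equiv.Perm.sign_symm, Fin.sign_cycleRange] using h

namespace BasisBracket

variable {G R : Type*} [CommRing R] (B : BasisBracket G R)

/-- The Chevalley–Eilenberg differential as a sum over pairs of slots. -/
def pairDiff {q : ℕ} (d : G) (f : (Fin q → G) → R) : (Fin (q + 1) → G) → R := fun Y =>
  ∑ p ∈ Finset.univ.filter (fun p : Fin (q + 1) × Fin (q + 1) => p.1 < p.2),
    (-1 : R) ^ (p.1.val + p.2.val) * B.coef (Y p.1) (Y p.2) *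
      f (fun k => if k.val = 0 then B.mul (Y p.1) (Y p.2) else removeTwo p.1 p.2 Y d (k.val - 1))

theorem pairDiff_eq_diff {q : ℕ} (d : G) {f : (Fin q → G) → R} (hf : IsAlt f) :
    B.pairDiff d f = B.diff f := by
  induction q with
  | zero =>
    funext Y
    rw [diff_of_zero]
    refine Finset.sum_eq_zero fun p hp => ?_
    have := (Finset.mem_filter.1 hp).2
    omega
  | succ q ih =>
    refine insertFirst_ext fun g => ?_
    rw [insertFirst_diff, ← ih (hf.insertFirst g)]
    funext Z
    simp only [insertFirst, pairDiff, Pi.sub_apply, Finset.sum_filter, Fintype.sum_prod_type]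
    rw [Fin.sum_univ_succ, Fin.sum_univ_succ, sub_eq_add_neg]
    simp only [Fin.sum_univ_succ (n := q + 1), lt_irrefl, if_false, zero_add, Fin.succ_pos,
      if_true, not_lt_zero, Fin.succ_lt_succ_iff, Fin.cons_zero, Fin.cons_succ]
    congr 1
    · rw [lie, ← Finset.sum_neg_distrib]
      refine Finset.sum_congr rfl fun j _ => ?_
      have e : (fun k : Fin (q + 1) => if k.val = 0 then B.mul g (Z j) else
          removeTwo (0 : Fin (q + 2)) j.succ (Fin.cons g Z : Fin (q + 2) → G) d (k.val - 1)) =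
          Fin.cons (B.mul g (Z j)) (j.removeNth Z) := by
        funext k
        refine Fin.cases ?_ (fun k => ?_) k
        · simp
        · rw [Fin.cons_succ, ← getD_eraseIdx_ofFn Z j d k]
          exact removeTwo_cons_zero_succ j g Z d k
      rw [e, hf.cons_removeNth]
      have h1 : ((-1 : R) ^ (j : ℕ)) * (-1) ^ (j : ℕ) = 1 := by
        rw [← mul_pow]; simp
      simp only [Fin.val_zero, Fin.val_succ, zero_add, pow_succ]
      linear_combination (-B.coef g (Z j) * f (Function.update Z j (B.mul g (Z j)))) * h1
    · rw [← Finset.sum_neg_distrib]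
      refine Finset.sum_congr rfl fun i _ => ?_
      rw [← Finset.sum_neg_distrib]
      refine Finset.sum_congr rfl fun j _ => ?_
      split_ifs with hij
      swap
      · simp
      cases q with
      | zero => omega
      | succ q =>
      have e : (fun k : Fin (q + 2) => if k.val = 0 then B.mul (Z i) (Z j) else
          removeTwo i.succ j.succ (Fin.cons g Z : Fin (q + 3) → G) d (k.val - 1)) =
          Fin.cons (B.mul (Z i) (Z j)) (Fin.cons g fun k : Fin q => removeTwo i j Z d k) := by
        funext k
        refine Fin.cases ?_ (fun k => Fin.cases ?_ (fun k => ?_) k) k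
        · simp
        · simp [removeTwo_cons_succ_succ_zero]
        · simp [removeTwo_cons_succ_succ_succ]
      have e' : (fun k : Fin (q + 1) => if k.val = 0 then B.mul (Z i) (Z j) else
          removeTwo i j Z d (k.val - 1)) =
          Fin.cons (B.mul (Z i) (Z j)) (fun k : Fin q => removeTwo i j Z d k) := by
        funext k
        refine Fin.cases ?_ (fun k => ?_) k <;> simp
      rw [e, e', hf.cons_cons]
      simp only [Fin.val_succ, pow_add, pow_one]
      ring

end BasisBracket

theorem bres_comm (x y : Fin 2) : bres x y = bres y x := max_comm x y

theorem bres_assoc (x y z : Fin 2) : bres (bres x y) z = bres x (bres y z) := max_assoc x y z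

theorem bcoef_comm (x y : Fin 2) : bcoef x y = bcoef y x := by
  simp only [bcoef, and_comm]

theorem bcoef_mul_bcoef (x y z : Fin 2) :
    bcoef x y * bcoef (bres x y) z = bcoef y z * bcoef (bres y z) x := by
  fin_cases x <;> fin_cases y <;> fin_cases z <;> simp [bcoef, bres]

/-- The brackets of the Fourier modes `L_λ`, `M_λ`. -/
noncomputable def modeBracket : BasisBracket (Fin 2 × ℂ) ℂ where
  mul g h := (bres g.1 h.1, g.2 + h.2)
  coef g h := bcoef g.1 h.1 * (g.2 - h.2)
  mul_comm g h := by simp [bres_comm g.1, add_comm g.2]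
  coef_antisymm g h := by rw [bcoef_comm]; ring
  jacobi a b c F := by
    have e1 := bcoef_mul_bcoef a.1 b.1 c.1
    have e2 := bcoef_mul_bcoef b.1 c.1 a.1
    have r1 : bres (bres b.1 c.1) a.1 = bres (bres a.1 b.1) c.1 := by
      rw [bres_comm, ← bres_assoc]
    have r2 : bres (bres c.1 a.1) b.1 = bres (bres a.1 b.1) c.1 := by
      rw [bres_comm c.1, bres_assoc, bres_comm c.1, ← bres_assoc]
    have s1 : b.2 + c.2 + a.2 = a.2 + b.2 + c.2 := by ring
    have s2 : c.2 + a.2 + b.2 = a.2 + b.2 + c.2 := by ring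
    simp only [r1, r2, s1, s2]
    linear_combination (-(F (bres (bres a.1 b.1) c.1, a.2 + b.2 + c.2))) *
      ((b.2 - c.2) * (b.2 + c.2 - a.2) * e1 + (c.2 - a.2) * (c.2 + a.2 - b.2) * (e1 + e2))

/-- Cochains as functions of tuples of Fourier modes. -/
def curryCochain (q : ℕ) : ((Fin q → Fin 2 × ℂ) → ℂ) ≃ₗ[ℂ] WCochain q where
  toFun f X l := f fun i => (X i, l i)
  invFun γ Y := γ (fun i => (Y i).1) fun i => (Y i).2
  map_add' _ _ := rfl
  map_smul' _ _ := rfl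
  left_inv _ := rfl
  right_inv _ := rfl

theorem isSkewCochain_curryCochain_iff {q : ℕ} (f : (Fin q → Fin 2 × ℂ) → ℂ) :
    IsSkewCochain (curryCochain q f) ↔ IsAlt f :=
  ⟨fun h σ Y => h σ (fun i => (Y i).1) fun i => (Y i).2, fun h σ X l => h σ fun i => (X i, l i)⟩

theorem dW_curryCochain {q : ℕ} {f : (Fin q → Fin 2 × ℂ) → ℂ} (hf : IsAlt f) :
    dW (curryCochain q f) = curryCochain (q + 1) (modeBracket.diff f) := by
  rw [← modeBracket.pairDiff_eq_diff (0, 0) hf]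
  funext X l
  refine Finset.sum_congr rfl fun p _ => ?_
  simp only [curryCochain, modeBracket, LinearEquiv.coe_mk, LinearMap.coe_mk, AddHom.coe_mk,
    mul_assoc]
  congr 5
  funext k
  have h1 := removeTwo_comp Prod.fst p.1 p.2 (fun i => (X i, l i)) ((0, 0) : Fin 2 × ℂ) (k.val - 1)
  have h2 := removeTwo_comp Prod.snd p.1 p.2 (fun i => (X i, l i)) ((0, 0) : Fin 2 × ℂ) (k.val - 1)
  split_ifs
  · rfl
  · exact Prod.ext h1 h2

theorem curryCochain_lie_L_zero {q : ℕ} (f : (Fin q → Fin 2 × ℂ) → ℂ) :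
    curryCochain q (modeBracket.lie (0, 0) f) = paW q (curryCochain q f) := by
  funext X l
  simp only [curryCochain, BasisBracket.lie, modeBracket, paW, LinearEquiv.coe_mk,
    LinearMap.coe_mk, AddHom.coe_mk, Finset.sum_mul, ← Finset.sum_neg_distrib]
  refine Finset.sum_congr rfl fun j _ => ?_
  have : ((bres 0 (X j), 0 + l j) : Fin 2 × ℂ) = (X j, l j) := by
    simp [bres]
  rw [this, Function.update_eq_self_iff.2 rfl]
  simp [bcoef]

/-! ### Divided power expansions of polynomial cochains -/

/-- The brackets `[L_{n-1}, L_{m-1}]`, `[L_{n-1}, M_{m-1}]` of the annihilation algebra,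
where `(0, n)` and `(1, n)` encode `L_{n-1}` and `M_{n-1}`. -/
def coeffBracket (R : Type*) [CommRing R] : BasisBracket (Fin 2 × ℕ) R where
  mul g h := (bres g.1 h.1, g.2 + h.2 - 1)
  coef g h := if g.1 = 1 ∧ h.1 = 1 then 0 else (g.2 : R) - h.2
  mul_comm g h := by rw [bres_comm g.1, add_comm g.2]
  coef_antisymm g h := by
    simp only [and_comm (a := h.1 = 1)]
    split_ifs <;> ring
  jacobi a b c F := by
    obtain ⟨x, m⟩ := a
    obtain ⟨y, n⟩ := b
    obtain ⟨z, k⟩ := c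
    have r1 : bres (bres y z) x = bres (bres x y) z := by rw [bres_comm, ← bres_assoc]
    have r2 : bres (bres z x) y = bres (bres x y) z := by
      rw [bres_comm z, bres_assoc, bres_comm z, ← bres_assoc]
    simp only [r1, r2]
    have key : ((m : R) - n) * (((m + n - 1 : ℕ) : R) - k) * F (bres (bres x y) z, m + n - 1 + k - 1)
        + ((n : R) - k) * (((n + k - 1 : ℕ) : R) - m) * F (bres (bres x y) z, n + k - 1 + m - 1)
        + ((k : R) - m) * (((k + m - 1 : ℕ) : R) - n) * F (bres (bres x y) z, k + m - 1 + n - 1)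
        = 0 := by
      have hT : ∀ a b c : ℕ, ((a : R) - b) * (((a + b - 1 : ℕ) : R) - c) *
          F (bres (bres x y) z, a + b - 1 + c - 1) =
          (a - b) * (a + b - 1 - c) * F (bres (bres x y) z, a + b + c - 2) := by
        intro a b c
        rcases Nat.eq_zero_or_pos (a + b) with h | h
        · obtain ⟨rfl, rfl⟩ := Nat.add_eq_zero_iff.1 h
          simp
        · rw [Nat.cast_sub h, Nat.cast_add, Nat.cast_one,
            show a + b - 1 + c - 1 = a + b + c - 2 by omega]
      rw [hT, hT, hT, show n + k + m = m + n + k by ring, show k + m + n = m + n + k by ring]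
      ring
    fin_cases x <;> fin_cases y <;> fin_cases z <;> simp [bres] at key ⊢ <;> linear_combination key

section expand

/-- The coefficients of index at least `N` in some variable vanish. -/
def Box (N : ℕ) {q : ℕ} (c : (Fin q → Fin 2 × ℕ) → ℂ) : Prop :=
  ∀ Y i, N ≤ (Y i).2 → c Y = 0

/-- The function of Fourier modes with divided power coefficients `c` (truncated at `N`). -/
noncomputable def dpExpand (N : ℕ) : ∀ {q : ℕ}, ((Fin q → Fin 2 × ℕ) → ℂ) → (Fin q → Fin 2 × ℂ) → ℂ
  | 0, c => fun _ => c Fin.elim0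
  | _ + 1, c => fun Y => ∑ n ∈ Finset.range N, (Y 0).2 ^ n / n.factorial *
      dpExpand N (insertFirst ((Y 0).1, n) c) (Fin.tail Y)

variable {N K q : ℕ}

theorem insertFirst_dpExpand (x : Fin 2) (s : ℂ) (c : (Fin (q + 1) → Fin 2 × ℕ) → ℂ) :
    insertFirst (x, s) (dpExpand N c) =
      ∑ n ∈ Finset.range N, (s ^ n / n.factorial) • dpExpand N (insertFirst (x, n) c) := by
  funext Y
  simp [insertFirst, dpExpand, Finset.sum_apply]

theorem dpExpand_add (c c' : (Fin q → Fin 2 × ℕ) → ℂ) :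
    dpExpand N (c + c') = dpExpand N c + dpExpand N c' := by
  induction q with
  | zero => rfl
  | succ q ih =>
    refine insertFirst_ext fun ⟨x, s⟩ => ?_
    rw [insertFirst_add]
    simp only [insertFirst_dpExpand, insertFirst_add, ih, smul_add, Finset.sum_add_distrib]

theorem dpExpand_smul (a : ℂ) (c : (Fin q → Fin 2 × ℕ) → ℂ) :
    dpExpand N (a • c) = a • dpExpand N c := by
  induction q with
  | zero => rfl
  | succ q ih =>
    refine insertFirst_ext fun ⟨x, s⟩ => ?_
    rw [insertFirst_smul]
    simp only [insertFirst_dpExpand, insertFirst_smul, ih, Finset.smul_sum]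
    exact Finset.sum_congr rfl fun _ _ => smul_comm _ _ _

theorem dpExpand_zero : dpExpand N (0 : (Fin q → Fin 2 × ℕ) → ℂ) = 0 := by
  simpa using dpExpand_smul (N := N) 0 (0 : (Fin q → Fin 2 × ℕ) → ℂ)

theorem dpExpand_sub (c c' : (Fin q → Fin 2 × ℕ) → ℂ) :
    dpExpand N (c - c') = dpExpand N c - dpExpand N c' := by
  rw [sub_eq_add_neg, ← neg_one_smul ℂ c', dpExpand_add, dpExpand_smul, neg_one_smul, sub_eq_add_neg]

theorem Box.mono {c : (Fin q → Fin 2 × ℕ) → ℂ} (hc : Box N c) (h : N ≤ K) : Box K c :=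
  fun Y i hi => hc Y i (h.trans hi)

theorem Box.insertFirst {c : (Fin (q + 1) → Fin 2 × ℕ) → ℂ} (hc : Box N c) (g : Fin 2 × ℕ) :
    Box N (insertFirst g c) :=
  fun Y i hi => hc _ i.succ (by simpa using hi)

theorem Box.insertFirst_eq_zero {c : (Fin (q + 1) → Fin 2 × ℕ) → ℂ} (hc : Box N c)
    {g : Fin 2 × ℕ} (hg : N ≤ g.2) : _root_.insertFirst g c = 0 :=
  funext fun _ => hc _ 0 (by simpa using hg)

theorem box_of_insertFirst {c : (Fin (q + 1) → Fin 2 × ℕ) → ℂ}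
    (h0 : ∀ g, N ≤ g.2 → insertFirst g c = 0) (h : ∀ g, Box N (insertFirst g c)) : Box N c := by
  intro Y i hi
  rw [← Fin.cons_self_tail Y]
  refine Fin.cases (fun hi => ?_) (fun j hi => ?_) i hi
  · exact congrFun (h0 _ hi) _
  · exact h _ _ j hi

theorem Box.dpExpand_eq {c : (Fin q → Fin 2 × ℕ) → ℂ} (hc : Box N c) (h : N ≤ K) :
    dpExpand K c = dpExpand N c := by
  induction q with
  | zero => rfl
  | succ q ih =>
    refine insertFirst_ext fun ⟨x, s⟩ => ?_
    simp only [insertFirst_dpExpand]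
    rw [← Finset.sum_subset (Finset.range_subset_range.2 h)]
    · exact Finset.sum_congr rfl fun n _ => by rw [ih (hc.insertFirst _)]
    · intro n _ hn
      rw [hc.insertFirst_eq_zero (by simpa using hn), dpExpand_zero, smul_zero]

theorem eq_zero_of_sum_pow_smul_eq_zero {V : Type*} (a : ℕ → V → ℂ)
    (h : ∀ s : ℂ, ∑ n ∈ Finset.range N, (s ^ n / n.factorial) • a n = 0) {n : ℕ} (hn : n < N) :
    a n = 0 := by
  funext v
  let P : Polynomial ℂ := ∑ n ∈ Finset.range N, Polynomial.monomial n (a n v / n.factorial)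
  have hP : P = 0 := Polynomial.funext fun s => by
    have := congrFun (h s) v
    simp only [Finset.sum_apply, Pi.smul_apply, smul_eq_mul, Pi.zero_apply] at this
    simp only [P, Polynomial.eval_finsetSum, Polynomial.eval_monomial, Polynomial.eval_zero]
    rw [← this]
    exact Finset.sum_congr rfl fun _ _ => by ring
  have := congrArg (fun Q => Polynomial.coeff Q n) hP
  simp only [P, Polynomial.finsetSum_coeff, Polynomial.coeff_monomial, Finset.sum_ite_eq',
    Finset.mem_range, hn, if_true, Polynomial.coeff_zero] at this
  simpa [Nat.factorial_ne_zero] using this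

theorem Box.eq_zero_of_dpExpand {c : (Fin q → Fin 2 × ℕ) → ℂ} (hc : Box N c)
    (h : dpExpand N c = 0) : c = 0 := by
  induction q with
  | zero =>
    funext Y
    rw [Subsingleton.elim Y Fin.elim0]
    exact congrFun h Fin.elim0
  | succ q ih =>
    refine insertFirst_ext fun ⟨x, n⟩ => ?_
    rcases lt_or_ge n N with hn | hn
    · refine ih (hc.insertFirst _) (eq_zero_of_sum_pow_smul_eq_zero
        (fun n => dpExpand N (_root_.insertFirst (x, n) c)) (fun s => ?_) hn)
      rw [← insertFirst_dpExpand, h]; rfl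
    · exact hc.insertFirst_eq_zero hn

end expand

section expand

variable {N K q : ℕ}

theorem dpExpand_eq_sum (c : (Fin q → Fin 2 × ℕ) → ℂ) (Y : Fin q → Fin 2 × ℂ) :
    dpExpand N c Y = ∑ n : Fin q → Fin N,
      (∏ i, (Y i).2 ^ (n i : ℕ) / (n i : ℕ).factorial) * c fun i => ((Y i).1, (n i : ℕ)) := by
  induction q with
  | zero =>
    simp only [dpExpand, Finset.univ_eq_empty, Finset.prod_empty, one_mul, Finset.univ_unique,
      Finset.sum_singleton]
    exact congrArg c (Subsingleton.elim _ _)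
  | succ q ih =>
    rw [← (Fin.consEquiv fun _ : Fin (q + 1) => Fin N).sum_comp, Fintype.sum_prod_type]
    refine (Finset.sum_range _).trans ?_
    refine Finset.sum_congr rfl fun m _ => ?_
    rw [ih, Finset.mul_sum]
    refine Finset.sum_congr rfl fun n _ => ?_
    simp only [Fin.consEquiv_apply, Fin.prod_univ_succ, Fin.cons_zero, Fin.cons_succ, mul_assoc,
      insertFirst]
    congr 3
    funext i
    refine Fin.cases ?_ (fun j => ?_) i <;> simp [Fin.tail]

theorem dpExpand_perm (c : (Fin q → Fin 2 × ℕ) → ℂ) (σ : Equiv.Perm (Fin q))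
    (Y : Fin q → Fin 2 × ℂ) :
    dpExpand N c (Y ∘ σ) = dpExpand N (fun Z => c (Z ∘ σ)) Y := by
  rw [dpExpand_eq_sum, dpExpand_eq_sum, ← (Equiv.arrowCongr σ.symm (Equiv.refl (Fin N))).sum_comp]
  refine Finset.sum_congr rfl fun n _ => ?_
  congr 1
  exact Equiv.prod_comp σ fun i => (Y i).2 ^ (n i : ℕ) / ((n i : ℕ).factorial : ℂ)

theorem IsAlt.dpExpand {c : (Fin q → Fin 2 × ℕ) → ℂ} (hc : IsAlt c) : IsAlt (dpExpand N c) := by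
  intro σ Y
  rw [dpExpand_perm, show (fun Z => c (Z ∘ σ)) = ((Equiv.Perm.sign σ : ℤ) : ℂ) • c from
    funext fun Z => hc σ Z, dpExpand_smul]
  rfl

theorem Box.isAlt_of_dpExpand {c : (Fin q → Fin 2 × ℕ) → ℂ} (hc : Box N c)
    (h : IsAlt (dpExpand N c)) : IsAlt c := by
  intro σ Y
  have hB : Box N ((fun Z => c (Z ∘ σ)) - ((Equiv.Perm.sign σ : ℤ) : ℂ) • c) := by
    intro Z i hi
    simp [hc Z i hi, hc (Z ∘ σ) (σ.symm i) (by simpa using hi)]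
  have := hB.eq_zero_of_dpExpand (by
    rw [dpExpand_sub, dpExpand_smul]
    funext Z
    rw [Pi.sub_apply, ← dpExpand_perm, h σ Z]
    simp)
  simpa [sub_eq_zero] using congrFun this Y

theorem isPolyCochain_dpExpand (c : (Fin q → Fin 2 × ℕ) → ℂ) :
    IsPolyCochain (curryCochain q (dpExpand N c)) := fun X =>
  ⟨∑ n : Fin q → Fin N, (∏ i, MvPolynomial.X i ^ (n i : ℕ) * C ((n i : ℕ).factorial : ℂ)⁻¹) *
      C (c fun i => (X i, (n i : ℕ))), fun l => by
    simp [curryCochain, dpExpand_eq_sum, div_eq_mul_inv]⟩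

theorem exists_box_dpExpand_eq {f : (Fin q → Fin 2 × ℂ) → ℂ}
    (hf : IsPolyCochain (curryCochain q f)) : ∃ N c, Box N c ∧ dpExpand N c = f := by
  choose P hP using hf
  let N := (Finset.univ.sup fun X => (P X).totalDegree) + 1
  let idx (n : Fin q → ℕ) : Fin q →₀ ℕ := Finsupp.equivFunOnFinite.symm n
  have hN : ∀ X n i, N ≤ n i → (P X).coeff (idx n) = 0 := by
    intro X n i hi
    refine coeff_eq_zero_of_totalDegree_lt ?_
    have h1 : (P X).totalDegree < N :=
      Nat.lt_succ_of_le (Finset.le_sup (f := fun X => (P X).totalDegree) (Finset.mem_univ X))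
    have h2 : n i ≤ (idx n).degree := Finsupp.le_degree i (idx n)
    exact h1.trans_le (hi.trans h2)
  refine ⟨N, fun Y => (∏ i, ((Y i).2.factorial : ℂ)) *
    (P fun i => (Y i).1).coeff (idx fun i => (Y i).2), fun Y i hi => ?_, ?_⟩
  · exact mul_eq_zero_of_right _ (hN _ (fun i => (Y i).2) i hi)
  · funext Y
    have e : f Y = eval (fun i => (Y i).2) (P fun i => (Y i).1) := hP _ _
    rw [e, dpExpand_eq_sum, eval_eq']
    let e : (Fin q → Fin N) ↪ (Fin q →₀ ℕ) := ⟨fun n => idx fun i => n i, fun n n' h => by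
      funext i
      exact Fin.ext (congrFun (Finsupp.equivFunOnFinite.symm.injective h) i)⟩
    rw [Finset.sum_subset (s₂ := Finset.univ.map e), Finset.sum_map]
    · refine Finset.sum_congr rfl fun n _ => ?_
      have : ∏ i, ((n i : ℕ).factorial : ℂ) ≠ 0 :=
        Finset.prod_ne_zero_iff.2 fun i _ => Nat.cast_ne_zero.2 (Nat.factorial_ne_zero _)
      rw [Finset.prod_div_distrib]
      field_simp
      exact _root_.mul_comm _ _
    · intro d hd
      have hd' : ∀ i, d i < N := by
        intro i
        by_contra! h
        refine mem_support_iff.1 hd ?_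
        rw [← Finsupp.equivFunOnFinite.symm_apply_apply d]
        exact hN _ d i h
      exact Finset.mem_map.2 ⟨fun i => ⟨d i, hd' i⟩, Finset.mem_univ _, by ext; rfl⟩
    · intro d _ hd
      rw [notMem_support_iff.1 hd, zero_mul]

end expand

namespace BasisBracket

variable {G R : Type*} [CommRing R] (B : BasisBracket G R)

/-- `BasisBracket.lie` as a linear map. -/
def lieLin (q : ℕ) (g : G) : ((Fin q → G) → R) →ₗ[R] ((Fin q → G) → R) where
  toFun := B.lie g
  map_add' := B.lie_add g
  map_smul' a := B.lie_smul a g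

/-- `BasisBracket.diff` as a linear map. -/
def diffLin (q : ℕ) : ((Fin q → G) → R) →ₗ[R] ((Fin (q + 1) → G) → R) where
  toFun := B.diff
  map_add' := B.diff_add
  map_smul' := B.diff_smul

theorem lie_sum_smul {q : ℕ} {ι : Type*} (s : Finset ι) (a : ι → R) (g : G)
    (f : ι → (Fin q → G) → R) :
    B.lie g (∑ i ∈ s, a i • f i) = ∑ i ∈ s, a i • B.lie g (f i) := by
  refine (map_sum (B.lieLin q g) (fun i => a i • f i) s).trans ?_
  exact Finset.sum_congr rfl fun i _ => B.lie_smul _ _ _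

theorem diff_sum_smul {q : ℕ} {ι : Type*} (s : Finset ι) (a : ι → R) (f : ι → (Fin q → G) → R) :
    B.diff (∑ i ∈ s, a i • f i) = ∑ i ∈ s, a i • B.diff (f i) := by
  refine (map_sum (B.diffLin q) (fun i => a i • f i) s).trans ?_
  exact Finset.sum_congr rfl fun i _ => B.diff_smul _ _

end BasisBracket

section expand

theorem insertFirst_sum_smul {G R : Type*} [CommRing R] {q : ℕ} {ι : Type*} (s : Finset ι)
    (a : ι → R) (g : G) (f : ι → (Fin (q + 1) → G) → R) :
    insertFirst g (∑ i ∈ s, a i • f i) = ∑ i ∈ s, a i • insertFirst g (f i) := by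
  funext Y
  simp [insertFirst, Finset.sum_apply]

variable {N K q : ℕ}

theorem sum_dividedPower_add {a b : ℕ} (ha : N ≤ a) (hb : N ≤ b) (s t : ℂ) {F : ℕ → ℂ}
    (hF : ∀ k, N ≤ k → F k = 0) :
    ∑ m ∈ Finset.range a, ∑ n ∈ Finset.range b,
      s ^ m / m.factorial * (t ^ n / n.factorial) * F (m + n) =
    ∑ k ∈ Finset.range N, (s + t) ^ k / k.factorial * F k := by
  rw [← Finset.sum_product' (f := fun m n => s ^ m / m.factorial * (t ^ n / n.factorial) *
    F (m + n)), ← Finset.sum_subset (Finset.filter_subset (fun p : ℕ × ℕ => p.1 + p.2 < N) _),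
    ← Finset.sum_fiberwise_of_maps_to (t := Finset.range N) (g := fun p => p.1 + p.2)]
  · refine Finset.sum_congr rfl fun k hk => ?_
    have e : ((Finset.range a ×ˢ Finset.range b).filter fun p => p.1 + p.2 < N).filter
        (fun p => p.1 + p.2 = k) = Finset.HasAntidiagonal.antidiagonal k := by
      ext p
      simp only [Finset.mem_filter, Finset.mem_product, Finset.mem_range,
        Finset.HasAntidiagonal.mem_antidiagonal] at hk ⊢
      omega
    rw [e, (Commute.all s t).add_pow', Finset.sum_div, Finset.sum_mul]
    refine Finset.sum_congr rfl fun ⟨m, n⟩ hp => ?_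
    obtain rfl := Finset.HasAntidiagonal.mem_antidiagonal.1 hp
    have h1 : (m.factorial : ℂ) ≠ 0 := Nat.cast_ne_zero.2 m.factorial_ne_zero
    have h2 : (n.factorial : ℂ) ≠ 0 := Nat.cast_ne_zero.2 n.factorial_ne_zero
    have h3 : ((m + n).factorial : ℂ) ≠ 0 := Nat.cast_ne_zero.2 (m + n).factorial_ne_zero
    have h4 : ((m + n).choose m : ℂ) * m.factorial * n.factorial = (m + n).factorial := by
      rw [Nat.choose_symm_add]
      exact_mod_cast Nat.add_choose_mul_factorial_mul_factorial m n
    rw [nsmul_eq_mul]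
    field_simp
    linear_combination (-s ^ m * t ^ n * F (m + n)) * h4
  · intro p hp
    simpa using (Finset.mem_filter.1 hp).2
  · intro p hp hp'
    rw [hF, mul_zero]
    by_contra! h
    exact hp' (Finset.mem_filter.2 ⟨hp, h⟩)

theorem sum_dividedPower_succ (s : ℂ) (f : ℕ → ℂ) :
    ∑ m ∈ Finset.range (N + 1), s ^ m / m.factorial * (m * f m) =
      s * ∑ m ∈ Finset.range N, s ^ m / m.factorial * f (m + 1) := by
  rw [Finset.sum_range_succ', Finset.mul_sum]
  simp only [Nat.cast_zero, zero_mul, mul_zero, add_zero]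
  refine Finset.sum_congr rfl fun m _ => ?_
  have h1 : (m.factorial : ℂ) ≠ 0 := Nat.cast_ne_zero.2 m.factorial_ne_zero
  have h2 : ((m : ℂ) + 1) ≠ 0 := Nat.cast_add_one_ne_zero m
  rw [Nat.factorial_succ]
  push_cast
  field_simp
  ring

theorem sum_dividedPower_bracket (hK : N + 1 ≤ K) (s t : ℂ) {F : ℕ → ℂ}
    (hF : ∀ k, N ≤ k → F k = 0) :
    ∑ m ∈ Finset.range K, ∑ n ∈ Finset.range K,
      s ^ m / m.factorial * (t ^ n / n.factorial) * ((m - n) * F (m + n - 1)) =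
    (s - t) * ∑ k ∈ Finset.range K, (s + t) ^ k / k.factorial * F k := by
  obtain ⟨K, rfl⟩ : ∃ K', K = K' + 1 := ⟨K - 1, by omega⟩
  have e0 : ∑ k ∈ Finset.range (K + 1), (s + t) ^ k / k.factorial * F k =
      ∑ k ∈ Finset.range N, (s + t) ^ k / k.factorial * F k := by
    refine (Finset.sum_subset (Finset.range_subset_range.2 (by omega)) fun k _ hk => ?_).symm
    rw [hF _ (by simpa using hk), mul_zero]
  have e1 : ∀ s t : ℂ, ∑ m ∈ Finset.range (K + 1), ∑ n ∈ Finset.range (K + 1),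
      s ^ m / m.factorial * (t ^ n / n.factorial) * (m * F (m + n - 1)) =
      s * ∑ k ∈ Finset.range N, (s + t) ^ k / k.factorial * F k := by
    intro s t
    rw [← sum_dividedPower_add (a := K) (b := K + 1) (by omega) (by omega) s t hF]
    have := sum_dividedPower_succ (N := K) s fun m => ∑ n ∈ Finset.range (K + 1),
      (t ^ n / n.factorial) * F (m + n - 1)
    simp only [Nat.add_right_comm _ 1, Nat.add_sub_cancel] at this
    simp only [Finset.mul_sum] at this ⊢
    rw [← Finset.sum_congr rfl fun m _ => Finset.sum_congr rfl fun n _ => ?_]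
    · simpa only [mul_assoc] using this
    · ring
  have e2 : ∑ m ∈ Finset.range (K + 1), ∑ n ∈ Finset.range (K + 1),
      s ^ m / m.factorial * (t ^ n / n.factorial) * (n * F (m + n - 1)) =
      t * ∑ k ∈ Finset.range N, (s + t) ^ k / k.factorial * F k := by
    rw [add_comm s t, ← e1, Finset.sum_comm]
    refine Finset.sum_congr rfl fun n _ => Finset.sum_congr rfl fun m _ => ?_
    rw [_root_.add_comm m n]
    ring
  rw [e0, sub_mul, ← e2, ← e1]
  simp only [← Finset.sum_sub_distrib]
  exact Finset.sum_congr rfl fun m _ => Finset.sum_congr rfl fun n _ => by ring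

theorem Box.lie {c : (Fin q → Fin 2 × ℕ) → ℂ} (hc : Box N c) (g : Fin 2 × ℕ) :
    Box (N + 1) ((coeffBracket ℂ).lie g c) := by
  intro Y i hi
  rw [BasisBracket.lie, neg_eq_zero]
  refine Finset.sum_eq_zero fun j _ => mul_eq_zero_of_right _ (hc _ i ?_)
  rcases eq_or_ne i j with rfl | h
  · rw [Function.update_self]
    simp only [coeffBracket]
    omega
  · rw [Function.update_of_ne h]
    omega

theorem Box.lie_eq_zero {c : (Fin q → Fin 2 × ℕ) → ℂ} (hc : Box N c) {g : Fin 2 × ℕ}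
    (hg : N + 1 ≤ g.2) : (coeffBracket ℂ).lie g c = 0 := by
  funext Y
  rw [BasisBracket.lie, Pi.zero_apply, neg_eq_zero]
  refine Finset.sum_eq_zero fun j _ => mul_eq_zero_of_right _ (hc _ j ?_)
  rw [Function.update_self]
  simp only [coeffBracket]
  omega

theorem Box.diff {c : (Fin q → Fin 2 × ℕ) → ℂ} (hc : Box N c) :
    Box (N + 1) ((coeffBracket ℂ).diff c) := by
  induction q with
  | zero => exact fun _ _ _ => rfl
  | succ q ih =>
    refine box_of_insertFirst (fun g hg => ?_) fun g => ?_ <;> rw [BasisBracket.insertFirst_diff]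
    · rw [hc.lie_eq_zero hg, hc.insertFirst_eq_zero (by omega), zero_sub, neg_eq_zero]
      exact map_zero ((coeffBracket ℂ).diffLin q)
    · intro Y i hi
      rw [Pi.sub_apply, hc.lie g Y i hi, ih (hc.insertFirst g) Y i hi, sub_zero]

theorem Box.lie_dpExpand {c : (Fin q → Fin 2 × ℕ) → ℂ} (hc : Box N c) (hK : N + 1 ≤ K)
    (x : Fin 2) (s : ℂ) :
    modeBracket.lie (x, s) (dpExpand K c) =
      ∑ m ∈ Finset.range K, (s ^ m / m.factorial) •
        dpExpand K ((coeffBracket ℂ).lie (x, m) c) := by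
  induction q with
  | zero =>
    have h1 : ∀ g, (coeffBracket ℂ).lie g c = 0 := fun g => by funext Y; simp [BasisBracket.lie]
    simp only [h1, dpExpand_zero, smul_zero, Finset.sum_const_zero]
    funext Y
    simp [BasisBracket.lie]
  | succ q ih =>
    refine insertFirst_ext fun ⟨y, t⟩ => ?_
    rw [BasisBracket.insertFirst_lie, insertFirst_dpExpand, BasisBracket.lie_sum_smul,
      insertFirst_sum_smul]
    simp only [ih (hc.insertFirst _)]
    funext Y
    have key := sum_dividedPower_bracket hK s t
      (F := fun k => dpExpand K (_root_.insertFirst (bres x y, k) c) Y) fun k hk => by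
        rw [hc.insertFirst_eq_zero hk, dpExpand_zero]; rfl
    have hb : modeBracket.coef (x, s) (y, t) = bcoef x y * (s - t) := rfl
    have hm : modeBracket.mul (x, s) (y, t) = (bres x y, s + t) := rfl
    have hc' : ∀ m n : ℕ, (coeffBracket ℂ).coef (x, m) (y, n) = bcoef x y * (m - n) := by
      intro m n
      simp only [coeffBracket, bcoef]
      split_ifs <;> simp
    have hm' : ∀ m n : ℕ, (coeffBracket ℂ).mul (x, m) (y, n) = (bres x y, m + n - 1) :=
      fun m n => rfl
    simp only [insertFirst_dpExpand, BasisBracket.insertFirst_lie, dpExpand_sub, dpExpand_smul,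
      hb, hm, hc', hm', Pi.sub_apply, Pi.smul_apply, Finset.sum_apply, smul_eq_mul]
    rw [mul_assoc, ← key]
    simp only [Finset.mul_sum]
    refine (congrArg (· - _) Finset.sum_comm).trans ?_
    rw [← Finset.sum_sub_distrib]
    refine Finset.sum_congr rfl fun m _ => ?_
    rw [← Finset.sum_sub_distrib]
    exact Finset.sum_congr rfl fun n _ => by ring

theorem Box.diff_dpExpand {c : (Fin q → Fin 2 × ℕ) → ℂ} (hc : Box N c) (hK : N + 1 ≤ K) :
    modeBracket.diff (dpExpand K c) = dpExpand K ((coeffBracket ℂ).diff c) := by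
  induction q with
  | zero => rw [BasisBracket.diff_of_zero, BasisBracket.diff_of_zero, dpExpand_zero]
  | succ q ih =>
    refine insertFirst_ext fun ⟨x, s⟩ => ?_
    rw [BasisBracket.insertFirst_diff, hc.lie_dpExpand hK, insertFirst_dpExpand,
      BasisBracket.diff_sum_smul, insertFirst_dpExpand, ← Finset.sum_sub_distrib]
    refine Finset.sum_congr rfl fun m _ => ?_
    rw [BasisBracket.insertFirst_diff, dpExpand_sub, ih (hc.insertFirst _), smul_sub]

end expand

/-! ### Cochains in coordinates -/

section coordinates

variable {N q : ℕ}

/-- The divided power series with finitely many coefficients `c`. -/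
noncomputable def dpSeries (c : (Fin q → Fin 2 × ℕ) → ℂ) : (Fin q → Fin 2 × ℂ) → ℂ :=
  open Classical in if h : ∃ N, Box N c then dpExpand h.choose c else 0

theorem Box.dpSeries_eq {c : (Fin q → Fin 2 × ℕ) → ℂ} (hc : Box N c) :
    dpSeries c = dpExpand N c := by
  have h : ∃ N, Box N c := ⟨N, hc⟩
  rw [dpSeries, dif_pos h, ← hc.dpExpand_eq (le_max_right h.choose N),
    h.choose_spec.dpExpand_eq (le_max_left _ _)]

/-- Alternating functions on basis tuples of the annihilation algebra that vanish when some
index is large. -/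
def finAlt (q : ℕ) : Submodule ℂ ((Fin q → Fin 2 × ℕ) → ℂ) where
  carrier := {c | IsAlt c ∧ ∃ N, Box N c}
  add_mem' := by
    rintro a b ⟨ha, M, hM⟩ ⟨hb, N, hN⟩
    refine ⟨fun σ Y => ?_, max M N, fun Y i hi => ?_⟩
    · rw [Pi.add_apply, Pi.add_apply, ha, hb, mul_add]
    · rw [Pi.add_apply, hM Y i (le_of_max_le_left hi), hN Y i (le_of_max_le_right hi), add_zero]
  zero_mem' := ⟨fun σ Y => by simp, 0, fun Y i _ => rfl⟩
  smul_mem' := by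
    rintro t a ⟨ha, M, hM⟩
    refine ⟨fun σ Y => ?_, M, fun Y i hi => ?_⟩
    · rw [Pi.smul_apply, Pi.smul_apply, ha, smul_eq_mul, smul_eq_mul]; ring
    · rw [Pi.smul_apply, hM Y i hi, smul_zero]

theorem diff_mem_finAlt {c : (Fin q → Fin 2 × ℕ) → ℂ} (hc : c ∈ finAlt q) :
    (coeffBracket ℂ).diff c ∈ finAlt (q + 1) :=
  ⟨BasisBracket.isAlt_diff _ hc.1, _, hc.2.choose_spec.diff⟩

theorem dpSeries_mem_cochainSub {c : (Fin q → Fin 2 × ℕ) → ℂ} (hc : c ∈ finAlt q) :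
    curryCochain q (dpSeries c) ∈ cochainSub q := by
  obtain ⟨hc, N, hN⟩ := hc
  rw [hN.dpSeries_eq]
  exact ⟨isPolyCochain_dpExpand c, (isSkewCochain_curryCochain_iff _).2 hc.dpExpand⟩

theorem dpSeries_add {a b : (Fin q → Fin 2 × ℕ) → ℂ} (ha : a ∈ finAlt q) (hb : b ∈ finAlt q) :
    dpSeries (a + b) = dpSeries a + dpSeries b := by
  obtain ⟨ha, M, hM⟩ := ha
  obtain ⟨hb, N, hN⟩ := hb
  have hM' := hM.mono (le_max_left M N)
  have hN' := hN.mono (le_max_right M N)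
  have h : Box (max M N) (a + b) := fun Y i hi => by
    rw [Pi.add_apply, hM' Y i hi, hN' Y i hi, add_zero]
  rw [h.dpSeries_eq, hM'.dpSeries_eq, hN'.dpSeries_eq, dpExpand_add]

theorem dpSeries_smul (t : ℂ) {a : (Fin q → Fin 2 × ℕ) → ℂ} (ha : a ∈ finAlt q) :
    dpSeries (t • a) = t • dpSeries a := by
  obtain ⟨ha, M, hM⟩ := ha
  have h : Box M (t • a) := fun Y i hi => by rw [Pi.smul_apply, hM Y i hi, smul_zero]
  rw [h.dpSeries_eq, hM.dpSeries_eq, dpExpand_smul]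

/-- The basic cochain with given coefficients, as a linear map. -/
noncomputable def cochainMap (q : ℕ) : finAlt q →ₗ[ℂ] cochainSub q where
  toFun c := ⟨curryCochain q (dpSeries c.1), dpSeries_mem_cochainSub c.2⟩
  map_add' a b := Subtype.ext (congrArg (curryCochain q) (dpSeries_add a.2 b.2))
  map_smul' t a := Subtype.ext (congrArg (curryCochain q) (dpSeries_smul t a.2))

theorem cochainMap_bijective (q : ℕ) : Function.Bijective (cochainMap q) := by
  constructor
  · refine (injective_iff_map_eq_zero _).2 fun ⟨c, hc, N, hN⟩ h => ?_
    have h' : curryCochain q (dpSeries c) = 0 := congrArg Subtype.val h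
    rw [hN.dpSeries_eq, LinearEquiv.map_eq_zero_iff] at h'
    exact Subtype.ext (hN.eq_zero_of_dpExpand h')
  · rintro ⟨γ, hp, hs⟩
    obtain ⟨N, c, hc, h⟩ := exists_box_dpExpand_eq (f := (curryCochain q).symm γ) hp
    refine ⟨⟨c, hc.isAlt_of_dpExpand ?_, N, hc⟩, Subtype.ext ?_⟩
    · rw [h]
      exact (isSkewCochain_curryCochain_iff _).1 hs
    · change curryCochain q (dpSeries c) = γ
      rw [hc.dpSeries_eq, h, LinearEquiv.apply_symm_apply]

/-- Basic cochains are the divided power series with alternating coefficients. -/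
noncomputable def cochainEquiv (q : ℕ) : finAlt q ≃ₗ[ℂ] cochainSub q :=
  LinearEquiv.ofBijective (cochainMap q) (cochainMap_bijective q)

theorem coe_cochainEquiv (c : finAlt q) :
    (cochainEquiv q c : WCochain q) = curryCochain q (dpSeries c.1) := rfl

theorem dW_cochainEquiv (c : finAlt q) :
    dW (cochainEquiv q c : WCochain q) =
      cochainEquiv (q + 1) ⟨(coeffBracket ℂ).diff c.1, diff_mem_finAlt c.2⟩ := by
  obtain ⟨c, hc, N, hN⟩ := c
  simp only [coe_cochainEquiv]
  rw [(hN.mono (Nat.le_succ N)).dpSeries_eq, hN.diff.dpSeries_eq, dW_curryCochain hc.dpExpand,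
    hN.diff_dpExpand le_rfl]

theorem dW_mem_cochainSub {γ : WCochain q} (h : γ ∈ cochainSub q) : dW γ ∈ cochainSub (q + 1) := by
  obtain ⟨c, hc⟩ := (cochainEquiv q).surjective ⟨γ, h⟩
  have := dW_cochainEquiv c
  rw [hc] at this
  rw [this]
  exact Subtype.property _

/-- A linear map on coefficients that identifies the degree `q + 1` cohomology. -/
theorem nonempty_basicH_equiv {h : ℕ} (Φ : ((Fin (q + 1) → Fin 2 × ℕ) → ℂ) →ₗ[ℂ] (Fin h → ℂ))
    (hs : ∀ v, ∃ z ∈ finAlt (q + 1), (coeffBracket ℂ).diff z = 0 ∧ Φ z = v)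
    (hd : ∀ y ∈ finAlt q, Φ ((coeffBracket ℂ).diff y) = 0)
    (hk : ∀ z ∈ finAlt (q + 1), (coeffBracket ℂ).diff z = 0 → Φ z = 0 →
      ∃ y ∈ finAlt q, (coeffBracket ℂ).diff y = z) :
    Nonempty (basicH (q + 1) ≃ₗ[ℂ] (Fin h → ℂ)) := by
  let Ψ : cocycleSub (q + 1) →ₗ[ℂ] (Fin h → ℂ) :=
    Φ ∘ₗ (finAlt (q + 1)).subtype ∘ₗ (cochainEquiv (q + 1)).symm.toLinearMap ∘ₗ
      Submodule.inclusion (inf_le_left : cocycleSub (q + 1) ≤ cochainSub (q + 1))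
  have hΨ : ∀ (c : finAlt (q + 1)) (h : (cochainEquiv (q + 1) c : WCochain (q + 1)) ∈
      cocycleSub (q + 1)), Ψ ⟨_, h⟩ = Φ c.1 := by
    intro c h
    change Φ ((cochainEquiv (q + 1)).symm (cochainEquiv (q + 1) c)).1 = _
    rw [LinearEquiv.symm_apply_apply]
  have hz : ∀ c : finAlt (q + 1), (cochainEquiv (q + 1) c : WCochain (q + 1)) ∈
      cocycleSub (q + 1) ↔ (coeffBracket ℂ).diff c.1 = 0 := by
    intro c
    refine ⟨fun h => ?_, fun h => ⟨Subtype.property _, ?_⟩⟩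
    · have h1 : dW (cochainEquiv (q + 1) c : WCochain (q + 1)) = 0 := h.2
      rw [dW_cochainEquiv, ZeroMemClass.coe_eq_zero, LinearEquiv.map_eq_zero_iff] at h1
      exact congrArg Subtype.val h1
    · change dW _ = 0
      rw [dW_cochainEquiv, ZeroMemClass.coe_eq_zero, LinearEquiv.map_eq_zero_iff]
      exact Subtype.ext h
  have hsurj : Function.Surjective Ψ := by
    intro v
    obtain ⟨z, hz1, hz2, rfl⟩ := hs v
    exact ⟨⟨_, (hz ⟨z, hz1⟩).2 hz2⟩, hΨ _ _⟩
  have hker : LinearMap.ker Ψ = (coboundSub (q + 1)).comap (cocycleSub (q + 1)).subtype := by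
    ext ⟨γ, hγ⟩
    obtain ⟨c, hc⟩ := (cochainEquiv (q + 1)).surjective ⟨γ, hγ.1⟩
    obtain rfl : (cochainEquiv (q + 1) c : WCochain (q + 1)) = γ := congrArg Subtype.val hc
    rw [LinearMap.mem_ker, hΨ, Submodule.mem_comap]
    constructor
    · intro h
      obtain ⟨y, hy, hyc⟩ := hk c.1 c.2 ((hz c).1 hγ) h
      refine ⟨cochainEquiv q ⟨y, hy⟩, Subtype.property _, (dW_cochainEquiv _).trans ?_⟩
      exact congrArg (fun c => (cochainEquiv (q + 1) c : WCochain (q + 1))) (Subtype.ext hyc)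
    · rintro ⟨β, hβ, e⟩
      obtain ⟨y, hy⟩ := (cochainEquiv q).surjective ⟨β, hβ⟩
      obtain rfl : (cochainEquiv q y : WCochain q) = β := congrArg Subtype.val hy
      have := (dW_cochainEquiv y).symm.trans e
      rw [← hd y.1 y.2]
      exact congrArg (fun c => Φ c.1) ((cochainEquiv (q + 1)).injective (Subtype.ext this)).symm
  exact ⟨(Submodule.quotEquivOfEq _ _ hker.symm).trans (Ψ.quotKerEquivOfSurjective hsurj)⟩

end coordinates

/-! ### Reduced cohomology from basic cohomology -/

section reduced

variable {q : ℕ}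

/-- Insertion of `L` with its variable set to zero. -/
noncomputable def insertLZero (q : ℕ) : WCochain (q + 1) →ₗ[ℂ] WCochain q where
  toFun γ X l := γ (Fin.cons 0 X) (Fin.cons 0 l)
  map_add' _ _ := rfl
  map_smul' _ _ := rfl

theorem curryCochain_insertFirst_L_zero (f : (Fin (q + 1) → Fin 2 × ℂ) → ℂ) :
    curryCochain q (insertFirst (0, 0) f) = insertLZero q (curryCochain (q + 1) f) := by
  funext X l
  refine congrArg f (funext fun i => ?_)
  refine Fin.cases ?_ (fun j => ?_) i <;> simp

theorem exists_isAlt_curryCochain_eq {γ : WCochain q} (h : γ ∈ cochainSub q) :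
    ∃ f, IsAlt f ∧ curryCochain q f = γ :=
  ⟨(curryCochain q).symm γ, (isSkewCochain_curryCochain_iff _).1 h.2,
    (curryCochain q).apply_symm_apply γ⟩

theorem insertLZero_mem {γ : WCochain (q + 1)} (h : γ ∈ cochainSub (q + 1)) :
    insertLZero q γ ∈ cochainSub q := by
  refine ⟨fun X => ?_, ?_⟩
  · obtain ⟨P, hP⟩ := h.1 (Fin.cons 0 X)
    refine ⟨bind₁ (Fin.cons 0 MvPolynomial.X) P, fun l => ?_⟩
    change γ _ _ = _
    rw [hP, ← MvPolynomial.coe_aeval_eq_eval, ← MvPolynomial.coe_aeval_eq_eval]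
    simp only [RingHom.coe_coe, aeval_bind₁]
    congr 2
    funext i
    refine Fin.cases ?_ (fun j => ?_) i <;> simp
  · obtain ⟨f, hf, rfl⟩ := exists_isAlt_curryCochain_eq h
    rw [← curryCochain_insertFirst_L_zero]
    exact (isSkewCochain_curryCochain_iff _).2 (hf.insertFirst _)

theorem dW_dW {γ : WCochain q} (h : γ ∈ cochainSub q) : dW (dW γ) = 0 := by
  obtain ⟨f, hf, rfl⟩ := exists_isAlt_curryCochain_eq h
  rw [dW_curryCochain hf, dW_curryCochain (BasisBracket.isAlt_diff _ hf), BasisBracket.diff_diff,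
    map_zero]

theorem dW_paW {γ : WCochain q} (h : γ ∈ cochainSub q) : dW (paW q γ) = paW (q + 1) (dW γ) := by
  obtain ⟨f, hf, rfl⟩ := exists_isAlt_curryCochain_eq h
  rw [← curryCochain_lie_L_zero, dW_curryCochain (BasisBracket.isAlt_lie _ _ hf),
    dW_curryCochain hf, ← curryCochain_lie_L_zero, BasisBracket.lie_diff]

/-- Cartan's formula for the homotopy `insertLZero`. -/
theorem insertLZero_dW {γ : WCochain (q + 1)} (h : γ ∈ cochainSub (q + 1)) :
    insertLZero (q + 1) (dW γ) = paW (q + 1) γ - dW (insertLZero q γ) := by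
  obtain ⟨f, hf, rfl⟩ := exists_isAlt_curryCochain_eq h
  rw [dW_curryCochain hf, ← curryCochain_insertFirst_L_zero, ← curryCochain_insertFirst_L_zero,
    dW_curryCochain (hf.insertFirst _), ← curryCochain_lie_L_zero, BasisBracket.insertFirst_diff,
    map_sub]

theorem eq_zero_of_paW {γ : WCochain (q + 1)} (h : γ ∈ cochainSub (q + 1))
    (h0 : paW (q + 1) γ = 0) : γ = 0 := by
  funext X l
  obtain ⟨P, hP⟩ := h.1 X
  have hS : (∑ i : Fin (q + 1), (MvPolynomial.X i : MvPolynomial (Fin (q + 1)) ℂ)) ≠ 0 := by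
    intro h
    have := congrArg (eval (Pi.single 0 1)) h
    simp at this
  have : (∑ i : Fin (q + 1), MvPolynomial.X i) * P = 0 := MvPolynomial.funext fun l => by
    have := congrFun (congrFun h0 X) l
    simpa [paW, hP] using this
  rw [hP, (mul_eq_zero.1 this).resolve_left hS]
  simp

theorem mem_redZ_of_mem_cocycleSub {α : WCochain q} (hα : α ∈ cocycleSub q) : α ∈ redZ q :=
  ⟨hα.1, 0, zero_mem _, by rw [map_zero, show dWLin q α = 0 from hα.2]⟩

theorem insertLZero_mem_redZ {φ : WCochain (q + 1)} (hφ : φ ∈ cocycleSub (q + 1)) :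
    insertLZero q φ ∈ redZ q := by
  refine ⟨insertLZero_mem hφ.1, φ, hφ.1, ?_⟩
  have h := insertLZero_dW hφ.1
  rw [show dW φ = 0 from hφ.2, map_zero] at h
  exact sub_eq_zero.1 h.symm

/-- The map `α ↦ [α]` from basic to reduced cohomology. -/
noncomputable def basicToReduced (q : ℕ) : basicH (q + 1) →ₗ[ℂ] reducedH (q + 1) :=
  Submodule.mapQ _ _
    (Submodule.inclusion
      (show cocycleSub (q + 1) ≤ redZ (q + 1) from fun _ => mem_redZ_of_mem_cocycleSub))
    fun _ h => Submodule.mem_sup_left h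

theorem basicToReduced_mk {α : WCochain (q + 1)} (hα : α ∈ cocycleSub (q + 1)) :
    basicToReduced q (Submodule.Quotient.mk ⟨α, hα⟩) =
      Submodule.Quotient.mk ⟨α, mem_redZ_of_mem_cocycleSub hα⟩ := rfl

/-- The map `φ ↦ [ι_L φ]` from basic cohomology to reduced cohomology in one degree less. -/
noncomputable def basicToReducedShift (q : ℕ) : basicH (q + 2) →ₗ[ℂ] reducedH (q + 1) :=
  Submodule.mapQ _ _
    ((insertLZero (q + 1)).restrict (p := cocycleSub (q + 2)) (q := redZ (q + 1))
      fun _ => insertLZero_mem_redZ) (by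
    rintro ⟨φ, hφ⟩ ⟨η, hη, rfl⟩
    refine Submodule.mem_sup.2 ⟨_, ⟨-insertLZero q η, neg_mem (insertLZero_mem hη), rfl⟩, _,
      ⟨η, hη, rfl⟩, ?_⟩
    rw [map_neg, neg_add_eq_sub]
    exact (insertLZero_dW hη).symm)

theorem basicToReducedShift_mk {φ : WCochain (q + 2)} (hφ : φ ∈ cocycleSub (q + 2)) :
    basicToReducedShift q (Submodule.Quotient.mk ⟨φ, hφ⟩) =
      Submodule.Quotient.mk ⟨insertLZero (q + 1) φ, insertLZero_mem_redZ hφ⟩ := rfl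

theorem basicToReduced_coprod_bijective (q : ℕ) :
    Function.Bijective ((basicToReduced q).coprod (basicToReducedShift q)) := by
  constructor
  · refine (injective_iff_map_eq_zero _).2 ?_
    rintro ⟨a, b⟩ h
    obtain ⟨⟨α, hα⟩, rfl⟩ := Submodule.Quotient.mk_surjective _ a
    obtain ⟨⟨φ, hφ⟩, rfl⟩ := Submodule.Quotient.mk_surjective _ b
    have h1 : α + insertLZero (q + 1) φ ∈ redB (q + 1) := by
      rw [LinearMap.coprod_apply, basicToReduced_mk, basicToReducedShift_mk,
        ← Submodule.Quotient.mk_add, Submodule.Quotient.mk_eq_zero] at h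
      exact h
    obtain ⟨_, ⟨β, hβ, rfl⟩, _, ⟨η, hη, rfl⟩, e⟩ := Submodule.mem_sup.1 h1
    have hφ0 := insertLZero_dW hφ.1
    rw [show dW φ = 0 from hφ.2, map_zero] at hφ0
    have e1 : φ = dW η := by
      have := congrArg (dWLin (q + 1)) e
      rw [map_add, map_add, show dWLin (q + 1) α = 0 from hα.2,
        show dWLin (q + 1) (dWLin q β) = 0 from dW_dW hβ,
        show dWLin (q + 1) (paW (q + 1) η) = paW (q + 2) (dW η) from dW_paW hη,
        zero_add, zero_add] at this
      refine sub_eq_zero.1 (eq_zero_of_paW (sub_mem hφ.1 (dW_mem_cochainSub hη)) ?_)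
      rw [map_sub, this]
      exact hφ0.symm
    subst e1
    have e2 : α = dWLin q (β + insertLZero q η) := by
      rw [insertLZero_dW hη] at e
      rw [map_add, show dWLin q (insertLZero q η) = dW (insertLZero q η) from rfl]
      linear_combination (exp := 1) -e
    refine Prod.ext ((Submodule.Quotient.mk_eq_zero _).2 ?_)
      ((Submodule.Quotient.mk_eq_zero _).2 ?_)
    · exact ⟨_, add_mem hβ (insertLZero_mem hη), e2.symm⟩
    · exact ⟨η, hη, rfl⟩
  · intro c
    obtain ⟨⟨γ, hγ, φ, hφ, e⟩, rfl⟩ := Submodule.Quotient.mk_surjective _ c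
    have hdφ : dW φ = 0 := by
      refine eq_zero_of_paW (dW_mem_cochainSub hφ) ?_
      rw [← dW_paW hφ, e]
      exact dW_dW hγ
    have hφ0 := insertLZero_dW hφ
    rw [hdφ, map_zero] at hφ0
    refine ⟨(Submodule.Quotient.mk ⟨γ - insertLZero (q + 1) φ,
      sub_mem hγ (insertLZero_mem hφ), ?_⟩, Submodule.Quotient.mk ⟨φ, hφ, hdφ⟩), ?_⟩
    · change dWLin (q + 1) _ = 0
      rw [map_sub, ← e]
      exact hφ0.symm
    · rw [LinearMap.coprod_apply]
      refine congrArg Submodule.Quotient.mk (Subtype.ext ?_)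
      exact sub_add_cancel γ (insertLZero (q + 1) φ)

/-- Reduced cohomology in degree `q + 1` is the sum of the basic cohomologies in degrees `q + 1`
and `q + 2`. -/
noncomputable def reducedHEquiv (q : ℕ) :
    (basicH (q + 1) × basicH (q + 2)) ≃ₗ[ℂ] reducedH (q + 1) :=
  LinearEquiv.ofBijective _ (basicToReduced_coprod_bijective q)

end reduced

/-! ### Reduction to weight zero -/

section weight

variable {N q : ℕ}

/-- The weight of a basis tuple, for the grading by eigenvalues of `L_0`. -/
def wt (Y : Fin q → Fin 2 × ℕ) : ℤ := ∑ i, (1 - ((Y i).2 : ℤ))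

theorem wt_cons (g : Fin 2 × ℕ) (Y : Fin q → Fin 2 × ℕ) :
    wt (Fin.cons g Y : Fin (q + 1) → Fin 2 × ℕ) = (1 - (g.2 : ℤ)) + wt Y := by
  rw [wt, Fin.sum_univ_succ]
  simp only [Fin.cons_zero, Fin.cons_succ]
  rfl

theorem wt_comp_perm (Y : Fin q → Fin 2 × ℕ) (σ : Equiv.Perm (Fin q)) : wt (Y ∘ σ) = wt Y :=
  Equiv.sum_comp σ fun i => 1 - ((Y i).2 : ℤ)

theorem coeffBracket_coef_mul_comp_wt (φ : ℤ → ℂ) (g : Fin 2 × ℕ) (Y : Fin q → Fin 2 × ℕ)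
    (j : Fin q) :
    (coeffBracket ℂ).coef g (Y j) * φ (wt (Function.update Y j ((coeffBracket ℂ).mul g (Y j)))) =
      (coeffBracket ℂ).coef g (Y j) * φ ((1 - (g.2 : ℤ)) + wt Y) := by
  by_cases h : g.2 = 0 ∧ (Y j).2 = 0
  · simp [coeffBracket, h.1, h.2]
  · congr 2
    have h1 : wt Y = ∑ i ∈ Finset.univ \ {j}, (1 - ((Y i).2 : ℤ)) + (1 - ((Y j).2 : ℤ)) := by
      rw [wt, ← Finset.sum_sdiff (Finset.subset_univ {j}), Finset.sum_singleton]
    have h2 : wt (Function.update Y j ((coeffBracket ℂ).mul g (Y j))) =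
        ∑ i ∈ Finset.univ \ {j}, (1 - ((Y i).2 : ℤ)) + (1 - ((g.2 + (Y j).2 - 1 : ℕ) : ℤ)) := by
      rw [wt, ← Finset.sum_sdiff (Finset.subset_univ {j}), Finset.sum_singleton,
        Function.update_self]
      congr 1
      refine Finset.sum_congr rfl fun i hi => ?_
      rw [Function.update_of_ne (by simpa using hi)]
    rw [h1, h2]
    omega

theorem lie_comp_wt_mul (φ : ℤ → ℂ) (g : Fin 2 × ℕ) (c : (Fin q → Fin 2 × ℕ) → ℂ) :
    (coeffBracket ℂ).lie g (fun Y => φ (wt Y) * c Y) =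
      fun Y => φ ((1 - (g.2 : ℤ)) + wt Y) * (coeffBracket ℂ).lie g c Y := by
  funext Y
  simp only [BasisBracket.lie, mul_neg, Finset.mul_sum]
  congr 1
  refine Finset.sum_congr rfl fun j _ => ?_
  rw [← mul_assoc, coeffBracket_coef_mul_comp_wt]
  ring

theorem diff_comp_wt_mul (φ : ℤ → ℂ) (c : (Fin q → Fin 2 × ℕ) → ℂ) :
    (coeffBracket ℂ).diff (fun Y => φ (wt Y) * c Y) =
      fun Y => φ (wt Y) * (coeffBracket ℂ).diff c Y := by
  induction q generalizing φ with
  | zero => simp [BasisBracket.diff_of_zero]; rfl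
  | succ q ih =>
    refine insertFirst_ext fun g => ?_
    have h1 : insertFirst g (fun Y => φ (wt Y) * c Y) =
        fun Y => φ ((1 - (g.2 : ℤ)) + wt Y) * insertFirst g c Y := by
      funext Y
      rw [insertFirst, wt_cons]
      rfl
    have h2 : insertFirst g (fun Y => φ (wt Y) * (coeffBracket ℂ).diff c Y) =
        fun Y => φ ((1 - (g.2 : ℤ)) + wt Y) * insertFirst g ((coeffBracket ℂ).diff c) Y := by
      funext Y
      rw [insertFirst, wt_cons]
      rfl
    rw [h2, BasisBracket.insertFirst_diff, BasisBracket.insertFirst_diff, h1,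
      ih fun w => φ (1 - (g.2 : ℤ) + w), lie_comp_wt_mul]
    funext Y
    simp [mul_sub]

theorem lie_L_one (c : (Fin q → Fin 2 × ℕ) → ℂ) (Y : Fin q → Fin 2 × ℕ) :
    (coeffBracket ℂ).lie (0, 1) c Y = -(wt Y * c Y) := by
  rw [BasisBracket.lie, wt, Int.cast_sum, Finset.sum_mul]
  congr 1
  refine Finset.sum_congr rfl fun j _ => ?_
  have : (coeffBracket ℂ).mul (0, 1) (Y j) = Y j := Prod.ext (by simp [coeffBracket, bres])
    (by simp [coeffBracket])
  rw [this, Function.update_eq_self]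
  simp [coeffBracket]

theorem comp_wt_mul_mem_finAlt (φ : ℤ → ℂ) {c : (Fin q → Fin 2 × ℕ) → ℂ} (hc : c ∈ finAlt q) :
    (fun Y => φ (wt Y) * c Y) ∈ finAlt q := by
  obtain ⟨hc, N, hN⟩ := hc
  refine ⟨fun σ Y => ?_, N, fun Y i hi => ?_⟩
  · simp only [wt_comp_perm, hc σ Y]; ring
  · simp only [hN Y i hi, mul_zero]

theorem insertFirst_mem_finAlt (g : Fin 2 × ℕ) {c : (Fin (q + 1) → Fin 2 × ℕ) → ℂ}
    (hc : c ∈ finAlt (q + 1)) : insertFirst g c ∈ finAlt q :=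
  ⟨hc.1.insertFirst g, _, hc.2.choose_spec.insertFirst g⟩

/-- A cocycle without component of weight zero is a coboundary. -/
theorem exists_diff_eq_of_wt {c : (Fin (q + 1) → Fin 2 × ℕ) → ℂ} (hc : c ∈ finAlt (q + 1))
    (hd : (coeffBracket ℂ).diff c = 0) (h0 : ∀ Y, wt Y = 0 → c Y = 0) :
    ∃ y ∈ finAlt q, (coeffBracket ℂ).diff y = c := by
  refine ⟨fun Y => (fun w : ℤ => -(w : ℂ)⁻¹) (wt Y) * insertFirst (0, 1) c Y,
    comp_wt_mul_mem_finAlt (fun w : ℤ => -(w : ℂ)⁻¹) (insertFirst_mem_finAlt (0, 1) hc), ?_⟩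
  have h := (coeffBracket ℂ).insertFirst_diff (0, 1) c
  have h1 : (coeffBracket ℂ).diff (insertFirst (0, 1) c) = (coeffBracket ℂ).lie (0, 1) c := by
    rw [hd] at h
    exact (sub_eq_zero.1 h.symm).symm
  rw [diff_comp_wt_mul fun w : ℤ => -(w : ℂ)⁻¹, h1]
  funext Y
  simp only [lie_L_one]
  rcases eq_or_ne (wt Y) 0 with hw | hw
  · simp [hw, h0 Y hw]
  · have : (wt Y : ℂ) ≠ 0 := Int.cast_ne_zero.2 hw
    field_simp

theorem diff_eq_zero_of_wt_eq_zero {c : (Fin q → Fin 2 × ℕ) → ℂ} (h0 : ∀ Y, wt Y = 0 → c Y = 0)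
    {Y : Fin (q + 1) → Fin 2 × ℕ} (hY : wt Y = 0) : (coeffBracket ℂ).diff c Y = 0 := by
  have e : c = fun Y => (fun w : ℤ => if w = 0 then (0 : ℂ) else 1) (wt Y) * c Y := by
    funext Y
    by_cases h : wt Y = 0 <;> simp [h, h0]
  rw [e, diff_comp_wt_mul fun w : ℤ => if w = 0 then (0 : ℂ) else 1]
  simp [hY]

theorem diff_eq_zero_of_wt_ne_zero {c : (Fin q → Fin 2 × ℕ) → ℂ} (h0 : ∀ Y, wt Y ≠ 0 → c Y = 0)
    {Y : Fin (q + 1) → Fin 2 × ℕ} (hY : wt Y ≠ 0) : (coeffBracket ℂ).diff c Y = 0 := by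
  have e : c = fun Y => (fun w : ℤ => if w = 0 then (1 : ℂ) else 0) (wt Y) * c Y := by
    funext Y
    by_cases h : wt Y = 0 <;> simp [h, h0]
  rw [e, diff_comp_wt_mul fun w : ℤ => if w = 0 then (1 : ℂ) else 0]
  simp [hY]

end weight

section altBasis

variable {q : ℕ}

/-- The alternating function dual to the basis tuple `t`, by cofactor expansion of
`det (Y i = t j)`. -/
def altBasis {G : Type*} [DecidableEq G] : ∀ {q : ℕ}, (Fin q → G) → (Fin q → G) → ℤ
  | 0, _, _ => 1
  | _ + 1, t, Y => ∑ j, if Y 0 = t j then (-1) ^ (j : ℕ) * altBasis (j.removeNth t) (Fin.tail Y)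
      else 0

variable {G : Type*} [DecidableEq G]

theorem altBasis_eq_det (t Y : Fin q → G) :
    altBasis t Y = (Matrix.of fun i j => if Y i = t j then (1 : ℤ) else 0).det := by
  induction q with
  | zero => simp [altBasis]
  | succ q ih =>
    rw [Matrix.det_succ_row_zero, altBasis]
    refine Finset.sum_congr rfl fun j _ => ?_
    rw [ih]
    split_ifs with h
    · simp only [Matrix.of_apply, h, if_true, mul_one]
      rfl
    · simp [h]

theorem altBasis_comp_perm (t Y : Fin q → G) (σ : Equiv.Perm (Fin q)) :
    altBasis t (Y ∘ σ) = Equiv.Perm.sign σ * altBasis t Y := by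
  rw [altBasis_eq_det, altBasis_eq_det]
  exact Matrix.det_permute σ (Matrix.of fun i j => if Y i = t j then (1 : ℤ) else 0)

theorem exists_comp_perm_of_altBasis_ne_zero {t Y : Fin q → G} (h : altBasis t Y ≠ 0) :
    ∃ σ : Equiv.Perm (Fin q), Y ∘ σ = t := by
  rw [altBasis_eq_det, Matrix.det_apply] at h
  obtain ⟨σ, -, hσ⟩ := Finset.exists_ne_zero_of_sum_ne_zero h
  refine ⟨σ, funext fun i => ?_⟩
  by_contra hi
  refine hσ ?_
  rw [Finset.prod_eq_zero (Finset.mem_univ i) (by simpa using hi), smul_zero]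

end altBasis

/-! ### Matrix certificates -/

theorem BasisBracket.lie_intCast {q : ℕ} (g : Fin 2 × ℕ) (f : (Fin q → Fin 2 × ℕ) → ℤ) :
    (coeffBracket ℂ).lie g (fun Y => (f Y : ℂ)) = fun Y => ((coeffBracket ℤ).lie g f Y : ℂ) := by
  funext Y
  simp only [BasisBracket.lie]
  push_cast
  congr 1
  refine Finset.sum_congr rfl fun j _ => ?_
  congr 1
  simp only [coeffBracket]
  split_ifs <;> simp

theorem BasisBracket.diff_intCast {q : ℕ} (f : (Fin q → Fin 2 × ℕ) → ℤ) :
    (coeffBracket ℂ).diff (fun Y => (f Y : ℂ)) = fun Y => ((coeffBracket ℤ).diff f Y : ℂ) := by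
  induction q with
  | zero => funext Y; simp [BasisBracket.diff_of_zero]
  | succ q ih =>
    refine insertFirst_ext fun g => ?_
    have h : insertFirst g (fun Y => (f Y : ℂ)) = fun Y => ((insertFirst g f Y : ℤ) : ℂ) := rfl
    rw [BasisBracket.insertFirst_diff, h, ih, BasisBracket.lie_intCast]
    funext Y
    have := congrFun ((coeffBracket ℤ).insertFirst_diff g f) Y
    change _ = ((insertFirst g ((coeffBracket ℤ).diff f) Y : ℤ) : ℂ)
    rw [this]
    simp

section basis

variable {q a b : ℕ}

/-- The cochain dual to the basis tuple `t`. -/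
noncomputable def dualCochain (t : Fin q → Fin 2 × ℕ) : (Fin q → Fin 2 × ℕ) → ℂ :=
  fun Y => altBasis t Y

theorem exists_comp_perm_of_dualCochain_ne_zero {t Y : Fin q → Fin 2 × ℕ}
    (h : dualCochain t Y ≠ 0) : ∃ σ : Equiv.Perm (Fin q), Y ∘ σ = t :=
  exists_comp_perm_of_altBasis_ne_zero (Int.cast_ne_zero.1 h)

theorem dualCochain_mem_finAlt (t : Fin q → Fin 2 × ℕ) : dualCochain t ∈ finAlt q := by
  refine ⟨fun σ Y => ?_, ∑ i, (t i).2 + 1, fun Y i hi => ?_⟩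
  · rw [dualCochain, altBasis_comp_perm]; push_cast; rfl
  · by_contra h
    obtain ⟨σ, hσ⟩ := exists_comp_perm_of_dualCochain_ne_zero h
    have h1 : t (σ.symm i) = Y i := by rw [← hσ]; simp
    have h2 := Finset.single_le_sum (f := fun i => (t i).2) (fun _ _ => Nat.zero_le _)
      (Finset.mem_univ (σ.symm i))
    simp only [h1] at h2
    omega

theorem dualCochain_of_wt_ne {t Y : Fin q → Fin 2 × ℕ} (h : wt Y ≠ wt t) : dualCochain t Y = 0 := by
  by_contra h0
  obtain ⟨σ, hσ⟩ := exists_comp_perm_of_dualCochain_ne_zero h0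
  exact h (by rw [← hσ, wt_comp_perm])

/-- The tuples `T i` represent all sets of `q` basis elements of total weight zero. -/
structure IsWeightZeroBasis (T : Fin a → Fin q → Fin 2 × ℕ) : Prop where
  altBasis_eq : ∀ i j, altBasis (T j) (T i) = if i = j then 1 else 0
  wt_eq : ∀ i, wt (T i) = 0
  exists_perm : ∀ Y : Fin q → Fin 2 × ℕ, Y.Injective → wt Y = 0 →
    ∃ i, ∃ σ : Equiv.Perm (Fin q), Y ∘ σ = T i

theorem IsAlt.eq_zero_of_not_injective {c : (Fin q → Fin 2 × ℕ) → ℂ} (hc : IsAlt c)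
    {Y : Fin q → Fin 2 × ℕ} (hY : ¬ Y.Injective) : c Y = 0 := by
  rw [Function.Injective] at hY
  push Not at hY
  obtain ⟨i, j, h, hij⟩ := hY
  have h1 := hc (Equiv.swap i j) Y
  have h2 : Y ∘ Equiv.swap i j = Y := by
    funext k
    rcases eq_or_ne k i with rfl | hi
    · simp [h]
    rcases eq_or_ne k j with rfl | hj
    · simp [h]
    simp [Equiv.swap_apply_of_ne_of_ne hi hj]
  rw [h2, Equiv.Perm.sign_swap hij] at h1
  push_cast at h1
  linear_combination h1 / 2

/-- The cochain with prescribed values on basis tuples. -/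
noncomputable def dualSum (T : Fin a → Fin q → Fin 2 × ℕ) (u : Fin a → ℂ) :
    (Fin q → Fin 2 × ℕ) → ℂ :=
  ∑ j, u j • dualCochain (T j)

theorem dualSum_mem_finAlt (T : Fin a → Fin q → Fin 2 × ℕ) (u : Fin a → ℂ) :
    dualSum T u ∈ finAlt q :=
  Submodule.sum_mem _ fun _ _ => Submodule.smul_mem _ _ (dualCochain_mem_finAlt _)

/-- The matrix of the differential between the spans of dual cochains. -/
def diffMatrix (T : Fin a → Fin q → Fin 2 × ℕ) (T' : Fin b → Fin (q + 1) → Fin 2 × ℕ) :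
    Matrix (Fin b) (Fin a) ℤ :=
  Matrix.of fun i j => (coeffBracket ℤ).diff (altBasis (T j)) (T' i)

theorem diff_dualSum (T : Fin a → Fin q → Fin 2 × ℕ) (T' : Fin b → Fin (q + 1) → Fin 2 × ℕ)
    (u : Fin a → ℂ) : (coeffBracket ℂ).diff (dualSum T u) ∘ T' =
      ((diffMatrix T T').map (Int.castRingHom ℂ)).mulVec u := by
  funext i
  rw [Function.comp_apply, dualSum, BasisBracket.diff_sum_smul, Finset.sum_apply]
  refine Finset.sum_congr rfl fun j _ => ?_
  have : (coeffBracket ℂ).diff (dualCochain (T j)) (T' i) = (diffMatrix T T' i j : ℂ) :=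
    congrFun (BasisBracket.diff_intCast _) _
  simp [this, _root_.mul_comm]

namespace IsWeightZeroBasis

variable {T : Fin a → Fin q → Fin 2 × ℕ}

theorem eq_zero (hT : IsWeightZeroBasis T) {c : (Fin q → Fin 2 × ℕ) → ℂ} (hc : IsAlt c) (h : c ∘ T = 0)
    {Y : Fin q → Fin 2 × ℕ} (hY : wt Y = 0) : c Y = 0 := by
  by_cases hi : Y.Injective
  · obtain ⟨i, σ, hσ⟩ := hT.exists_perm Y hi hY
    have h1 := hc σ Y
    have h2 : c (T i) = 0 := congrFun h i
    rw [hσ, h2] at h1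
    have h3 : ((Equiv.Perm.sign σ : ℤ) : ℂ) ≠ 0 := by
      rcases Int.units_eq_one_or (Equiv.Perm.sign σ) with h | h <;> simp [h]
    exact (mul_eq_zero.1 h1.symm).resolve_left h3
  · exact hc.eq_zero_of_not_injective hi

theorem dualSum_comp (hT : IsWeightZeroBasis T) (u : Fin a → ℂ) : dualSum T u ∘ T = u := by
  funext i
  simp [dualSum, Finset.sum_apply, dualCochain, hT.altBasis_eq]

theorem dualSum_of_wt_ne (hT : IsWeightZeroBasis T) (u : Fin a → ℂ)
    {Y : Fin q → Fin 2 × ℕ} (hY : wt Y ≠ 0) :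
    dualSum T u Y = 0 := by
  rw [dualSum, Finset.sum_apply]
  refine Finset.sum_eq_zero fun j _ => ?_
  rw [Pi.smul_apply, dualCochain_of_wt_ne (by rwa [hT.wt_eq]), smul_zero]

theorem diff_comp (hT : IsWeightZeroBasis T) {T' : Fin b → Fin (q + 1) → Fin 2 × ℕ} (hT' : ∀ i, wt (T' i) = 0)
    {c : (Fin q → Fin 2 × ℕ) → ℂ} (hc : c ∈ finAlt q) : (coeffBracket ℂ).diff c ∘ T' =
      ((diffMatrix T T').map (Int.castRingHom ℂ)).mulVec (c ∘ T) := by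
  rw [← diff_dualSum]
  funext i
  have h := Submodule.sub_mem _ hc (dualSum_mem_finAlt T (c ∘ T))
  have h1 : (c - dualSum T (c ∘ T)) ∘ T = 0 := by
    rw [← sub_eq_zero.2 (hT.dualSum_comp (c ∘ T)).symm]
    rfl
  have h2 := diff_eq_zero_of_wt_eq_zero (fun Y hY => hT.eq_zero h.1 h1 hY) (hT' i)
  rw [BasisBracket.diff_sub] at h2
  exact sub_eq_zero.1 h2

end IsWeightZeroBasis

/-- A contraction of the weight zero subcomplex onto `Fin h → ℂ` computes the basic cohomology. -/
theorem nonempty_basicH_equiv_of_contraction {c h : ℕ} {T : Fin a → Fin q → Fin 2 × ℕ}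
    {T' : Fin b → Fin (q + 1) → Fin 2 × ℕ} {T'' : Fin c → Fin (q + 2) → Fin 2 × ℕ}
    (hT : IsWeightZeroBasis T) (hT' : IsWeightZeroBasis T') (hT'' : IsWeightZeroBasis T'')
    {D : Matrix (Fin b) (Fin a) ℤ} {D' : Matrix (Fin c) (Fin b) ℤ}
    (hD : diffMatrix T T' = D) (hD' : diffMatrix T' T'' = D')
    (F : Matrix (Fin h) (Fin b) ℤ) (R : Matrix (Fin b) (Fin h) ℤ)
    (H : Matrix (Fin a) (Fin b) ℤ) (H' : Matrix (Fin b) (Fin c) ℤ) (m : ℤ) (hm : m ≠ 0)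
    (hFD : F * D = 0) (hDR : D' * R = 0) (hFR : F * R = Matrix.diagonal fun _ => m)
    (hH : R * F + D * H + H' * D' = Matrix.diagonal fun _ => m) :
    Nonempty (basicH (q + 1) ≃ₗ[ℂ] (Fin h → ℂ)) := by
  have hm' : (m : ℂ) ≠ 0 := Int.cast_ne_zero.2 hm
  set f := Int.castRingHom ℂ with hf
  replace hFD : F.map f * D.map f = 0 := by rw [← Matrix.map_mul, hFD]; simp
  replace hDR : D'.map f * R.map f = 0 := by rw [← Matrix.map_mul, hDR]; simp
  replace hFR : F.map f * R.map f = Matrix.diagonal fun _ => (m : ℂ) := by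
    rw [← Matrix.map_mul, hFR, Matrix.diagonal_map (map_zero f)]; rfl
  replace hH : R.map f * F.map f + D.map f * H.map f + H'.map f * D'.map f =
      Matrix.diagonal fun _ => (m : ℂ) := by
    rw [← Matrix.map_mul, ← Matrix.map_mul, ← Matrix.map_mul,
      ← Matrix.map_add f (map_add f), ← Matrix.map_add f (map_add f), hH,
      Matrix.diagonal_map (map_zero f)]
    rfl
  refine nonempty_basicH_equiv
    ((Matrix.mulVecLin (F.map f)).comp (LinearMap.funLeft ℂ ℂ T')) (fun v => ?_) (fun y hy => ?_)
    fun z hz hd h0 => ?_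
  · refine ⟨dualSum T' ((R.map f).mulVec ((m : ℂ)⁻¹ • v)), dualSum_mem_finAlt _ _, ?_, ?_⟩
    · funext Y
      by_cases hY : wt Y = 0
      · refine hT''.eq_zero (diff_mem_finAlt (dualSum_mem_finAlt _ _)).1 ?_ hY
        rw [diff_dualSum, hD', Matrix.mulVec_mulVec, hDR, Matrix.zero_mulVec]
      · exact diff_eq_zero_of_wt_ne_zero (fun Z hZ => hT'.dualSum_of_wt_ne _ hZ) hY
    · change (F.map f).mulVec (dualSum T' _ ∘ T') = v
      rw [hT'.dualSum_comp, Matrix.mulVec_mulVec, hFR]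
      funext i
      simp [Matrix.mulVec_diagonal, hm']
  · change (F.map f).mulVec ((coeffBracket ℂ).diff y ∘ T') = 0
    rw [hT.diff_comp hT'.wt_eq hy, hD, Matrix.mulVec_mulVec, hFD, Matrix.zero_mulVec]
  · replace h0 : (F.map f).mulVec (z ∘ T') = 0 := h0
    set u := (H.map f).mulVec ((m : ℂ)⁻¹ • (z ∘ T')) with hu
    have hdz : (D'.map f).mulVec (z ∘ T') = 0 := by
      rw [← hD', ← hT'.diff_comp hT''.wt_eq hz, hd]; rfl
    have hw := dualSum_mem_finAlt T u
    have hz' := Submodule.sub_mem _ hz (diff_mem_finAlt hw)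
    have h1 : (z - (coeffBracket ℂ).diff (dualSum T u)) ∘ T' = 0 := by
      have h2 : (coeffBracket ℂ).diff (dualSum T u) ∘ T' = z ∘ T' := by
        rw [diff_dualSum, hD, hu, Matrix.mulVec_mulVec, Matrix.mulVec_smul]
        have h3 := congrArg (fun M => M.mulVec (z ∘ T')) hH
        simp only [Matrix.add_mulVec, ← Matrix.mulVec_mulVec, h0, hdz, Matrix.mulVec_zero,
          zero_add, add_zero] at h3
        rw [← Matrix.mulVec_mulVec, h3]
        funext i
        simp [hm']
      funext i
      exact sub_eq_zero.2 (congrFun h2 i).symm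
    obtain ⟨y, hy, hyz⟩ := exists_diff_eq_of_wt hz'
      (by rw [BasisBracket.diff_sub, hd, BasisBracket.diff_diff, sub_zero])
      fun Y hY => hT'.eq_zero hz'.1 h1 hY
    exact ⟨y + dualSum T u, Submodule.add_mem _ hy hw, by
      rw [BasisBracket.diff_add, hyz, sub_add_cancel]⟩

theorem snd_lt_four_of_sum_eq_zero {S : Finset (Fin 2 × ℕ)}
    (hS : ∑ x ∈ S, (1 - (x.2 : ℤ)) = 0) : S ⊆ Finset.univ ×ˢ Finset.range 4 := by
  intro x hx
  by_contra h
  have hx4 : 4 ≤ x.2 := by simpa using h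
  rw [← Finset.add_sum_erase _ _ hx] at hS
  have h1 : ∑ y ∈ S.erase x, (1 - (y.2 : ℤ)) ≤ ∑ y ∈ S.erase x, if y.2 = 0 then 1 else 0 :=
    Finset.sum_le_sum fun y _ => by split_ifs <;> omega
  rw [Finset.sum_boole] at h1
  have h2 : ((S.erase x).filter fun y => y.2 = 0) ⊆ Finset.univ ×ˢ {0} := by
    intro y hy
    rw [Finset.mem_product, Finset.mem_singleton]
    exact ⟨Finset.mem_univ _, (Finset.mem_filter.1 hy).2⟩
  have h3 := Finset.card_le_card h2
  simp at h3
  have h4 : ((((S.erase x).filter fun y => y.2 = 0).card : ℕ) : ℤ) ≤ 2 := by exact_mod_cast h3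
  omega

theorem isWeightZeroBasis_of_powersetCard {T : Fin a → Fin q → Fin 2 × ℕ}
    (h1 : ∀ i j, altBasis (T j) (T i) = if i = j then 1 else 0) (h2 : ∀ i, wt (T i) = 0)
    (h3 : ∀ S ∈ ((Finset.univ : Finset (Fin 2)) ×ˢ Finset.range 4).powersetCard q,
      ∑ x ∈ S, (1 - (x.2 : ℤ)) = 0 → ∃ i, Finset.univ.image (T i) = S) :
    IsWeightZeroBasis T := by
  refine ⟨h1, h2, fun Y hY hw => ?_⟩
  have hs : ∑ x ∈ Finset.univ.image Y, (1 - (x.2 : ℤ)) = 0 := by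
    rwa [Finset.sum_image fun i _ j _ h => hY h]
  have hc : (Finset.univ.image Y).card = q := by
    rw [Finset.card_image_of_injective _ hY, Finset.card_univ, Fintype.card_fin]
  obtain ⟨i, hi⟩ := h3 _ (Finset.mem_powersetCard.2 ⟨snd_lt_four_of_sum_eq_zero hs, hc⟩) hs
  have hex : ∀ j, ∃ k, Y k = T i j := fun j => by
    have : T i j ∈ Finset.univ.image Y := hi ▸ Finset.mem_image_of_mem _ (Finset.mem_univ j)
    simpa using this
  choose s hs' using hex
  have hTi : (T i).Injective := by
    have : (Finset.univ.image (T i)).card = (Finset.univ : Finset (Fin q)).card := by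
      rw [hi, hc, Finset.card_univ, Fintype.card_fin]
    exact fun x y h => Finset.card_image_iff.1 this (Finset.mem_coe.2 (Finset.mem_univ x))
      (Finset.mem_coe.2 (Finset.mem_univ y)) h
  have hsi : s.Injective := fun x y h => hTi (by rw [← hs', ← hs', h])
  exact ⟨i, Equiv.ofBijective s (Finite.injective_iff_bijective.1 hsi), funext hs'⟩

end basis

/-! ### The weight zero subcomplex -/

namespace WeightZero

/-- Weight zero basis tuples of degree 0. -/
def tuplesZero : Fin 1 → Fin 0 → Fin 2 × ℕ :=
  ![![]]

theorem isWeightZeroBasis_tuplesZero : IsWeightZeroBasis tuplesZero :=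
  isWeightZeroBasis_of_powersetCard (by decide +kernel) (by decide +kernel) (by decide +kernel)

/-- Weight zero basis tuples of degree 1. -/
def tuplesOne : Fin 2 → Fin 1 → Fin 2 × ℕ :=
  ![![(0, 1)], ![(1, 1)]]

theorem isWeightZeroBasis_tuplesOne : IsWeightZeroBasis tuplesOne :=
  isWeightZeroBasis_of_powersetCard (by decide +kernel) (by decide +kernel) (by decide +kernel)

/-- Weight zero basis tuples of degree 2. -/
def tuplesTwo : Fin 5 → Fin 2 → Fin 2 × ℕ :=
  ![![(0, 0), (0, 2)], ![(0, 0), (1, 2)], ![(0, 1), (1, 1)], ![(0, 2), (1, 0)],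
    ![(1, 0), (1, 2)]]

theorem isWeightZeroBasis_tuplesTwo : IsWeightZeroBasis tuplesTwo :=
  isWeightZeroBasis_of_powersetCard (by decide +kernel) (by decide +kernel) (by decide +kernel)

/-- Weight zero basis tuples of degree 3. -/
def tuplesThree : Fin 10 → Fin 3 → Fin 2 × ℕ :=
  ![![(0, 0), (0, 1), (0, 2)], ![(0, 0), (0, 1), (1, 2)], ![(0, 0), (0, 2), (1, 1)],
    ![(0, 0), (0, 3), (1, 0)], ![(0, 0), (1, 0), (1, 3)], ![(0, 0), (1, 1), (1, 2)],
    ![(0, 1), (0, 2), (1, 0)], ![(0, 1), (1, 0), (1, 2)], ![(0, 2), (1, 0), (1, 1)],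
    ![(1, 0), (1, 1), (1, 2)]]

theorem isWeightZeroBasis_tuplesThree : IsWeightZeroBasis tuplesThree :=
  isWeightZeroBasis_of_powersetCard (by decide +kernel) (by decide +kernel) (by decide +kernel)

/-- Weight zero basis tuples of degree 4. -/
def tuplesFour : Fin 9 → Fin 4 → Fin 2 × ℕ :=
  ![![(0, 0), (0, 1), (0, 2), (1, 1)], ![(0, 0), (0, 1), (0, 3), (1, 0)],
    ![(0, 0), (0, 1), (1, 0), (1, 3)], ![(0, 0), (0, 1), (1, 1), (1, 2)],
    ![(0, 0), (0, 2), (1, 0), (1, 2)], ![(0, 0), (0, 3), (1, 0), (1, 1)],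
    ![(0, 0), (1, 0), (1, 1), (1, 3)], ![(0, 1), (0, 2), (1, 0), (1, 1)],
    ![(0, 1), (1, 0), (1, 1), (1, 2)]]

theorem isWeightZeroBasis_tuplesFour : IsWeightZeroBasis tuplesFour :=
  isWeightZeroBasis_of_powersetCard (by decide +kernel) (by decide +kernel) (by decide +kernel)

/-- Weight zero basis tuples of degree 5. -/
def tuplesFive : Fin 4 → Fin 5 → Fin 2 × ℕ :=
  ![![(0, 0), (0, 1), (0, 2), (1, 0), (1, 2)], ![(0, 0), (0, 1), (0, 3), (1, 0), (1, 1)],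
    ![(0, 0), (0, 1), (1, 0), (1, 1), (1, 3)], ![(0, 0), (0, 2), (1, 0), (1, 1), (1, 2)]]

theorem isWeightZeroBasis_tuplesFive : IsWeightZeroBasis tuplesFive :=
  isWeightZeroBasis_of_powersetCard (by decide +kernel) (by decide +kernel) (by decide +kernel)

/-- Weight zero basis tuples of degree 6. -/
def tuplesSix : Fin 1 → Fin 6 → Fin 2 × ℕ :=
  ![![(0, 0), (0, 1), (0, 2), (1, 0), (1, 1), (1, 2)]]

theorem isWeightZeroBasis_tuplesSix : IsWeightZeroBasis tuplesSix :=
  isWeightZeroBasis_of_powersetCard (by decide +kernel) (by decide +kernel) (by decide +kernel)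

/-- Weight zero basis tuples of degree 7. -/
def tuplesSeven : Fin 0 → Fin 7 → Fin 2 × ℕ :=
  ![]

theorem isWeightZeroBasis_tuplesSeven : IsWeightZeroBasis tuplesSeven :=
  isWeightZeroBasis_of_powersetCard (by decide +kernel) (by decide +kernel) (by decide +kernel)

theorem diffMatrix_tuplesZero : diffMatrix tuplesZero tuplesOne =
    0 := by
  decide +kernel

theorem diffMatrix_tuplesOne : diffMatrix tuplesOne tuplesTwo =
    !![2, 0; 0, 2; 0, 0; 0, -2; 0, 0] := by
  decide +kernel

theorem diffMatrix_tuplesTwo : diffMatrix tuplesTwo tuplesThree =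
    !![0, 0, 0, 0, 0; 0, 0, 2, 0, 0; 0, 1, 2, 1, 0; 0, 3, 0, 3, 0; 0, 0, 0, 0, 3; 0, 0, 0, 0, 1; 0,
        0, 2, 0, 0; 0, 0, 0, 0, 0; 0, 0, 0, 0, -1; 0, 0, 0, 0, 0] := by
  decide +kernel

theorem diffMatrix_tuplesThree : diffMatrix tuplesThree tuplesFour =
    !![0, -1, 0, 0, 0, 0, 1, 0, 0, 0; 0, -3, 0, 0, 0, 0, 3, 0, 0, 0; 0, 0, 0, 0, 0, 0, 0, 3, 0, 0;
        0, 0, 0, 0, 0, 0, 0, 1, 0, 0; 0, 0, 0, 0, 0, 2, 0, 2, 2, 0; 0, 0, 0, 0, 2, -3, 0, 0, 3,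
        0; 0, 0, 0, 0, 0, 0, 0, 0, 0, 3; 0, 0, 0, 0, 0, 0, 0, 1, 0, 0; 0, 0, 0, 0, 0, 0, 0, 0,
        0, 0] := by
  decide +kernel

theorem diffMatrix_tuplesFour : diffMatrix tuplesFour tuplesFive =
    !![0, 0, 0, -2, 0, 0, 0, 2, 0; 0, 0, -2, 3, 0, 0, 0, 3, 0; 0, 0, 0, 0, 0, 0, 0, 0, 3; 0, 0, 0,
        0, 0, 0, 0, 0, 2] := by
  decide +kernel

theorem diffMatrix_tuplesFive : diffMatrix tuplesFive tuplesSix =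
    0 := by
  decide +kernel

theorem diffMatrix_tuplesSix : diffMatrix tuplesSix tuplesSeven =
    0 := by
  decide +kernel

theorem nonempty_basicH_one_equiv : Nonempty (basicH 1 ≃ₗ[ℂ] (Fin 0 → ℂ)) :=
  nonempty_basicH_equiv_of_contraction isWeightZeroBasis_tuplesZero
    isWeightZeroBasis_tuplesOne isWeightZeroBasis_tuplesTwo
    diffMatrix_tuplesZero diffMatrix_tuplesOne
    0
    0
    0
    (!![1, 0, 0, 0, 0; 0, 0, 0, -1, 0])
    2 (by decide) (by decide +kernel) (by decide +kernel)
    (by decide +kernel) (by decide +kernel)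

theorem nonempty_basicH_two_equiv : Nonempty (basicH 2 ≃ₗ[ℂ] (Fin 0 → ℂ)) :=
  nonempty_basicH_equiv_of_contraction isWeightZeroBasis_tuplesOne
    isWeightZeroBasis_tuplesTwo isWeightZeroBasis_tuplesThree
    diffMatrix_tuplesOne diffMatrix_tuplesTwo
    0
    0
    (!![3, 0, 0, 0, 0; 0, 0, 0, -3, 0])
    (!![0, 0, 0, 0, 0, 0, 0, 0, 0, 0; 0, 0, 0, 2, 0, 0, 0, 0, 0, 0; 0, 0, 0, 0, 0, 0, 3, 0, 0, 0;
      0, 0, 0, 0, 0, 0, 0, 0, 0, 0; 0, 0, 0, 0, 0, 0, 0, 0, -6, 0])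
    6 (by decide) (by decide +kernel) (by decide +kernel)
    (by decide +kernel) (by decide +kernel)

theorem nonempty_basicH_three_equiv : Nonempty (basicH 3 ≃ₗ[ℂ] (Fin 2 → ℂ)) :=
  nonempty_basicH_equiv_of_contraction isWeightZeroBasis_tuplesTwo
    isWeightZeroBasis_tuplesThree isWeightZeroBasis_tuplesFour
    diffMatrix_tuplesTwo diffMatrix_tuplesThree
    (!![12, 0, 0, 0, 0, 0, 0, 0, 0, 0; 0, 0, 12, -4, 0, 0, -12, 0, 0, 0])
    (!![1, 0; 0, 0; 0, 1; 0, 0; 0, 0; 0, 0; 0, 0; 0, 0; 0, 0; 0, 0])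
    (!![0, 0, 0, 0, 0, 0, 0, 0, 0, 0; 0, 0, 0, 4, 0, 0, 0, 0, 0, 0; 0, 0, 0, 0, 0, 0, 6, 0, 0, 0;
      0, 0, 0, 0, 0, 0, 0, 0, 0, 0; 0, 0, 0, 0, 0, 0, 0, 0, -12, 0])
    (!![0, 0, 0, 0, 0, 0, 0, 0, 0; 0, -4, 0, 0, 0, 0, 0, 0, 0; 0, 0, 0, 0, 0, 0, 0, 0, 0; 0, 0, 0,
      0, 0, 0, 0, 0, 0; 0, 0, 0, 0, 9, 6, 0, -18, 0; 0, 0, 0, 0, 6, 0, 0, -12, 0; 0, 0, 0, 0,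
      0, 0, 0, 0, 0; 0, 0, 0, 0, 0, 0, 0, 12, 0; 0, 0, 0, 0, 0, 0, 0, 0, 0; 0, 0, 0, 0, 0, 0,
      4, 0, 0])
    12 (by decide) (by decide +kernel) (by decide +kernel)
    (by decide +kernel) (by decide +kernel)

theorem nonempty_basicH_four_equiv : Nonempty (basicH 4 ≃ₗ[ℂ] (Fin 1 → ℂ)) :=
  nonempty_basicH_equiv_of_contraction isWeightZeroBasis_tuplesThree
    isWeightZeroBasis_tuplesFour isWeightZeroBasis_tuplesFive
    diffMatrix_tuplesThree diffMatrix_tuplesFour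
    (!![12, -4, 0, 0, 0, 0, 0, 0, 0])
    (!![1; 0; 0; 0; 0; 0; 0; 0; 0])
    (!![0, 0, 0, 0, 0, 0, 0, 0, 0; 0, -4, 0, 0, 0, 0, 0, 0, 0; 0, 0, 0, 0, 0, 0, 0, 0, 0; 0, 0, 0,
      0, 0, 0, 0, 0, 0; 0, 0, 0, 0, 9, 6, 0, -18, 0; 0, 0, 0, 0, 6, 0, 0, -12, 0; 0, 0, 0, 0,
      0, 0, 0, 0, 0; 0, 0, 0, 0, 0, 0, 0, 12, 0; 0, 0, 0, 0, 0, 0, 0, 0, 0; 0, 0, 0, 0, 0, 0,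
      4, 0, 0])
    (!![0, 0, 0, 0; 0, 0, 0, 0; -9, -6, 0, 0; -6, 0, 0, 0; 0, 0, 0, 0; 0, 0, 0, 0; 0, 0, 0, 0; 0,
      0, 0, 0; 0, 0, 0, 6])
    12 (by decide) (by decide +kernel) (by decide +kernel)
    (by decide +kernel) (by decide +kernel)

theorem nonempty_basicH_five_equiv : Nonempty (basicH 5 ≃ₗ[ℂ] (Fin 1 → ℂ)) :=
  nonempty_basicH_equiv_of_contraction isWeightZeroBasis_tuplesFour
    isWeightZeroBasis_tuplesFive isWeightZeroBasis_tuplesSix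
    diffMatrix_tuplesFour diffMatrix_tuplesFive
    (!![0, 0, 4, -6])
    (!![0; 0; 1; 0])
    (!![0, 0, 0, 0; 0, 0, 0, 0; -3, -2, 0, 0; -2, 0, 0, 0; 0, 0, 0, 0; 0, 0, 0, 0; 0, 0, 0, 0; 0,
      0, 0, 0; 0, 0, 0, 2])
    0
    4 (by decide) (by decide +kernel) (by decide +kernel)
    (by decide +kernel) (by decide +kernel)

theorem nonempty_basicH_six_equiv : Nonempty (basicH 6 ≃ₗ[ℂ] (Fin 1 → ℂ)) :=
  nonempty_basicH_equiv_of_contraction isWeightZeroBasis_tuplesFive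
    isWeightZeroBasis_tuplesSix isWeightZeroBasis_tuplesSeven
    diffMatrix_tuplesFive diffMatrix_tuplesSix
    (!![1])
    (!![1])
    0
    0
    1 (by decide) (by decide +kernel) (by decide +kernel)
    (by decide +kernel) (by decide +kernel)

end WeightZero

/-! ### Dimensions of the reduced cohomology -/

theorem nonempty_basicH_equiv_of_six_le {q : ℕ} (hq : 6 ≤ q) :
    Nonempty (basicH (q + 1) ≃ₗ[ℂ] (Fin 0 → ℂ)) := by
  refine nonempty_basicH_equiv 0 (fun v => ⟨0, Submodule.zero_mem _, ?_, Subsingleton.elim _ _⟩)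
    (fun _ _ => rfl) fun z hz hd _ => exists_diff_eq_of_wt hz hd fun Y hw => ?_
  · simpa using (coeffBracket ℂ).diff_smul 0 (0 : (Fin (q + 1) → Fin 2 × ℕ) → ℂ)
  · refine hz.1.eq_zero_of_not_injective fun hY => ?_
    have hs : ∑ x ∈ Finset.univ.image Y, (1 - (x.2 : ℤ)) = 0 := by
      rwa [Finset.sum_image fun i _ j _ h => hY h]
    have hc : (Finset.univ.image Y).card = q + 1 := by
      rw [Finset.card_image_of_injective _ hY, Finset.card_univ, Fintype.card_fin]
    have h6 : ∀ S ∈ ((Finset.univ : Finset (Fin 2)) ×ˢ Finset.range 4).powerset,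
        ∑ x ∈ S, (1 - (x.2 : ℤ)) = 0 → S.card ≤ 6 := by decide +kernel
    have := h6 _ (Finset.mem_powerset.2 (snd_lt_four_of_sum_eq_zero hs)) hs
    omega

theorem nonempty_reducedH_equiv {q h h' : ℕ} (e : Nonempty (basicH (q + 1) ≃ₗ[ℂ] (Fin h → ℂ)))
    (e' : Nonempty (basicH (q + 2) ≃ₗ[ℂ] (Fin h' → ℂ))) :
    Nonempty (reducedH (q + 1) ≃ₗ[ℂ] ((Fin h → ℂ) × (Fin h' → ℂ))) :=
  ⟨(reducedHEquiv q).symm.trans (e.some.prodCongr e'.some)⟩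

theorem finrank_reducedH {q h h' : ℕ} (e : Nonempty (basicH (q + 1) ≃ₗ[ℂ] (Fin h → ℂ)))
    (e' : Nonempty (basicH (q + 2) ≃ₗ[ℂ] (Fin h' → ℂ))) :
    Module.finrank ℂ (reducedH (q + 1)) = h + h' := by
  rw [(nonempty_reducedH_equiv e e').some.finrank_eq, Module.finrank_prod, Module.finrank_fin_fun,
    Module.finrank_fin_fun]

theorem subsingleton_reducedH {q : ℕ} (e : Nonempty (basicH (q + 1) ≃ₗ[ℂ] (Fin 0 → ℂ)))
    (e' : Nonempty (basicH (q + 2) ≃ₗ[ℂ] (Fin 0 → ℂ))) : Subsingleton (reducedH (q + 1)) :=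
  (nonempty_reducedH_equiv e e').some.toEquiv.subsingleton

theorem finrank_reducedH_zero : Module.finrank ℂ (reducedH 0) = 1 := by
  have hpa : paW 0 = 0 := by
    ext γ X l
    simp [paW]
  have hd : dWLin 0 = 0 := by
    ext γ X l
    have : ∀ p : Fin (0 + 1) × Fin (0 + 1), ¬ p.1 < p.2 := by decide
    simp [dWLin, dW, this]
  have hB : redB 0 = ⊥ := by rw [redB, hpa, Submodule.map_zero]
  have hmem : ∀ γ : WCochain 0, γ ∈ redZ 0 := fun γ => by
    refine ⟨⟨fun X => ⟨C (γ X 0), fun l => ?_⟩, fun σ X l => ?_⟩, ?_⟩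
    · rw [eval_C, Subsingleton.elim l 0]
    · rw [Subsingleton.elim (X ∘ σ) X, Subsingleton.elim (l ∘ σ) l, Subsingleton.elim σ 1]
      simp
    · change dWLin 0 γ ∈ Submodule.map (paW 1) (cochainSub 1)
      rw [hd]
      exact Submodule.zero_mem _
  have hcomap : Submodule.comap (redZ 0).subtype (redB 0) = ⊥ := by
    rw [hB, Submodule.comap_bot, Submodule.ker_subtype]
  have htop : redZ 0 = ⊤ := Submodule.eq_top_iff'.2 hmem
  have e : WCochain 0 ≃ₗ[ℂ] ℂ :=
    { toFun := fun γ => γ 0 0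
      invFun := fun c _ _ => c
      map_add' := fun _ _ => rfl
      map_smul' := fun _ _ => rfl
      left_inv := fun γ => by
        funext X l
        rw [Subsingleton.elim X 0, Subsingleton.elim l 0]
      right_inv := fun _ => rfl }
  rw [((Submodule.quotEquivOfEqBot _ hcomap).trans
    ((LinearEquiv.ofTop _ htop).trans e)).finrank_eq, Module.finrank_self]

/-- the reduced cohomology of the W(2,2) Lie conformal algebra
`𝒲` with trivial coefficients `ℂ`: `dim H⁰ = 1`, `H¹ = 0`, `dim H² = 2`,
`dim H³ = 3`, `dim H⁴ = dim H⁵ = 2`, `dim H⁶ = 1`, and `H^q = 0` for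
`q ≥ 7`. -/
theorem stmt13 :
    Module.finrank ℂ (reducedH 0) = 1 ∧
    Subsingleton (reducedH 1) ∧
    Module.finrank ℂ (reducedH 2) = 2 ∧
    Module.finrank ℂ (reducedH 3) = 3 ∧
    Module.finrank ℂ (reducedH 4) = 2 ∧
    Module.finrank ℂ (reducedH 5) = 2 ∧
    Module.finrank ℂ (reducedH 6) = 1 ∧
    ∀ q : ℕ, 7 ≤ q → Subsingleton (reducedH q) := by
  open WeightZero in
  refine ⟨finrank_reducedH_zero,
    subsingleton_reducedH nonempty_basicH_one_equiv nonempty_basicH_two_equiv,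
    finrank_reducedH nonempty_basicH_two_equiv nonempty_basicH_three_equiv,
    finrank_reducedH nonempty_basicH_three_equiv nonempty_basicH_four_equiv,
    finrank_reducedH nonempty_basicH_four_equiv nonempty_basicH_five_equiv,
    finrank_reducedH nonempty_basicH_five_equiv nonempty_basicH_six_equiv,
    finrank_reducedH nonempty_basicH_six_equiv (nonempty_basicH_equiv_of_six_le le_rfl),
    fun q hq => ?_⟩
  obtain ⟨q, rfl⟩ : ∃ k, q = k + 1 := ⟨q - 1, by omega⟩
  exact subsingleton_reducedH (nonempty_basicH_equiv_of_six_le (by omega))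
    (nonempty_basicH_equiv_of_six_le (by omega))
end
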